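/- arXiv:1804.06791 — 3 statements merged into one kernel-verified Lean document; each statement's English description precedes it below -/
import Mathlib

section
/- For all r > 0 and η > 0 there exist n₀ ∈ ℕ and γ > 0 such that the following holds. Let G be a graph of order n > n₀ and let T be a tree of order k with colour classes V₁, V₂ such that |V₁| ≤ rk and every vertex v ∈ V₂ has degree at most γk in T. If δ(G) ≥ rk + ηn and at least ηn vertices of G have degree at least k + ηn, then G contains T. -/
open SimpleGraph Finset

/-- The degree of a vertex `v` in a graph `G` (number of neighbours). -/
noncomputable def degree' {V : Type*} (G : SimpleGraph V) (v : V) : ℕ :=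
  (G.neighborSet v).ncard

/-- `G` contains `T` if there is an injective map of the vertices of `T` into those of
`G` mapping edges of `T` to edges of `G`. -/
def Contains {V W : Type*} (G : SimpleGraph V) (T : SimpleGraph W) : Prop :=
  ∃ φ : W → V, Function.Injective φ ∧ ∀ ⦃x y⦄, T.Adj x y → G.Adj (φ x) (φ y)

/-- A tree, rooted at `ρ`, has a parent map and a depth function. -/
lemma SimpleGraph.IsTree.exists_parent {V : Type*} {T : SimpleGraph V} (hT : T.IsTree) (ρ : V) :
    ∃ (p : V → V) (dep : V → ℕ), (∀ v, v ≠ ρ → dep (p v) < dep v) ∧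
      (∀ v, v ≠ ρ → T.Adj v (p v)) ∧
      ∀ x y, T.Adj x y → (x ≠ ρ ∧ p x = y) ∨ (y ≠ ρ ∧ p y = x) := by
  classical
  have hpath : ∀ v, ∃ q : T.Walk v ρ, q.IsPath ∧ q.length = T.dist v ρ :=
    fun v => hT.connected.exists_path_of_dist v ρ
  choose q hq hlen using hpath
  have huniq : ∀ {v} (q' : T.Walk v ρ), q'.IsPath → q' = q v := fun {v} q' h' =>
    (hT.existsUnique_path v ρ).unique h' (hq v)
  have key : ∀ x y, T.Adj x y → T.dist x ρ = T.dist y ρ + 1 → x ≠ ρ ∧ (q x).snd = y := by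
    intro x y hxy hd
    refine ⟨fun h => by subst h; simp at hd, ?_⟩
    have hx : x ∉ (q y).support := by
      intro hx
      have h1 := SimpleGraph.dist_le ((q y).dropUntil x hx)
      have h2 := (q y).length_dropUntil_le_length hx
      rw [hlen] at h2
      omega
    have := huniq (Walk.cons hxy (q y)) ((hq y).cons hx)
    rw [← this]
    simp
  have hadj : ∀ v, v ≠ ρ → T.Adj v (q v).snd := fun v hv =>
    (q v).adj_snd (Walk.not_nil_of_ne hv)
  have hdist : ∀ x y, T.Adj x y → T.dist x ρ = T.dist y ρ + 1 ∨ T.dist y ρ = T.dist x ρ + 1 := by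
    intro x y hxy
    have := hT.dist_eq_dist_add_one_of_adj ρ hxy
    rw [T.dist_comm (u := x), T.dist_comm (u := y)]
    omega
  refine ⟨fun v => (q v).snd, fun v => T.dist v ρ, fun v hv => ?_, hadj, fun x y hxy => ?_⟩
  · have h1 := SimpleGraph.dist_le (q v).tail
    have h2 := (q v).length_tail_add_one (Walk.not_nil_of_ne hv)
    have h3 : (q v).length = T.dist v ρ := hlen v
    show T.dist (q v).snd ρ < T.dist v ρ
    omega
  · rcases hdist x y hxy with h | h
    · exact Or.inl (key x y hxy h)
    · exact Or.inr (key y x hxy.symm h)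

/-- `Below p W u v`: the vertex `u` is reached from `v` by iterating `p` without meeting `W`. -/
inductive Below {V : Type*} (p : V → V) (W : Finset V) (u : V) : V → Prop
  | refl : u ∉ W → Below p W u u
  | step {v : V} : v ∉ W → Below p W u (p v) → Below p W u v

namespace Below

variable {V : Type*} {p : V → V} {W W' : Finset V} {u v : V}

lemma right_notMem (h : Below p W u v) : v ∉ W := by
  cases h <;> assumption

lemma left_notMem (h : Below p W u v) : u ∉ W := by
  induction h <;> assumption

lemma mono (hW : W ⊆ W') (h : Below p W' u v) : Below p W u v := by
  induction h with
  | refl h => exact .refl fun h' => h (hW h')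
  | step h _ ih => exact .step (fun h' => h (hW h')) ih

lemma dep_le {ρ : V} {dep : V → ℕ} (hdep : ∀ v, v ≠ ρ → dep (p v) < dep v) (hρ : ρ ∈ W)
    (h : Below p W u v) : dep u ≤ dep v := by
  induction h with
  | refl h => exact le_rfl
  | @step v h _ ih =>
    have := hdep v (fun e => h (e ▸ hρ))
    omega

lemma eq_of_dep_le {ρ : V} {dep : V → ℕ} (hdep : ∀ v, v ≠ ρ → dep (p v) < dep v) (hρ : ρ ∈ W)
    (h : Below p W u v) (hd : dep v ≤ dep u) : v = u := by
  cases h with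
  | refl h => rfl
  | step h h' =>
    have := hdep v (fun e => h (e ▸ hρ))
    have := h'.dep_le hdep hρ
    omega

lemma eq_of_parent_mem {x y : V} (hx : p x ∈ W) (hy : p y ∈ W) (h : Below p W x v)
    (h' : Below p W y v) : x = y := by
  induction h with
  | refl h =>
    cases h' with
    | refl h => rfl
    | step h h' => exact absurd hx h'.right_notMem
  | step h h₁ ih =>
    cases h' with
    | refl h => exact absurd hy h₁.right_notMem
    | step h h' => exact ih h'

end Below

/-- A rooted tree in which every vertex outside `V₁` has at most `D` children has a small set
`W ⊆ V₁` of vertices, containing the root, such that the components left after the deletion of `W`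
have at most `τ` vertices. -/
lemma exists_cut {V : Type*} [Fintype V] [DecidableEq V] {ρ : V} {p : V → V} {dep : V → ℕ}
    (hdep : ∀ v, v ≠ ρ → dep (p v) < dep v) (V₁ : Finset V) (hρ : ρ ∈ V₁)
    (halt : ∀ v, v ≠ ρ → (v ∈ V₁ ↔ p v ∉ V₁)) (D τ : ℕ) (hD : 1 ≤ D) (hτ : 1 ≤ τ)
    (hchild : ∀ u, u ∉ V₁ → #{v | v ≠ ρ ∧ p v = u} ≤ D) :
    ∃ W : Finset V, ρ ∈ W ∧ W ⊆ V₁ ∧ #W * τ ≤ τ + D * Fintype.card V ∧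
      ∀ u, {v | Below p W u v}.ncard ≤ τ := by
  classical
  let sub (W : Finset V) (u : V) : Finset V := {v | Below p W u v}
  let X (W : Finset V) : Finset V := {v | ∃ u, Below p W u v ∧ τ < #(sub W u)}
  let Q (W : Finset V) : Prop :=
    ρ ∈ W ∧ W ⊆ V₁ ∧ #W * τ + D * #(X W) ≤ τ + D * Fintype.card V
  have hQ : ∃ W, W ∈ ({W | Q W} : Finset (Finset V)) := by
    refine ⟨{ρ}, ?_⟩
    simp only [Q, mem_filter, mem_univ, true_and, mem_singleton, singleton_subset_iff,
      card_singleton, one_mul]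
    exact ⟨hρ, Nat.add_le_add_left (Nat.mul_le_mul_left _ (card_le_univ _)) _⟩
  obtain ⟨W, hWQ, hmax⟩ := exists_max_image _ card hQ
  simp only [mem_filter, mem_univ, true_and] at hWQ hmax
  obtain ⟨hρW, hWV, hcard⟩ := hWQ
  refine ⟨W, hρW, hWV, le_trans (Nat.le_add_right _ _) hcard, ?_⟩
  by_contra! hcon
  have hsub : ∀ u, {v | Below p W u v}.ncard = #(sub W u) := by
    intro u
    rw [← Set.ncard_coe_finset]
    simp [sub]
  have hne : ({u | τ < #(sub W u)} : Finset V).Nonempty := by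
    obtain ⟨u, hu⟩ := hcon
    exact ⟨u, by simpa [hsub] using hu⟩
  obtain ⟨u, hu, hdeep⟩ := exists_max_image _ dep hne
  simp only [mem_filter, mem_univ, true_and] at hu hdeep
  have hsubmono : ∀ {W'}, W ⊆ W' → ∀ u, sub W' u ⊆ sub W u := by
    intro W' hW' u v hv
    simp only [sub, mem_filter, mem_univ, true_and] at hv ⊢
    exact hv.mono hW'
  have hXmono : ∀ {W'}, W ⊆ W' → X W' ⊆ X W := by
    intro W' hW' v hv
    simp only [X, mem_filter, mem_univ, true_and] at hv ⊢
    obtain ⟨u', h1, h2⟩ := hv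
    exact ⟨u', h1.mono hW', h2.trans_le (card_le_card (hsubmono hW' u'))⟩
  have hsubX : sub W u ⊆ X W := by
    intro v hv
    simp only [sub, X, mem_filter, mem_univ, true_and] at hv ⊢
    exact ⟨u, hv, hu⟩
  have huW : u ∉ W := by
    obtain ⟨v, hv⟩ := card_pos.1 (lt_of_le_of_lt (Nat.zero_le _) hu)
    simp only [sub, mem_filter, mem_univ, true_and] at hv
    exact hv.left_notMem
  have huu : u ∈ sub W u := by simpa [sub] using Below.refl huW
  -- enlarging `W` by `S` removes `sub W u`, except possibly `u`, from the bad set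
  have main : ∀ S : Finset V, S.Nonempty → Disjoint W S → S ⊆ V₁ → #S ≤ D →
      (∀ v ∈ sub W u, v ≠ u → ∀ u', Below p (W ∪ S) u' v → ¬ dep u' ≤ dep u) → False := by
    intro S hS hWS hSV hSD hkill
    have h1 : X (W ∪ S) ⊆ X W \ (sub W u).erase u := by
      intro v hv
      rw [mem_sdiff]
      refine ⟨hXmono subset_union_left hv, fun hv' => ?_⟩
      rw [mem_erase] at hv'
      simp only [X, mem_filter, mem_univ, true_and] at hv
      obtain ⟨u', h1, h2⟩ := hv
      exact hkill v hv'.2 hv'.1 u' h1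
        (hdeep u' (h2.trans_le (card_le_card (hsubmono subset_union_left u'))))
    have h2 := card_le_card h1
    rw [card_sdiff_of_subset ((erase_subset _ _).trans hsubX), card_erase_of_mem huu] at h2
    have h3 := card_le_card hsubX
    have h4 : #(W ∪ S) = #W + #S := card_union_of_disjoint hWS
    have h5 : #(X (W ∪ S)) + τ ≤ #(X W) := by omega
    have h6 : Q (W ∪ S) := by
      refine ⟨mem_union_left _ hρW, union_subset hWV hSV, le_trans ?_ hcard⟩
      rw [h4]
      have h7 : #S * τ ≤ D * τ := Nat.mul_le_mul_right _ hSD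
      have h8 : D * (#(X (W ∪ S)) + τ) ≤ D * #(X W) := Nat.mul_le_mul_left _ h5
      nlinarith
    have h7 := hmax _ h6
    have h8 := hS.card_pos
    omega
  by_cases huV : u ∈ V₁
  · refine main {u} (singleton_nonempty _) (disjoint_singleton_right.2 huW)
      (singleton_subset_iff.2 huV) (by simpa using hD) ?_
    intro v hv hvu u' h' hd
    simp only [sub, mem_filter, mem_univ, true_and] at hv
    have : u ∉ W ∪ {u} := by
      clear hvu
      induction h' with
      | refl h =>
        have e := hv.eq_of_dep_le hdep hρW hd
        exact fun hh => h (by rw [e]; exact hh)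
      | step h _ ih =>
        cases hv with
        | refl _ => exact h
        | step _ hv => exact ih hv
    simp at this
  · refine main {v | (v ≠ ρ ∧ p v = u) ∧ v ∉ W} ?_ ?_ ?_ ?_ ?_
    · by_contra hemp
      rw [not_nonempty_iff_eq_empty] at hemp
      have : sub W u ⊆ {u} := by
        intro v hv
        simp only [sub, mem_filter, mem_univ, true_and] at hv
        rw [mem_singleton]
        induction hv with
        | refl h => rfl
        | @step v h h' ih =>
          have : v ∈ ({v | (v ≠ ρ ∧ p v = u) ∧ v ∉ W} : Finset V) := by
            simp only [mem_filter, mem_univ, true_and]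
            exact ⟨⟨fun e => h (e ▸ hρW), ih⟩, h⟩
          rw [hemp] at this
          simp at this
      have := card_le_card this
      rw [card_singleton] at this
      omega
    · rw [Finset.disjoint_left]
      intro v hv hv'
      simp only [mem_filter, mem_univ, true_and] at hv'
      exact hv'.2 hv
    · intro v hv
      simp only [mem_filter, mem_univ, true_and] at hv
      rw [halt v hv.1.1, hv.1.2]
      exact huV
    · refine le_trans (card_le_card ?_) (hchild u huV)
      intro v hv
      simp only [mem_filter, mem_univ, true_and] at hv ⊢
      exact hv.1
    · intro v hv hvu u' h' hd
      simp only [sub, mem_filter, mem_univ, true_and] at hv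
      induction h' with
      | refl h => exact hvu (hv.eq_of_dep_le hdep hρW hd)
      | @step v h _ ih =>
        cases hv with
        | refl _ => exact hvu rfl
        | step hvW hv =>
          by_cases hpu : p v = u
          · refine h (mem_union_right _ ?_)
            simp only [mem_filter, mem_univ, true_and]
            exact ⟨⟨fun e => hvW (e ▸ hρW), hpu⟩, hvW⟩
          · exact ih hpu hv

/-- The map sending a vertex outside `W` to the top vertex of its component. -/
lemma exists_top {V : Type*} {ρ : V} {p : V → V} {dep : V → ℕ}
    (hdep : ∀ v, v ≠ ρ → dep (p v) < dep v) {W : Finset V} (hρ : ρ ∈ W) :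
    ∃ top : V → V, ∀ v, v ∉ W → top v ∉ W ∧ p (top v) ∈ W ∧ Below p W (top v) v ∧
      (p v ∈ W → top v = v) ∧ (p v ∉ W → top v = top (p v)) := by
  classical
  have hex : ∀ v, ∃ x, v ∉ W → x ∉ W ∧ p x ∈ W ∧ Below p W x v := by
    intro v
    induction hn : dep v using Nat.strong_induction_on generalizing v with
    | _ n ih =>
      by_cases hv : v ∈ W
      · exact ⟨v, fun h => absurd hv h⟩
      by_cases hpv : p v ∈ W
      · exact ⟨v, fun h => ⟨h, hpv, .refl h⟩⟩
      · obtain ⟨x, hx⟩ := ih (dep (p v)) (hn ▸ hdep v fun e => hv (e ▸ hρ)) (p v) rfl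
        obtain ⟨h1, h2, h3⟩ := hx hpv
        exact ⟨x, fun h => ⟨h1, h2, .step h h3⟩⟩
  choose top htop using hex
  refine ⟨top, fun v hv => ?_⟩
  obtain ⟨h1, h2, h3⟩ := htop v hv
  refine ⟨h1, h2, h3, fun h => h3.eq_of_parent_mem h2 h (.refl hv), fun h => ?_⟩
  obtain ⟨h4, h5, h6⟩ := htop (p v) h
  exact h3.eq_of_parent_mem h2 h5 (.step hv h6)

/-- `φ` embeds the parent-closed set `D` of a rooted tree into `G`. -/
def IsPartialEmb {V U : Type*} (G : SimpleGraph U) (p : V → V) (ρ : V) (D : Finset V)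
    (φ : V → U) : Prop :=
  Set.InjOn φ D ∧ ∀ v ∈ D, v ≠ ρ → p v ∈ D ∧ G.Adj (φ (p v)) (φ v)

section Embedding

variable {V U : Type*} [DecidableEq V] {G : SimpleGraph U}
  {p : V → V} {ρ : V} {dep : V → ℕ} {φ : V → U} {D : Finset V}

lemma IsPartialEmb.insert_vertex (hφ : IsPartialEmb G p ρ D φ) {v : V} (hv : v ∉ D) {y : U}
    (hy : ∀ u ∈ D, φ u ≠ y) (hp : v ≠ ρ → p v ∈ D ∧ G.Adj (φ (p v)) y) :
    IsPartialEmb G p ρ (insert v D) (Function.update φ v y) := by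
  have hne : ∀ u ∈ D, u ≠ v := fun u hu e => hv (e ▸ hu)
  refine ⟨?_, ?_⟩
  · intro u hu w hw huw
    simp only [coe_insert, Set.mem_insert_iff, mem_coe] at hu hw
    rcases hu with rfl | hu <;> rcases hw with rfl | hw
    · rfl
    · rw [Function.update_self, Function.update_of_ne (hne w hw)] at huw
      exact absurd huw.symm (hy w hw)
    · rw [Function.update_self, Function.update_of_ne (hne u hu)] at huw
      exact absurd huw (hy u hu)
    · rw [Function.update_of_ne (hne u hu), Function.update_of_ne (hne w hw)] at huw
      exact hφ.1 hu hw huw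
  · intro u hu huρ
    rcases mem_insert.1 hu with rfl | hu
    · obtain ⟨h1, h2⟩ := hp huρ
      refine ⟨mem_insert_of_mem h1, ?_⟩
      rwa [Function.update_self, Function.update_of_ne (hne _ h1)]
    · obtain ⟨h1, h2⟩ := hφ.2 u hu huρ
      refine ⟨mem_insert_of_mem h1, ?_⟩
      rwa [Function.update_of_ne (hne u hu), Function.update_of_ne (hne _ h1)]

variable [DecidableEq U] [DecidableRel G.Adj]

/-- Greedy extension of a partial embedding. -/
lemma IsPartialEmb.exists_extend (hdep : ∀ v, v ≠ ρ → dep (p v) < dep v)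
    (hφ : IsPartialEmb G p ρ D φ) {K : Finset V} (hDK : Disjoint D K) (hρ : ρ ∉ K)
    (hp : ∀ v ∈ K, p v ∈ D ∪ K) {t : V → Finset U} (ht : ∀ v ∈ K, ∀ u ∈ D, φ u ∉ t v)
    (hD : ∀ v ∈ K, p v ∈ D → #K ≤ #{z ∈ t v | G.Adj (φ (p v)) z})
    (hK : ∀ v ∈ K, p v ∈ K → ∀ y ∈ t (p v), #K ≤ #{z ∈ t v | G.Adj y z}) :
    ∃ φ' : V → U, (∀ v ∈ D, φ' v = φ v) ∧ IsPartialEmb G p ρ (D ∪ K) φ' ∧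
      ∀ v ∈ K, φ' v ∈ t v := by
  suffices H : ∀ j ≤ #K, ∃ K' ⊆ K, #K' = j ∧ ∃ φ' : V → U, (∀ v ∈ D, φ' v = φ v) ∧
      IsPartialEmb G p ρ (D ∪ K') φ' ∧ ∀ v ∈ K', φ' v ∈ t v by
    obtain ⟨K', hK', hc, H⟩ := H _ le_rfl
    rwa [eq_of_subset_of_card_le hK' hc.ge] at H
  intro j
  induction j with
  | zero => exact fun _ => ⟨∅, empty_subset _, rfl, φ, fun _ _ => rfl, by simpa using hφ, by simp⟩
  | succ j ih =>
    intro hj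
    obtain ⟨K', hK', hc, φ', hext, hφ', ht'⟩ := ih (by omega)
    have hne : (K \ K').Nonempty := by
      rw [← card_pos, card_sdiff_of_subset hK']
      omega
    obtain ⟨v, hv, hmin⟩ := exists_min_image _ dep hne
    rw [mem_sdiff] at hv
    have hvρ : v ≠ ρ := fun e => hρ (e ▸ hv.1)
    have hpv : p v ∈ D ∪ K' := by
      rcases mem_union.1 (hp v hv.1) with h | h
      · exact mem_union_left _ h
      · refine mem_union_right _ (by_contra fun h' => ?_)
        have := hmin (p v) (mem_sdiff.2 ⟨h, h'⟩)
        have := hdep v hvρ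
        omega
    have hlarge : #K ≤ #{z ∈ t v | G.Adj (φ' (p v)) z} := by
      rcases mem_union.1 hpv with h | h
      · rw [hext _ h]; exact hD v hv.1 h
      · exact hK v hv.1 (hK' h) _ (ht' _ h)
    obtain ⟨y, hy, hyK⟩ : ∃ y ∈ ({z ∈ t v | G.Adj (φ' (p v)) z} : Finset U), y ∉ K'.image φ' := by
      refine exists_mem_notMem_of_card_lt_card (lt_of_le_of_lt card_image_le ?_)
      omega
    rw [mem_filter] at hy
    have hvD : v ∉ D ∪ K' := by
      rw [mem_union, not_or]
      exact ⟨fun h => Finset.disjoint_left.1 hDK h hv.1, hv.2⟩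
    have hneq : ∀ u ∈ D ∪ K', u ≠ v := fun u hu e => hvD (e ▸ hu)
    refine ⟨insert v K', insert_subset hv.1 hK', by rw [card_insert_of_notMem hv.2, hc],
      Function.update φ' v y, ?_, ?_, ?_⟩
    · intro u hu
      rw [Function.update_of_ne (hneq u (mem_union_left _ hu)), hext u hu]
    · rw [union_insert]
      refine hφ'.insert_vertex hvD (fun u hu => ?_) fun _ => ⟨hpv, hy.2⟩
      rcases mem_union.1 hu with h | h
      · rw [hext u h]
        exact fun e => ht v hv.1 u h (e ▸ hy.1)
      · exact fun e => hyK (mem_image.2 ⟨u, h, e⟩)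
    · intro u hu
      rcases mem_insert.1 hu with rfl | hu
      · rw [Function.update_self]; exact hy.1
      · rw [Function.update_of_ne (hneq u (mem_union_right _ hu))]
        exact ht' u hu

/-- Embedding the components hanging from the vertex `a`: the component `comp x`
is embedded with its vertices outside `V₁` in `S (f x)` and its vertices in `V₁` in `R (g x)`. -/
lemma IsPartialEmb.exists_extend_components {ι : Type*} [DecidableEq ι]
    (hdep : ∀ v, v ≠ ρ → dep (p v) < dep v) (hφ : IsPartialEmb G p ρ D φ) {V₁ : Finset V}
    {a : V} {comp : V → Finset V} {f g : V → ι} {S R : ι → Finset U} {s : ι → ℝ} {τ : ℕ}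
    (hSS : ∀ i j, i ≠ j → Disjoint (S i) (S j)) (hRR : ∀ i j, i ≠ j → Disjoint (R i) (R j))
    (hSR : ∀ i j, Disjoint (S i) (R j)) (hS : ∀ i, ∀ u ∈ D, φ u ∉ S i)
    (hR : ∀ i, ∀ u ∈ D, φ u ∉ R i) (J : Finset V)
    (hdisj : ∀ x ∈ J, ∀ x' ∈ J, x ≠ x' → Disjoint (comp x) (comp x'))
    (hDcomp : ∀ x ∈ J, Disjoint D (comp x)) (hρ : ∀ x ∈ J, ρ ∉ comp x)
    (hp : ∀ x ∈ J, ∀ v ∈ comp x, (p v = a ∧ a ∈ D ∧ v ∉ V₁) ∨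
      (p v ∈ comp x ∧ (v ∈ V₁ ↔ p v ∉ V₁)))
    (hτ : ∀ x ∈ J, #(comp x) ≤ τ) (hadj : ∀ x ∈ J, ∀ z ∈ S (f x), G.Adj (φ a) z)
    (hScard : ∀ x ∈ J, (∑ x' ∈ J with f x' = f x, (#{v ∈ comp x' | v ∉ V₁} : ℝ)) + s (f x) ≤
      #(S (f x)))
    (hRcard : ∀ x ∈ J, (∑ x' ∈ J with g x' = g x, (#{v ∈ comp x' | v ∈ V₁} : ℝ)) + s (g x) ≤
      #(R (g x)))
    (hpair : ∀ x ∈ J, ∀ S' ⊆ S (f x), ∀ R' ⊆ R (g x), s (f x) ≤ #S' → s (g x) ≤ #R' →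
      ∃ X ⊆ S', ∃ Y ⊆ R', τ ≤ #X ∧ (∀ b ∈ X, τ ≤ #{z ∈ Y | G.Adj b z}) ∧
        ∀ c ∈ Y, τ ≤ #{z ∈ X | G.Adj c z}) :
    ∃ φ' : V → U, (∀ v ∈ D, φ' v = φ v) ∧ IsPartialEmb G p ρ (D ∪ J.biUnion comp) φ' ∧
      ∀ x ∈ J, ∀ v ∈ comp x, (v ∈ V₁ → φ' v ∈ R (g x)) ∧ (v ∉ V₁ → φ' v ∈ S (f x)) := by
  suffices H : ∀ J' ⊆ J, ∃ φ' : V → U, (∀ v ∈ D, φ' v = φ v) ∧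
      IsPartialEmb G p ρ (D ∪ J'.biUnion comp) φ' ∧
      ∀ x ∈ J', ∀ v ∈ comp x, (v ∈ V₁ → φ' v ∈ R (g x)) ∧ (v ∉ V₁ → φ' v ∈ S (f x)) from
    H J Subset.rfl
  intro J'
  induction J' using Finset.induction_on with
  | empty => exact fun _ => ⟨φ, fun _ _ => rfl, by simpa using hφ, by simp⟩
  | insert x J' hxJ' ih =>
    intro hJ'
    obtain ⟨φ', hext, hφ', hmem⟩ := ih ((subset_insert _ _).trans hJ')
    have hx : x ∈ J := hJ' (mem_insert_self _ _)
    have hJ'J : J' ⊆ J := (subset_insert _ _).trans hJ'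
    -- the room left in a target set
    have avail : ∀ (Q : Finset U) (h : V → ι) (P : V → Prop) [DecidablePred P],
        (∀ u ∈ D, φ u ∉ Q) →
        (∀ x' ∈ J', ∀ v ∈ comp x', φ' v ∈ Q → h x' = h x ∧ P v) →
        (∑ x' ∈ J with h x' = h x, (#{v ∈ comp x' | P v} : ℝ)) + s (h x) ≤ #Q →
        s (h x) ≤ #(Q \ (D ∪ J'.biUnion comp).image φ') := by
      intro Q h P _ hQD hQ hcard
      have h1 : Q ∩ (D ∪ J'.biUnion comp).image φ' ⊆
          ({x' ∈ J' | h x' = h x}.biUnion fun x' => {v ∈ comp x' | P v}).image φ' := by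
        intro z hz
        simp only [mem_inter, mem_image, mem_union, mem_biUnion] at hz
        obtain ⟨hzQ, v, hv | ⟨x', hx', hv⟩, rfl⟩ := hz
        · rw [hext v hv] at hzQ
          exact absurd hzQ (hQD v hv)
        · obtain ⟨h2, h3⟩ := hQ x' hx' v hv hzQ
          exact mem_image_of_mem _ (mem_biUnion.2 ⟨x', mem_filter.2 ⟨hx', h2⟩,
            mem_filter.2 ⟨hv, h3⟩⟩)
      have h2 : #(Q ∩ (D ∪ J'.biUnion comp).image φ') ≤
          ∑ x' ∈ J' with h x' = h x, #{v ∈ comp x' | P v} :=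
        (card_le_card h1).trans (card_image_le.trans card_biUnion_le)
      have h3 : ∑ x' ∈ J' with h x' = h x, #{v ∈ comp x' | P v} ≤
          ∑ x' ∈ J with h x' = h x, #{v ∈ comp x' | P v} :=
        sum_le_sum_of_subset (filter_subset_filter _ hJ'J)
      have h4 := card_sdiff_add_card_inter Q ((D ∪ J'.biUnion comp).image φ')
      have h5 : (#Q : ℝ) ≤ #(Q \ (D ∪ J'.biUnion comp).image φ') +
          ∑ x' ∈ J with h x' = h x, (#{v ∈ comp x' | P v} : ℝ) := by
        exact_mod_cast (by omega : #Q ≤ #(Q \ (D ∪ J'.biUnion comp).image φ') +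
          ∑ x' ∈ J with h x' = h x, #{v ∈ comp x' | P v})
      linarith
    have hS' := avail (S (f x)) f (· ∉ V₁) (hS _) (fun x' hx' v hv hvS => by
      by_cases hV : v ∈ V₁
      · exact absurd ((hmem x' hx' v hv).1 hV) (Finset.disjoint_left.1 (hSR _ _) hvS)
      · refine ⟨by_contra fun hne => ?_, hV⟩
        exact Finset.disjoint_left.1 (hSS _ _ hne) ((hmem x' hx' v hv).2 hV) hvS) (hScard x hx)
    have hR' := avail (R (g x)) g (· ∈ V₁) (hR _) (fun x' hx' v hv hvR => by
      by_cases hV : v ∈ V₁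
      · refine ⟨by_contra fun hne => ?_, hV⟩
        exact Finset.disjoint_left.1 (hRR _ _ hne) ((hmem x' hx' v hv).1 hV) hvR
      · exact absurd hvR (Finset.disjoint_left.1 (hSR _ _) ((hmem x' hx' v hv).2 hV))) (hRcard x hx)
    obtain ⟨X, hXS, Y, hYR, hX, hXY, hYX⟩ :=
      hpair x hx _ sdiff_subset _ sdiff_subset hS' hR'
    have hXS' := hXS.trans sdiff_subset
    have hYR' := hYR.trans sdiff_subset
    have hτx := hτ x hx
    obtain ⟨φ'', hext', hφ'', hmem'⟩ := hφ'.exists_extend hdep (K := comp x)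
      (t := fun v => if v ∈ V₁ then Y else X) (by
        rw [disjoint_union_left, disjoint_biUnion_left]
        exact ⟨hDcomp x hx, fun x' hx' => hdisj x' (hJ'J hx') x hx fun e => hxJ' (e ▸ hx')⟩)
      (hρ x hx) (fun v hv => by
        rcases hp x hx v hv with ⟨h1, h2, _⟩ | ⟨h1, _⟩
        · rw [h1]; exact mem_union_left _ (mem_union_left _ h2)
        · exact mem_union_right _ h1)
      (fun v hv u hu h => by
        have hu' := mem_image_of_mem φ' hu
        split_ifs at h
        · exact (mem_sdiff.1 (hYR h)).2 hu'
        · exact (mem_sdiff.1 (hXS h)).2 hu')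
      (fun v hv hpv => by
        rcases hp x hx v hv with ⟨h1, h2, h3⟩ | ⟨h1, _⟩
        · simp only [h3, if_false]
          rw [filter_true_of_mem]
          · omega
          · intro z hz
            rw [h1, hext a h2]
            exact hadj x hx z (hXS' hz)
        · refine absurd hpv ?_
          rw [mem_union, mem_biUnion, not_or]
          refine ⟨fun h => Finset.disjoint_left.1 (hDcomp x hx) h h1, ?_⟩
          rintro ⟨x', hx', h⟩
          exact Finset.disjoint_left.1 (hdisj x' (hJ'J hx') x hx fun e => hxJ' (e ▸ hx')) h h1)
      (fun v hv hpv y hy => by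
        rcases hp x hx v hv with ⟨h1, h2, h3⟩ | ⟨_, h1⟩
        · exact absurd (h1 ▸ hpv) (Finset.disjoint_left.1 (hDcomp x hx) h2)
        · by_cases hV : v ∈ V₁
          · have := h1.1 hV
            simp only [this, if_false] at hy
            simp only [hV, if_true]
            exact hτx.trans (hXY y hy)
          · have : p v ∈ V₁ := by_contra fun h => hV (h1.2 h)
            simp only [this, if_true] at hy
            simp only [hV, if_false]
            exact hτx.trans (hYX y hy))
    refine ⟨φ'', fun v hv => ?_, ?_, ?_⟩
    · rw [hext' v (mem_union_left _ hv), hext v hv]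
    · rwa [biUnion_insert, union_comm (comp x), ← union_assoc]
    · intro x' hx' v hv
      rcases mem_insert.1 hx' with rfl | hx'
      · have := hmem' v hv
        refine ⟨fun h => ?_, fun h => ?_⟩
        · simp only [h, if_true] at this; exact hYR' this
        · simp only [h, if_false] at this; exact hXS' this
      · rw [hext' v (mem_union_right _ (mem_biUnion.2 ⟨x', hx', hv⟩))]
        exact hmem x' hx' v hv

end Embedding

section LowReg

variable {U : Type*} {G : SimpleGraph U} [DecidableRel G.Adj]

/-- One-sided lower regularity of the pair `(X, Y)` with density `d`: few vertices of `X` have few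
neighbours in a given large subset of `Y`. -/
def LowReg {U : Type*} (G : SimpleGraph U) [DecidableRel G.Adj] (ε d : ℝ) (X Y : Finset U) : Prop :=
  ∀ Y' ⊆ Y, ε * #Y ≤ #Y' → (#{x ∈ X | (#{y ∈ Y' | G.Adj x y} : ℝ) < (d - ε) * #Y'} : ℝ) ≤ ε * #X

lemma LowReg.le_card {ε d : ℝ} {X Y : Finset U} (h : LowReg G ε d X Y) {X' Y' : Finset U}
    (hX' : X' ⊆ X) (hY' : Y' ⊆ Y) (hY : ε * #Y ≤ #Y') :
    (#X' : ℝ) - ε * #X ≤ #{x ∈ X' | (d - ε) * #Y' ≤ (#{y ∈ Y' | G.Adj x y} : ℝ)} := by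
  have h1 := h Y' hY' hY
  have h2 : #{x ∈ X' | (#{y ∈ Y' | G.Adj x y} : ℝ) < (d - ε) * #Y'} ≤
      #{x ∈ X | (#{y ∈ Y' | G.Adj x y} : ℝ) < (d - ε) * #Y'} :=
    card_le_card (filter_subset_filter _ hX')
  have h3 := card_filter_add_card_filter_not (s := X')
    fun x => (#{y ∈ Y' | G.Adj x y} : ℝ) < (d - ε) * #Y'
  simp only [not_lt] at h3
  have h4 : (#X' : ℝ) = #{x ∈ X' | (#{y ∈ Y' | G.Adj x y} : ℝ) < (d - ε) * #Y'} +
      #{x ∈ X' | (d - ε) * #Y' ≤ (#{y ∈ Y' | G.Adj x y} : ℝ)} := by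
    exact_mod_cast h3.symm
  have h5 : (#{x ∈ X' | (#{y ∈ Y' | G.Adj x y} : ℝ) < (d - ε) * #Y'} : ℝ) ≤
      #{x ∈ X | (#{y ∈ Y' | G.Adj x y} : ℝ) < (d - ε) * #Y'} := by exact_mod_cast h2
  linarith

/-- Large subsets of the two sides of a regular pair span a bipartite graph of large minimum
degree. -/
lemma LowReg.exists_pair [DecidableEq U] {ε d δ m : ℝ} {B C : Finset U} (hBC : LowReg G ε d B C)
    (hCB : LowReg G ε d C B) (hε : 0 ≤ ε) (hd : d ≤ 1) (hδ0 : 0 ≤ δ) (hd0 : 0 ≤ d)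
    (hεδ : 4 * ε ≤ d * δ) (hm : 0 ≤ m) (hmB : m ≤ #B) (hmC : m ≤ #C)
    {τ : ℕ} (hτ : (τ : ℝ) ≤ d * δ / 2 * m) {S R : Finset U} (hS : S ⊆ B) (hR : R ⊆ C)
    (hSB : δ * #B ≤ #S) (hRC : δ * #C ≤ #R) :
    ∃ X ⊆ S, ∃ Y ⊆ R, τ ≤ #X ∧ (∀ b ∈ X, τ ≤ #{z ∈ Y | G.Adj b z}) ∧
      ∀ c ∈ Y, τ ≤ #{z ∈ X | G.Adj c z} := by
  have hεδ' : 4 * ε ≤ δ := hεδ.trans (mul_le_of_le_one_left hδ0 hd)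
  have half : ∀ {B C S R : Finset U}, LowReg G ε d B C → S ⊆ B → R ⊆ C → m ≤ #B →
      δ * #B ≤ #S → δ * #C ≤ #R →
      (#S : ℝ) - ε * #B ≤ #{b ∈ S | (d - ε) * #R ≤ (#{c ∈ R | G.Adj b c} : ℝ)} := by
    intro B C S R hBC hS hR hmB hSB hRC
    refine hBC.le_card hS hR (le_trans ?_ hRC)
    have : (0 : ℝ) ≤ #C := Nat.cast_nonneg _
    nlinarith
  have cross : ∀ {C R Y : Finset U} (b : U), m ≤ #C → δ * #C ≤ #R → Y ⊆ R → R ⊆ C →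
      (#R : ℝ) - ε * #C ≤ #Y → (d - ε) * #R ≤ (#{c ∈ R | G.Adj b c} : ℝ) →
      τ ≤ #{c ∈ Y | G.Adj b c} := by
    intro C R Y b hmC hRC hYR hRC' hY hb
    have h1 : #{c ∈ R | G.Adj b c} ≤ #{c ∈ Y | G.Adj b c} + #(R \ Y) := by
      refine (card_le_card ?_).trans (card_union_le _ _)
      intro c hc
      rw [mem_filter] at hc
      by_cases hcY : c ∈ Y
      · exact mem_union_left _ (mem_filter.2 ⟨hcY, hc.2⟩)
      · exact mem_union_right _ (mem_sdiff.2 ⟨hc.1, hcY⟩)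
    have h2 := card_sdiff_add_card_eq_card hYR
    have h3 : (#{c ∈ R | G.Adj b c} : ℝ) ≤ #{c ∈ Y | G.Adj b c} + #(R \ Y) := by exact_mod_cast h1
    have h4 : (#(R \ Y) : ℝ) + #Y = #R := by exact_mod_cast h2
    have h5 : (#R : ℝ) ≤ #C := by exact_mod_cast card_le_card hRC'
    have h6 : (τ : ℝ) ≤ #{c ∈ Y | G.Adj b c} := by
      have hC0 : (0 : ℝ) ≤ #C := Nat.cast_nonneg _
      have hdδ : 0 ≤ d * δ := by positivity
      have h7 : d * (δ * #C) ≤ d * #R := mul_le_mul_of_nonneg_left hRC hd0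
      have h8 : ε * #R ≤ ε * #C := mul_le_mul_of_nonneg_left h5 hε
      have h9 : d * δ * m ≤ d * δ * #C := mul_le_mul_of_nonneg_left hmC hdδ
      have h10 : 4 * ε * #C ≤ d * δ * #C := mul_le_mul_of_nonneg_right hεδ hC0
      linarith
    exact_mod_cast h6
  have hX := half hBC hS hR hmB hSB hRC
  have hY := half hCB hR hS hmC hRC hSB
  refine ⟨_, filter_subset _ S, _, filter_subset _ R, ?_,
    fun b hb => cross b hmC hRC (filter_subset _ R) hR hY (mem_filter.1 hb).2,
    fun c hc => cross c hmB hSB (filter_subset _ S) hS hX (mem_filter.1 hc).2⟩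
  have h6 : (τ : ℝ) ≤ #{b ∈ S | (d - ε) * #R ≤ (#{c ∈ R | G.Adj b c} : ℝ)} := by
    have h7 : d * δ * m ≤ δ * m :=
      mul_le_mul_of_nonneg_right (mul_le_of_le_one_left hδ0 hd) hm
    have h7' : 0 ≤ δ * m := by positivity
    have h8 : δ * m ≤ δ * #B := mul_le_mul_of_nonneg_left hmB hδ0
    have h9 : 4 * ε * #B ≤ δ * #B := mul_le_mul_of_nonneg_right hεδ' (Nat.cast_nonneg _)
    linarith
  exact_mod_cast h6

end LowReg

/-- The contribution to the load of the cluster `B` of an item with `a` vertices placed in `q.2` and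
`b` vertices placed in `q.1`, where a vertex placed in `q.1` takes up room `1 / d q.1`. -/
noncomputable def itemLoad {ι : Type*} [DecidableEq ι] (d : ι → ℝ) (a b : ℝ) (q : ι × ι) (B : ι) :
    ℝ :=
  (if q.1 = B then b / d B else 0) + (if q.2 = B then a else 0)

section Load

variable {ι : Type*} [DecidableEq ι] {d : ι → ℝ} {a b : ℝ} {q : ι × ι}

lemma itemLoad_nonneg (ha : 0 ≤ a) (hb : 0 ≤ b) (hd : 0 < d q.1) (B : ι) :
    0 ≤ itemLoad d a b q B := by
  unfold itemLoad
  refine add_nonneg ?_ ?_ <;> split_ifs with h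
  · subst h; positivity
  · exact le_rfl
  · exact ha
  · exact le_rfl

lemma sum_mul_itemLoad [Fintype ι] (y : ι → ℝ) :
    ∑ B, y B * itemLoad d a b q B = b * (y q.1 / d q.1) + a * y q.2 := by
  simp only [itemLoad, mul_add, sum_add_distrib, mul_ite, mul_zero, sum_ite_eq, mem_univ, if_true]
  ring

lemma sum_itemLoad [Fintype ι] : ∑ B, itemLoad d a b q B = b / d q.1 + a := by
  have := sum_mul_itemLoad (d := d) (a := a) (b := b) (q := q) fun _ => 1
  simp only [one_mul, mul_one] at this
  rw [this]
  ring

lemma itemLoad_le {d₀ : ℝ} (ha : 0 ≤ a) (hb : 0 ≤ b) (hd₀ : 0 < d₀) (hd : d₀ ≤ d q.1) (B : ι) :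
    itemLoad d a b q B ≤ a + b / d₀ := by
  unfold itemLoad
  have h1 : (if q.1 = B then b / d B else 0) ≤ b / d₀ := by
    split_ifs with h
    · subst h; gcongr
    · positivity
  have h2 : (if q.2 = B then a else 0) ≤ a := by
    split_ifs with h
    · exact le_rfl
    · exact ha
  linarith

end Load

lemma sq_max_add_sub_le {z s o w : ℝ} (ho : 0 ≤ o) (hw : 0 ≤ w) (hos : o ≤ s) (hws : w ≤ s) :
    (max (z + (w - o)) 0) ^ 2 ≤
      (max z 0) ^ 2 + 2 * (max z 0 * w) - 2 * (max z 0 * o) + (s * w + s * o) := by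
  have h5 : (w - o) ^ 2 ≤ s * w + s * o := by nlinarith
  rcases max_cases z 0 with ⟨h6, h7⟩ | ⟨h6, h7⟩ <;> rw [h6] <;>
  rcases max_cases (z + (w - o)) 0 with ⟨h8, h9⟩ | ⟨h8, h9⟩ <;> rw [h8] <;>
  nlinarith [sq_nonneg (z + (w - o))]

/-- **Weighted Hall-type condition.** If every dual weighting of the clusters is large enough then
the items can be distributed with a small overflow `E`. -/
lemma exists_assignment {I ι : Type*} [Fintype I] [Fintype ι] [DecidableEq ι]
    {α β : I → ℝ} (hα : ∀ i, 0 ≤ α i) (hβ : ∀ i, 0 ≤ β i) {d c : ι → ℝ} (hc : ∀ B, 0 ≤ c B)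
    {d₀ : ℝ} (hd₀ : 0 < d₀) {NA : Finset ι} {N : ι → Finset ι} (hd : ∀ B ∈ NA, d₀ ≤ d B)
    (hd1 : ∀ B ∈ NA, d B ≤ 1) (hNAne : NA.Nonempty) (hNne : ∀ B ∈ NA, (N B).Nonempty)
    {K₁ K₂ E : ℝ} (hE : 0 ≤ E) (hα' : ∑ i, α i ≤ K₁) (hβ' : ∑ i, β i ≤ K₂)
    (hNA : K₁ + K₂ ≤ ∑ B ∈ NA, d B * c B) (hN : ∀ B ∈ NA, K₁ ≤ ∑ C ∈ N B, c C)
    (hsq : ∑ i, (α i + β i / d₀) ^ 2 ≤ E ^ 2) :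
    ∃ F : I → ι × ι, (∀ i, (F i).1 ∈ NA ∧ (F i).2 ∈ N (F i).1) ∧
      ∀ B, ∑ i, itemLoad d (α i) (β i) (F i) B ≤ c B + E := by
  classical
  let valid (q : ι × ι) : Prop := q.1 ∈ NA ∧ q.2 ∈ N q.1
  let ld (F : I → ι × ι) (B : ι) : ℝ := ∑ i, itemLoad d (α i) (β i) (F i) B
  let Φ (F : I → ι × ι) : ℝ := ∑ B, (max (ld F B - c B) 0) ^ 2
  have hne : ({F | ∀ i, valid (F i)} : Finset (I → ι × ι)).Nonempty := by
    obtain ⟨B, hB⟩ := hNAne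
    obtain ⟨C, hC⟩ := hNne B hB
    exact ⟨fun _ => (B, C), by simp [valid, hB, hC]⟩
  obtain ⟨F, hF, hmin⟩ := exists_min_image _ Φ hne
  simp only [mem_filter, mem_univ, true_and] at hF hmin
  refine ⟨F, hF, ?_⟩
  set y : ι → ℝ := fun B => max (ld F B - c B) 0 with hy
  have hy0 : ∀ B, 0 ≤ y B := fun B => le_max_right _ _
  obtain ⟨B₀, hB₀, hBmin⟩ := exists_min_image NA (fun B => y B / d B) hNAne
  obtain ⟨C₀, hC₀, hCmin⟩ := exists_min_image (N B₀) y (hNne B₀ hB₀)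
  set t := y B₀ / d B₀ with ht
  set u := y C₀ with hu
  have ht0 : 0 ≤ t := div_nonneg (hy0 _) (hd₀.le.trans (hd _ hB₀))
  have hu0 : 0 ≤ u := hy0 _
  have hK₁ : 0 ≤ K₁ := (sum_nonneg fun i _ => hα i).trans hα'
  have hK₂ : 0 ≤ K₂ := (sum_nonneg fun i _ => hβ i).trans hβ'
  have hdual : K₂ * t + K₁ * u ≤ ∑ B, y B * c B := by
    have hyNA : ∀ B ∈ NA, t * (d B * c B) ≤ y B * c B := by
      intro B hB
      have h1 := hBmin B hB
      rw [le_div_iff₀ (hd₀.trans_le (hd _ hB))] at h1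
      rw [← mul_assoc]
      exact mul_le_mul_of_nonneg_right h1 (hc B)
    rcases le_total t u with htu | htu
    · have h1 : ∑ B ∈ N B₀, y B * c B + ∑ B ∈ NA \ N B₀, y B * c B ≤ ∑ B, y B * c B := by
        rw [← sum_union disjoint_sdiff]
        exact sum_le_sum_of_subset_of_nonneg (subset_univ _)
          fun B _ _ => mul_nonneg (hy0 B) (hc B)
      have h2 : u * ∑ B ∈ N B₀, c B ≤ ∑ B ∈ N B₀, y B * c B := by
        rw [mul_sum]
        exact sum_le_sum fun B hB => mul_le_mul_of_nonneg_right (hCmin B hB) (hc B)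
      have h3 : t * ∑ B ∈ NA \ N B₀, d B * c B ≤ ∑ B ∈ NA \ N B₀, y B * c B := by
        rw [mul_sum]
        exact sum_le_sum fun B hB => hyNA B (mem_sdiff.1 hB).1
      have h4 : ∑ B ∈ NA, d B * c B ≤ ∑ B ∈ NA \ N B₀, d B * c B + ∑ B ∈ N B₀, c B := by
        rw [← sum_inter_add_sum_sdiff NA (N B₀), add_comm]
        refine add_le_add le_rfl (le_trans (sum_le_sum (g := c) fun B hB => ?_)
          (sum_le_sum_of_subset_of_nonneg inter_subset_right fun B _ _ => hc B))
        exact mul_le_of_le_one_left (hc B) (hd1 B (mem_inter.1 hB).1)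
      have h5 := hN B₀ hB₀
      nlinarith [mul_le_mul_of_nonneg_left (hNA.trans h4) ht0,
        mul_le_mul_of_nonneg_left h5 (sub_nonneg.2 htu)]
    · have h1 : t * ∑ B ∈ NA, d B * c B ≤ ∑ B, y B * c B := by
        rw [mul_sum]
        exact (sum_le_sum hyNA).trans (sum_le_sum_of_subset_of_nonneg (subset_univ _)
          fun B _ _ => mul_nonneg (hy0 B) (hc B))
      nlinarith [mul_le_mul_of_nonneg_left hNA ht0, mul_le_mul_of_nonneg_left htu hK₁]
  have hitem : ∀ i, ∑ B, y B * itemLoad d (α i) (β i) (F i) B ≤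
      β i * t + α i * u + (α i + β i / d₀) ^ 2 := by
    intro i
    let F' := Function.update F i (B₀, C₀)
    have hvalid : ∀ j, valid (F' j) := by
      intro j
      by_cases hj : j = i
      · subst hj; simp [F', valid, hB₀, hC₀]
      · simp only [F']; rw [Function.update_of_ne hj]; exact hF j
    set s := α i + β i / d₀
    let old := itemLoad d (α i) (β i) (F i)
    let new := itemLoad d (α i) (β i) (B₀, C₀)
    have hld : ∀ B, ld F' B = ld F B + (new B - old B) := by
      intro B
      simp only [ld]
      rw [← add_sum_erase _ _ (mem_univ i), ← add_sum_erase _ _ (mem_univ i)]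
      have : ∑ x ∈ univ.erase i, itemLoad d (α x) (β x) (F' x) B =
          ∑ x ∈ univ.erase i, itemLoad d (α x) (β x) (F x) B :=
        sum_congr rfl fun x hx => by simp only [F']; rw [Function.update_of_ne (mem_erase.1 hx).1]
      rw [this]; simp only [F']; rw [Function.update_self]
      ring
    have hdF := hd _ (hF i).1
    have hdB := hd _ hB₀
    have hold0 : ∀ B, 0 ≤ old B := itemLoad_nonneg (hα i) (hβ i) (hd₀.trans_le hdF)
    have hnew0 : ∀ B, 0 ≤ new B :=
      itemLoad_nonneg (q := (B₀, C₀)) (hα i) (hβ i) (hd₀.trans_le hdB)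
    have holds : ∀ B, old B ≤ s := itemLoad_le (hα i) (hβ i) hd₀ hdF
    have hnews : ∀ B, new B ≤ s := itemLoad_le (q := (B₀, C₀)) (hα i) (hβ i) hd₀ hdB
    have hs0 : 0 ≤ s := (hold0 B₀).trans (holds B₀)
    have hterm : ∀ B, (max (ld F' B - c B) 0) ^ 2 ≤ (max (ld F B - c B) 0) ^ 2
        + 2 * (y B * new B) - 2 * (y B * old B) + (s * new B + s * old B) := by
      intro B
      rw [hld, show ld F B + (new B - old B) - c B = ld F B - c B + (new B - old B) by ring]
      exact sq_max_add_sub_le (hold0 B) (hnew0 B) (holds B) (hnews B)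
    have hsum : Φ F' ≤ Φ F + 2 * (∑ B, y B * new B) - 2 * (∑ B, y B * old B)
        + (s * ∑ B, new B + s * ∑ B, old B) := by
      simp only [Φ, mul_sum, ← sum_add_distrib, ← sum_sub_distrib]
      exact sum_le_sum fun B _ => hterm B
    have hΦ : Φ F ≤ Φ F' := hmin F' hvalid
    have hfrac : ∀ {x}, d₀ ≤ x → β i / x + α i ≤ s := by
      intro x hx
      have h1 : β i / x ≤ β i / d₀ := div_le_div_of_nonneg_left (hβ i) hd₀ hx
      linarith
    have e1 : ∑ B, y B * new B = β i * t + α i * u := sum_mul_itemLoad y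
    have e2 : ∑ B, new B ≤ s := by
      exact sum_itemLoad.trans_le (hfrac hdB)
    have e3 : ∑ B, old B ≤ s := by
      exact sum_itemLoad.trans_le (hfrac hdF)
    have e4 := mul_le_mul_of_nonneg_left e2 hs0
    have e5 := mul_le_mul_of_nonneg_left e3 hs0
    linarith
  have htot : ∑ B, y B * ld F B ≤ ∑ B, y B * c B + E ^ 2 := by
    have h1 : ∑ B, y B * ld F B = ∑ i, ∑ B, y B * itemLoad d (α i) (β i) (F i) B := by
      rw [sum_comm]
      exact sum_congr rfl fun B _ => mul_sum _ _ _
    have h2 := sum_le_sum fun i (_ : i ∈ (univ : Finset I)) => hitem i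
    rw [sum_add_distrib, sum_add_distrib, ← sum_mul, ← sum_mul] at h2
    rw [h1]
    nlinarith [mul_le_mul_of_nonneg_right hα' hu0, mul_le_mul_of_nonneg_right hβ' ht0]
  have hysq : ∀ B, y B ^ 2 = y B * ld F B - y B * c B := by
    intro B
    simp only [hy]
    rcases max_cases (ld F B - c B) 0 with ⟨h6, h7⟩ | ⟨h6, h7⟩ <;> rw [h6] <;> ring
  intro B
  have h1 : y B ^ 2 ≤ E ^ 2 := by
    calc y B ^ 2 ≤ ∑ B, y B ^ 2 :=
          single_le_sum (f := fun B => y B ^ 2) (fun B _ => sq_nonneg _) (mem_univ B)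
      _ = ∑ B, y B * ld F B - ∑ B, y B * c B := by
          rw [← sum_sub_distrib]; exact sum_congr rfl fun B _ => hysq B
      _ ≤ E ^ 2 := by linarith
  have h2 : y B ≤ E := abs_le_of_sq_le_sq' h1 hE |>.2
  have h3 : ld F B - c B ≤ y B := le_max_left _ _
  show ld F B ≤ _
  linarith

lemma card_mul_le_of_sum_bad_gt {U ι : Type*} {A P : Finset U} (hP : P ⊆ A) {J : Finset ι}
    {bad : ι → U → Prop} [∀ B y, Decidable (bad B y)] {ε c : ℝ}
    (hbad : ∀ B ∈ J, (#{y ∈ A | bad B y} : ℝ) ≤ ε * #A) {w : ι → ℝ} (hw : ∀ B, 0 ≤ w B)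
    (hε : 0 ≤ ε) :
    c * #{y ∈ P | c * ∑ B ∈ J, w B < ∑ B ∈ J with bad B y, w B} ≤ ε * #A := by
  set Q : Finset U := {y ∈ P | c * ∑ B ∈ J, w B < ∑ B ∈ J with bad B y, w B}
  have hQ : Q ⊆ A := (filter_subset _ _).trans hP
  have hle : ∀ y, ∑ B ∈ J with bad B y, w B ≤ ∑ B ∈ J, w B := fun y =>
    sum_le_sum_of_subset_of_nonneg (filter_subset _ _) fun B _ _ => hw B
  rcases (sum_nonneg fun B (_ : B ∈ J) => hw B).eq_or_lt with h0 | h0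
  · have : Q = ∅ := by
      refine filter_eq_empty_iff.2 fun y _ => ?_
      rw [not_lt, ← h0, mul_zero, h0]
      exact hle y
    rw [this]
    simp only [card_empty, Nat.cast_zero, mul_zero]
    positivity
  · have h1 : #Q • (c * ∑ B ∈ J, w B) ≤ ∑ y ∈ Q, ∑ B ∈ J with bad B y, w B :=
      card_nsmul_le_sum _ _ _ fun y hy => (mem_filter.1 hy).2.le
    have h2 : ∑ y ∈ Q, ∑ B ∈ J with bad B y, w B ≤ ∑ y ∈ A, ∑ B ∈ J with bad B y, w B :=
      sum_le_sum_of_subset_of_nonneg hQ fun y _ _ => sum_nonneg fun B _ => hw B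
    have h3 : ∑ y ∈ A, ∑ B ∈ J with bad B y, w B = ∑ B ∈ J, #{y ∈ A | bad B y} * w B := by
      simp only [sum_filter]
      rw [sum_comm]
      refine sum_congr rfl fun B _ => ?_
      rw [← sum_filter, sum_const, nsmul_eq_mul]
    have h4 : ∑ B ∈ J, #{y ∈ A | bad B y} * w B ≤ ε * #A * ∑ B ∈ J, w B := by
      rw [mul_sum]
      exact sum_le_sum fun B hB => mul_le_mul_of_nonneg_right (hbad B hB) (hw B)
    rw [nsmul_eq_mul] at h1
    refine le_of_mul_le_mul_right ?_ h0
    linarith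

/-- If each relation `bad B` holds for few vertices of `A`, then a large subset of `A` has a vertex
for which the `B` with `bad B y` have small weight, for two weights simultaneously. -/
lemma exists_sum_bad_le {U ι : Type*} {A P : Finset U} (hP : P ⊆ A) {J : Finset ι}
    {bad : ι → U → Prop} [∀ B y, Decidable (bad B y)] {ε c : ℝ}
    (hbad : ∀ B ∈ J, (#{y ∈ A | bad B y} : ℝ) ≤ ε * #A) {w w' : ι → ℝ} (hw : ∀ B, 0 ≤ w B)
    (hw' : ∀ B, 0 ≤ w' B) (hε : 0 ≤ ε) (hc : 0 ≤ c) (hcard : 2 * ε * #A < c * #P) :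
    ∃ y ∈ P, ∑ B ∈ J with bad B y, w B ≤ c * ∑ B ∈ J, w B ∧
      ∑ B ∈ J with bad B y, w' B ≤ c * ∑ B ∈ J, w' B := by
  classical
  by_contra! hcon
  have h1 := card_mul_le_of_sum_bad_gt (c := c) hP hbad hw hε
  have h2 := card_mul_le_of_sum_bad_gt (c := c) hP hbad hw' hε
  have h3 : P ⊆ {y ∈ P | c * ∑ B ∈ J, w B < ∑ B ∈ J with bad B y, w B} ∪
      {y ∈ P | c * ∑ B ∈ J, w' B < ∑ B ∈ J with bad B y, w' B} := by
    intro y hy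
    rw [mem_union, mem_filter, mem_filter]
    rcases lt_or_ge (c * ∑ B ∈ J, w B) (∑ B ∈ J with bad B y, w B) with h | h
    · exact Or.inl ⟨hy, h⟩
    · exact Or.inr ⟨hy, hcon y hy h⟩
  have h4 := (card_le_card h3).trans (card_union_le _ _)
  have h5 : (#P : ℝ) ≤ #{y ∈ P | c * ∑ B ∈ J, w B < ∑ B ∈ J with bad B y, w B} +
      #{y ∈ P | c * ∑ B ∈ J, w' B < ∑ B ∈ J with bad B y, w' B} := by exact_mod_cast h4
  have h6 := mul_le_mul_of_nonneg_left h5 hc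
  linarith

/-- Items can be moved away from a small set `Bad` of clusters, at the expense of a small increase
of the overflow `e`. -/
lemma exists_reassignment {I ι : Type*} [Fintype I] [Fintype ι] [DecidableEq I] [DecidableEq ι]
    {α β : I → ℝ} (hα : ∀ i, 0 ≤ α i) (hβ : ∀ i, 0 ≤ β i) {d s : ι → ℝ} {d₀ δ m η b e₀ ℓ : ℝ}
    (hd₀ : 0 < d₀) (hd₀1 : d₀ ≤ 1) (hδ : 0 < δ) (hm : 0 ≤ m) (hη : 0 < η) (hs : ∀ B, m ≤ s B)
    {NA : Finset ι} {N : ι → Finset ι} (hd : ∀ B ∈ NA, d₀ ≤ d B) (hd1 : ∀ B ∈ NA, d B ≤ 1)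
    (hNA : η ≤ ∑ B ∈ NA, s B) (hN : ∀ B ∈ NA, η ≤ ∑ C ∈ N B, s C)
    {F : I → ι × ι} (hF : ∀ i, (F i).1 ∈ NA ∧ (F i).2 ∈ N (F i).1) {e : ι → ℝ}
    (he : ∀ B, 0 ≤ e B) (heδ : ∀ B, e B ≤ δ * s B)
    (hload : ∀ B, ∑ i, itemLoad d (α i) (β i) (F i) B ≤ (1 - 2 * δ) * s B + e B)
    (hsum : ∑ B, e B ≤ e₀) {Bad : Finset ι} (hBad : ∑ B ∈ Bad, s B ≤ b) {L : Finset I}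
    (hL : ∑ i ∈ L, (α i + β i / d₀) ≤ ℓ) (hsmall : b + 2 * e₀ / δ ≤ η / 2)
    (hℓ : 16 * ℓ ≤ d₀ * δ * η) (hsq : ∑ i, (α i + β i / d₀) ^ 2 ≤ (δ * m / 4) ^ 2) :
    ∃ (F' : I → ι × ι) (e' : ι → ℝ), (∀ i, (F' i).1 ∈ NA ∧ (F' i).2 ∈ N (F' i).1) ∧
      (∀ i ∉ L, F' i = F i) ∧ (∀ i ∈ L, (F' i).1 ∉ Bad) ∧ (∀ B, 0 ≤ e' B) ∧
      (∀ B, e' B ≤ δ * s B) ∧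
      (∀ B, ∑ i, itemLoad d (α i) (β i) (F' i) B ≤ (1 - 2 * δ) * s B + e' B) ∧
      ∑ B, e' B ≤ ∑ B, e B + ℓ := by
  have hs0 : ∀ B, 0 ≤ s B := fun B => hm.trans (hs B)
  let H : Finset ι := {B | δ * s B / 2 < e B}
  have hH : ∑ B ∈ H, s B ≤ 2 * e₀ / δ := by
    rw [le_div_iff₀ hδ]
    have h1 : ∑ B ∈ H, δ * s B / 2 ≤ ∑ B, e B :=
      (sum_le_sum fun B hB => (mem_filter.1 hB).2.le).trans
        (sum_le_sum_of_subset_of_nonneg (subset_univ _) fun B _ _ => he B)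
    rw [← sum_div, ← mul_sum] at h1
    linarith
  have hremove : ∀ S T : Finset ι, ∑ B ∈ S, s B - ∑ B ∈ T, s B ≤ ∑ B ∈ S \ T, s B := by
    intro S T
    have h1 := sum_inter_add_sum_sdiff S T s
    have h2 : ∑ B ∈ S ∩ T, s B ≤ ∑ B ∈ T, s B :=
      sum_le_sum_of_subset_of_nonneg inter_subset_right fun B _ _ => hs0 B
    linarith
  have he₀ : 0 ≤ 2 * e₀ / δ := by
    have := (sum_nonneg fun B _ => he B).trans hsum
    positivity
  have hb : 0 ≤ b := (sum_nonneg fun B _ => hs0 B).trans hBad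
  have hNA' : η / 2 ≤ ∑ B ∈ (NA \ Bad) \ H, s B := by
    linarith [hremove (NA \ Bad) H, hremove NA Bad]
  have hN' : ∀ B ∈ NA, η / 2 ≤ ∑ C ∈ N B \ H, s C := by
    intro B hB
    linarith [hremove (N B) H, hN B hB]
  have hsub : ∀ {B}, B ∈ (NA \ Bad) \ H → B ∈ NA := fun hB => (mem_sdiff.1 (mem_sdiff.1 hB).1).1
  have hnonempty : ∀ {S : Finset ι}, η / 2 ≤ ∑ B ∈ S, s B → S.Nonempty := by
    intro S hS
    rw [nonempty_iff_ne_empty]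
    rintro rfl
    rw [sum_empty] at hS
    linarith
  let α' : I → ℝ := fun i => if i ∈ L then α i else 0
  let β' : I → ℝ := fun i => if i ∈ L then β i else 0
  have hα' : ∀ i, 0 ≤ α' i := fun i => by
    simp only [α']; split_ifs; exacts [hα i, le_rfl]
  have hβ' : ∀ i, 0 ≤ β' i := fun i => by
    simp only [β']; split_ifs; exacts [hβ i, le_rfl]
  have hαβ : ∀ i, α' i + β' i / d₀ = if i ∈ L then α i + β i / d₀ else 0 := fun i => by
    simp only [α', β']; split_ifs <;> simp
  have hwt : ∑ i, (α' i + β' i / d₀) ≤ ℓ := by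
    simp only [hαβ, sum_ite_mem, univ_inter]
    exact hL
  have hαℓ : ∑ i, α' i ≤ ℓ :=
    (sum_le_sum fun i _ => le_add_of_nonneg_right (div_nonneg (hβ' i) hd₀.le)).trans hwt
  have hβℓ : ∑ i, β' i ≤ ℓ :=
    (sum_le_sum fun i _ => (le_div_self (hβ' i) hd₀ hd₀1).trans
      (le_add_of_nonneg_left (hα' i))).trans hwt
  have hδη : d₀ * δ * η ≤ δ * η := by
    rw [mul_assoc]; exact mul_le_of_le_one_left (by positivity) hd₀1
  have hℓ0 : 0 ≤ ℓ := (sum_nonneg fun i _ => hα' i).trans hαℓ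
  have hdual : ℓ + ℓ ≤ ∑ B ∈ (NA \ Bad) \ H, d B * (δ * s B / 4) := by
    have h1 : ∑ B ∈ (NA \ Bad) \ H, d₀ * δ / 4 * s B ≤
        ∑ B ∈ (NA \ Bad) \ H, d B * (δ * s B / 4) := sum_le_sum fun B hB => by
      have h2 : 0 ≤ δ * s B / 4 := by have := hs0 B; positivity
      linarith [mul_le_mul_of_nonneg_right (hd B (hsub hB)) h2]
    rw [← mul_sum] at h1
    have h3 := mul_le_mul_of_nonneg_left hNA' (by positivity : 0 ≤ d₀ * δ / 4)
    linarith
  have hdual' : ∀ B ∈ (NA \ Bad) \ H, ℓ ≤ ∑ C ∈ N B \ H, δ * s C / 4 := by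
    intro B hB
    have h3 := mul_le_mul_of_nonneg_left (hN' B (hsub hB)) (by positivity : 0 ≤ δ / 4)
    rw [mul_sum] at h3
    have h4 : ∑ C ∈ N B \ H, δ * s C / 4 = ∑ C ∈ N B \ H, δ / 4 * s C :=
      sum_congr rfl fun C _ => by ring
    linarith
  have hsq' : ∑ i, (α' i + β' i / d₀) ^ 2 ≤ (δ * m / 4) ^ 2 := by
    refine le_trans (sum_le_sum fun i _ => ?_) hsq
    rw [hαβ]
    split_ifs
    · exact le_rfl
    · rw [zero_pow two_ne_zero]; exact sq_nonneg _
  obtain ⟨F₁, hF₁, hload₁⟩ := exists_assignment (d := d) (c := fun B => δ * s B / 4) hα' hβ'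
    (fun B => by have := hs0 B; positivity) hd₀ (fun B hB => hd B (hsub hB))
    (fun B hB => hd1 B (hsub hB)) (hnonempty hNA') (fun B hB => hnonempty (hN' B (hsub hB)))
    (by positivity) hαℓ hβℓ hdual hdual' hsq'
  have hdF₁ : ∀ i, d₀ ≤ d (F₁ i).1 := fun i => hd _ (hsub (hF₁ i).1)
  have hg0 : ∀ i B, 0 ≤ itemLoad d (α' i) (β' i) (F₁ i) B := fun i =>
    itemLoad_nonneg (hα' i) (hβ' i) (hd₀.trans_le (hdF₁ i))
  refine ⟨fun i => if i ∈ L then F₁ i else F i,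
    fun B => e B + ∑ i, itemLoad d (α' i) (β' i) (F₁ i) B, fun i => ?_, fun i hi => if_neg hi,
    fun i hi => ?_, fun B => add_nonneg (he B) (sum_nonneg fun i _ => hg0 i B), fun B => ?_,
    fun B => ?_, ?_⟩
  · dsimp only
    split_ifs
    · exact ⟨hsub (hF₁ i).1, (mem_sdiff.1 (hF₁ i).2).1⟩
    · exact hF i
  · simp only [if_pos hi]
    exact (mem_sdiff.1 (mem_sdiff.1 (hF₁ i).1).1).2
  · dsimp only
    by_cases hB : B ∈ H
    · rw [sum_eq_zero, add_zero]
      · exact heδ B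
      · intro i _
        have h1 : (F₁ i).1 ≠ B := fun h => (mem_sdiff.1 (hF₁ i).1).2 (h ▸ hB)
        have h2 : (F₁ i).2 ≠ B := fun h => (mem_sdiff.1 (hF₁ i).2).2 (h ▸ hB)
        simp [itemLoad, h1, h2]
    · have h1 : e B ≤ δ * s B / 2 := by simpa [H] using hB
      have h2 := hload₁ B
      have h3 := mul_le_mul_of_nonneg_left (hs B) hδ.le
      linarith
  · dsimp only
    have h1 : ∑ i, itemLoad d (α i) (β i) (if i ∈ L then F₁ i else F i) B ≤
        ∑ i, (itemLoad d (α i) (β i) (F i) B + itemLoad d (α' i) (β' i) (F₁ i) B) := by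
      refine sum_le_sum fun i _ => ?_
      have h2 := itemLoad_nonneg (hα i) (hβ i) (hd₀.trans_le (hd _ (hF i).1)) B
      have h3 := hg0 i B
      by_cases hi : i ∈ L
      · simp only [α', β', if_pos hi] at h3 ⊢
        linarith
      · simp only [if_neg hi]
        linarith
    rw [sum_add_distrib] at h1
    linarith [hload B]
  · rw [sum_add_distrib, sum_comm]
    simp only [sum_itemLoad]
    refine add_le_add le_rfl (le_trans (sum_le_sum fun i _ => ?_) hwt)
    rw [add_comm]
    exact add_le_add le_rfl (div_le_div_of_nonneg_left (hβ' i) hd₀ (hdF₁ i))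

/-- A rooted tree with a set `W` of seeds, all in the colour class `V₁` of the root, such that each
component of the rest has at most `τ` vertices; `top` gives the top vertex of a component. -/
structure CutTree (V : Type*) [Fintype V] [DecidableEq V] (τ : ℕ) where
  p : V → V
  ρ : V
  dep : V → ℕ
  V₁ : Finset V
  W : Finset V
  top : V → V
  dep_lt : ∀ v, v ≠ ρ → dep (p v) < dep v
  alt : ∀ v, v ≠ ρ → (v ∈ V₁ ↔ p v ∉ V₁)
  root_mem : ρ ∈ W
  subset : W ⊆ V₁
  dep_top : ∀ v ∉ W, dep (top v) ≤ dep v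
  top_notMem : ∀ v ∉ W, top v ∉ W
  parent_top : ∀ v ∉ W, p (top v) ∈ W
  top_eq : ∀ v ∉ W, p v ∈ W → top v = v
  top_parent : ∀ v ∉ W, p v ∉ W → top v = top (p v)
  card_comp : ∀ x, #{v | v ∉ W ∧ top v = x} ≤ τ

namespace CutTree

variable {V : Type*} [Fintype V] [DecidableEq V] {τ : ℕ} (C : CutTree V τ)

/-- The component with top vertex `x`. -/
def comp (x : V) : Finset V := {v | v ∉ C.W ∧ C.top v = x}

/-- The number of vertices of `V₁` in a component. -/
def inner (x : V) : ℝ := #{v ∈ C.comp x | v ∈ C.V₁}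

/-- The number of vertices outside `V₁` in a component. -/
def outer (x : V) : ℝ := #{v ∈ C.comp x | v ∉ C.V₁}

/-- The top vertices of the components hanging from a vertex of `Z`. -/
def items (Z : Finset V) : Finset V := {x | x ∉ C.W ∧ C.p x ∈ Z}

/-- The set `Z` of seeds together with all components hanging from them. -/
def done (Z : Finset V) : Finset V := {v | v ∈ Z ∨ v ∉ C.W ∧ C.p (C.top v) ∈ Z}

lemma inner_nonneg (x : V) : 0 ≤ C.inner x := Nat.cast_nonneg _

lemma outer_nonneg (x : V) : 0 ≤ C.outer x := Nat.cast_nonneg _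

lemma ne_root {v : V} (hv : v ∉ C.W) : v ≠ C.ρ := fun h => hv (h ▸ C.root_mem)

lemma done_insert (Z : Finset V) (a : V) :
    C.done (insert a Z) = insert a (C.done Z) ∪ (C.items {a}).biUnion C.comp := by
  ext v
  simp only [done, items, comp, mem_filter, mem_univ, true_and, mem_union, mem_insert,
    mem_biUnion, mem_singleton]
  constructor
  · rintro ((h | h) | ⟨h, h' | h'⟩)
    · exact Or.inl (Or.inl h)
    · exact Or.inl (Or.inr (Or.inl h))
    · exact Or.inr ⟨C.top v, ⟨C.top_notMem v h, h'⟩, h, rfl⟩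
    · exact Or.inl (Or.inr (Or.inr ⟨h, h'⟩))
  · rintro ((h | (h | h)) | ⟨x, ⟨_, h2⟩, h3, h4⟩)
    · exact Or.inl (Or.inl h)
    · exact Or.inl (Or.inr h)
    · exact Or.inr ⟨h.1, Or.inr h.2⟩
    · exact Or.inr ⟨h3, Or.inl (by rw [h4, h2])⟩

lemma disjoint_comp {x y : V} (hxy : x ≠ y) : Disjoint (C.comp x) (C.comp y) := by
  rw [Finset.disjoint_left]
  intro v hv hv'
  simp only [comp, mem_filter] at hv hv'
  exact hxy (hv.2.2.symm.trans hv'.2.2)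

lemma sum_card_comp_le (P : V → Prop) [DecidablePred P] :
    ∑ x, #{v ∈ C.comp x | P v} ≤ #{v | P v} := by
  rw [← card_biUnion fun x _ y _ hxy => disjoint_filter_filter (C.disjoint_comp hxy)]
  refine card_le_card fun v => ?_
  simp only [mem_biUnion, mem_filter, mem_univ, true_and]
  rintro ⟨_, _, h⟩
  exact h

lemma sum_inner_le : ∑ x, C.inner x ≤ #C.V₁ := by
  have := C.sum_card_comp_le (· ∈ C.V₁)
  simp only [filter_univ_mem] at this
  simp only [inner]
  exact_mod_cast this

lemma sum_outer_le : ∑ x, C.outer x ≤ #C.V₁ᶜ := by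
  have := C.sum_card_comp_le (· ∉ C.V₁)
  rw [← compl_filter, filter_univ_mem] at this
  simp only [outer]
  exact_mod_cast this

lemma inner_add_outer_le (x : V) : C.inner x + C.outer x ≤ τ := by
  have h := card_filter_add_card_filter_not (s := C.comp x) (· ∈ C.V₁)
  have h' := C.card_comp x
  simp only [inner, outer]
  exact_mod_cast h.trans_le h'

/-- The weight of a component: the space it may need. -/
noncomputable def weight (d₀ : ℝ) (x : V) : ℝ := C.inner x + C.outer x / d₀

lemma weight_nonneg {d₀ : ℝ} (hd₀ : 0 < d₀) (x : V) : 0 ≤ C.weight d₀ x :=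
  add_nonneg (C.inner_nonneg x) (div_nonneg (C.outer_nonneg x) hd₀.le)

lemma weight_le {d₀ : ℝ} (hd₀ : 0 < d₀) (hd₀1 : d₀ ≤ 1) (x : V) :
    C.weight d₀ x ≤ (C.inner x + C.outer x) / d₀ := by
  rw [weight, add_div]
  exact add_le_add (le_div_self (C.inner_nonneg x) hd₀ hd₀1) le_rfl

lemma sum_weight_le {d₀ : ℝ} (hd₀ : 0 < d₀) (hd₀1 : d₀ ≤ 1) :
    ∑ x, C.weight d₀ x ≤ Fintype.card V / d₀ := by
  refine (sum_le_sum fun x _ => C.weight_le hd₀ hd₀1 x).trans ?_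
  rw [← sum_div, sum_add_distrib]
  have h := card_add_card_compl C.V₁
  have h' : (#C.V₁ : ℝ) + #C.V₁ᶜ = Fintype.card V := by exact_mod_cast h
  have := C.sum_inner_le
  have := C.sum_outer_le
  gcongr
  linarith

lemma sum_weight_sq_le {d₀ : ℝ} (hd₀ : 0 < d₀) (hd₀1 : d₀ ≤ 1) :
    ∑ x, C.weight d₀ x ^ 2 ≤ τ / d₀ * (Fintype.card V / d₀) := by
  refine le_trans ?_ (mul_le_mul_of_nonneg_left (C.sum_weight_le hd₀ hd₀1) (by positivity))
  rw [mul_sum]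
  refine sum_le_sum fun x _ => ?_
  rw [sq]
  refine mul_le_mul_of_nonneg_right ((C.weight_le hd₀ hd₀1 x).trans ?_) (C.weight_nonneg hd₀ x)
  have := C.inner_add_outer_le x
  gcongr

end CutTree

/-- A cluster `A` and further clusters `Cl B`, where the pairs `A, B` for `B ∈ NA` are regular of
density `d B ≥ d₀`, and so are the pairs `B, C` for `B ∈ NA`, `C ∈ N B` with density `d₀`. -/
structure ClusterSystem {U : Type*} (G : SimpleGraph U) [DecidableRel G.Adj] (ι : Type*)
    (ε d₀ m : ℝ) where
  A : Finset U
  Cl : ι → Finset U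
  NA : Finset ι
  N : ι → Finset ι
  d : ι → ℝ
  disjoint : ∀ B C, B ≠ C → Disjoint (Cl B) (Cl C)
  disjoint_left : ∀ B, Disjoint A (Cl B)
  le_card_left : m ≤ #A
  le_card : ∀ B, m ≤ #(Cl B)
  le_d : ∀ B ∈ NA, d₀ ≤ d B
  d_le : ∀ B ∈ NA, d B ≤ 1
  reg_left : ∀ B ∈ NA, LowReg G ε (d B) A (Cl B)
  reg_left' : ∀ B ∈ NA, LowReg G ε d₀ (Cl B) A
  reg : ∀ B ∈ NA, ∀ C ∈ N B, LowReg G ε d₀ (Cl B) (Cl C)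
  reg' : ∀ B ∈ NA, ∀ C ∈ N B, LowReg G ε d₀ (Cl C) (Cl B)

/-- The situation after the seeds in `Z` and the components hanging from them are embedded by `φ`;
the component `x` is assigned to the pair `F x` of clusters. -/
structure SeedState {U V ι : Type*} {G : SimpleGraph U} [DecidableRel G.Adj] [Fintype V]
    [DecidableEq V] [DecidableEq ι] {τ : ℕ} {ε d₀ m : ℝ} (C : CutTree V τ)
    (K : ClusterSystem G ι ε d₀ m) (Z : Finset V) (φ : V → U) (F : V → ι × ι) : Prop where
  emb : IsPartialEmb G C.p C.ρ (C.done Z) φ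
  seed : ∀ a ∈ Z, φ a ∈ K.A
  inner : ∀ v ∉ C.W, C.p (C.top v) ∈ Z → v ∈ C.V₁ → φ v ∈ K.Cl (F (C.top v)).2
  outer : ∀ v ∉ C.W, C.p (C.top v) ∈ Z → v ∉ C.V₁ → φ v ∈ K.Cl (F (C.top v)).1 ∧
    (d₀ - ε) * #K.A ≤ #{z ∈ K.A | G.Adj (φ v) z}
  valid : ∀ x, (F x).1 ∈ K.NA ∧ (F x).2 ∈ K.N (F x).1

namespace SeedState

variable {U V ι : Type*} {G : SimpleGraph U} [DecidableRel G.Adj] [Fintype V] [DecidableEq V]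
  [DecidableEq ι] {τ : ℕ} {ε d₀ m : ℝ} {C : CutTree V τ} {K : ClusterSystem G ι ε d₀ m}
  {Z : Finset V} {φ : V → U} {F F' : V → ι × ι}

lemma congr (h : SeedState C K Z φ F) (hF' : ∀ x, (F' x).1 ∈ K.NA ∧ (F' x).2 ∈ K.N (F' x).1)
    (hFF' : ∀ x ∈ C.items Z, F' x = F x) : SeedState C K Z φ F' where
  emb := h.emb
  seed := h.seed
  inner v hv hvZ hv₁ := by
    rw [hFF' _ (by simpa [CutTree.items] using ⟨C.top_notMem v hv, hvZ⟩)]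
    exact h.inner v hv hvZ hv₁
  outer v hv hvZ hv₁ := by
    rw [hFF' _ (by simpa [CutTree.items] using ⟨C.top_notMem v hv, hvZ⟩)]
    exact h.outer v hv hvZ hv₁
  valid := hF'

variable [DecidableEq U]

lemma card_used_le (h : SeedState C K Z φ F) (hd₀ : 0 < d₀) (B : ι) :
    (#(K.Cl B ∩ (C.done Z).image φ) : ℝ) ≤
      ∑ x ∈ C.items Z, itemLoad K.d (C.inner x) (C.outer x) (F x) B := by
  have hsub : K.Cl B ∩ (C.done Z).image φ ⊆ ((C.items Z).biUnion fun x =>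
      (if (F x).1 = B then {v ∈ C.comp x | v ∉ C.V₁} else ∅) ∪
        (if (F x).2 = B then {v ∈ C.comp x | v ∈ C.V₁} else ∅)).image φ := by
    intro z hz
    rw [mem_inter, mem_image] at hz
    obtain ⟨hzB, v, hv, rfl⟩ := hz
    refine mem_image_of_mem _ (mem_biUnion.2 ?_)
    have hcases : v ∈ Z ∨ v ∉ C.W ∧ C.p (C.top v) ∈ Z := by simpa [CutTree.done] using hv
    rcases hcases with hv | ⟨hvW, hvZ⟩
    · exact absurd hzB (Finset.disjoint_left.1 (K.disjoint_left B) (h.seed v hv))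
    refine ⟨C.top v, by simpa [CutTree.items] using ⟨C.top_notMem v hvW, hvZ⟩, ?_⟩
    have heq : ∀ {B'}, φ v ∈ K.Cl B' → B' = B := fun hB' => by
      by_contra hne
      exact Finset.disjoint_left.1 (K.disjoint _ _ hne) hB' hzB
    have hcomp : v ∈ C.comp (C.top v) := by simpa [CutTree.comp] using hvW
    rw [mem_union]
    by_cases hv₁ : v ∈ C.V₁
    · right
      rw [if_pos (heq (h.inner v hvW hvZ hv₁))]
      exact mem_filter.2 ⟨hcomp, hv₁⟩
    · left
      rw [if_pos (heq (h.outer v hvW hvZ hv₁).1)]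
      exact mem_filter.2 ⟨hcomp, hv₁⟩
  have h1 := (card_le_card hsub).trans (card_image_le.trans (card_biUnion_le.trans
    (sum_le_sum fun x _ => card_union_le _ _)))
  refine (Nat.cast_le.2 h1).trans ?_
  push_cast
  refine sum_le_sum fun x _ => ?_
  unfold itemLoad
  refine add_le_add ?_ ?_
  · split_ifs with hB
    · subst hB
      have hd := K.le_d _ (h.valid x).1
      exact le_div_self (C.outer_nonneg x) (hd₀.trans_le hd) (K.d_le _ (h.valid x).1)
    · simp
  · split_ifs
    · exact le_rfl
    · simp

end SeedState

/-- Splitting the free part of a cluster into a part in the neighbourhood `Q` of a seed, which has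
room for `x` vertices, and the rest, which has room for `l` vertices. -/
lemma exists_target {U : Type*} [DecidableEq U] {Free FB Q : Finset U} {b d d₀ δ ε x l : ℝ}
    (hFB : FB ⊆ Free) (hQ : Q ⊆ FB) (hFree : (#Free : ℝ) ≤ b) (hFBcard : (#Free : ℝ) - ε * b ≤ #FB)
    (hQcard : (d - ε) * #FB ≤ #Q) (hd₀ : 0 < d₀) (hd : d₀ ≤ d) (hd1 : d ≤ 1) (hδ : 0 < δ)
    (hε : 0 ≤ ε) (hεδ : 16 * ε ≤ d₀ * δ) (hb : 8 ≤ d₀ * δ * b) (hx : 0 ≤ x) (hl : 0 ≤ l)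
    (hroom : δ * b + x / d + l ≤ #Free) :
    ∃ S ⊆ Q, x + d₀ * δ / 4 * b ≤ #S ∧ l + d₀ * δ / 4 * b ≤ #(Free \ S) := by
  have hd' : 0 < d := hd₀.trans_le hd
  have hFB' : (#FB : ℝ) ≤ b := le_trans (by exact_mod_cast card_le_card hFB) hFree
  have hb0 : 0 ≤ b := le_trans (Nat.cast_nonneg _) hFree
  have hx0 : 0 ≤ x + d₀ * δ / 4 * b := by positivity
  have h1 : d * (x / d) = x := mul_div_cancel₀ x hd'.ne'
  have h2 : d * (δ * b + x / d + l - ε * b) ≤ d * #FB :=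
    mul_le_mul_of_nonneg_left (by linarith) hd'.le
  have h3 : d₀ * δ * b ≤ d * δ * b := by gcongr
  have h4 : d * (ε * b) ≤ ε * b := mul_le_of_le_one_left (by positivity) hd1
  have h5 : ε * #FB ≤ ε * b := mul_le_mul_of_nonneg_left hFB' hε
  have h6 : 16 * ε * b ≤ d₀ * δ * b := mul_le_mul_of_nonneg_right hεδ hb0
  have h7 : 0 ≤ d * l := by positivity
  have h8 : x + d₀ * δ / 4 * b + 1 ≤ #Q := by linarith
  obtain ⟨S, hS, hcard⟩ := exists_subset_card_eq (s := Q) (n := ⌈x + d₀ * δ / 4 * b⌉₊)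
    (by exact_mod_cast ((Nat.ceil_lt_add_one hx0).le.trans h8))
  refine ⟨S, hS, hcard ▸ Nat.le_ceil _, ?_⟩
  have h9 := card_sdiff_add_card_eq_card (hS.trans (hQ.trans hFB))
  have h10 : (#(Free \ S) : ℝ) + #S = #Free := by exact_mod_cast h9
  have h11 := (Nat.ceil_lt_add_one hx0).le
  rw [← hcard] at h11
  have h12 : x ≤ x / d := le_div_self hx hd' hd1
  have h13 : d₀ * δ * b ≤ δ * b := by
    rw [mul_assoc]
    exact mul_le_of_le_one_left (by positivity) (hd.trans hd1)
  linarith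

namespace SeedState

variable {U V ι : Type*} {G : SimpleGraph U} [DecidableRel G.Adj] [Fintype V] [DecidableEq V]
  [DecidableEq ι] {τ : ℕ} {ε d₀ m : ℝ} {C : CutTree V τ} {K : ClusterSystem G ι ε d₀ m}
  {Z : Finset V} {φ : V → U} {F : V → ι × ι} [DecidableEq U]

/-- Extending the embedding to a seed `a`, placed at `y`, and to the components hanging from it. -/
lemma exists_extend (h : SeedState C K Z φ F) {δ : ℝ} (hd₀ : 0 < d₀) (hd₀1 : d₀ ≤ 1) (hδ : 0 < δ)
    (hδ1 : δ ≤ 1) (hε : 0 ≤ ε) (hεδ : 16 * ε ≤ d₀ ^ 2 * δ) (hτ1 : 1 ≤ τ)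
    (hτ : (τ : ℝ) ≤ d₀ ^ 2 * δ / 8 * m)
    (hload : ∀ B, ∑ x, itemLoad K.d (C.inner x) (C.outer x) (F x) B ≤ (1 - δ) * #(K.Cl B))
    {a : V} (haW : a ∈ C.W) (haZ : a ∉ Z) (hZ : Z ⊆ C.W)
    (hpa : a ≠ C.ρ → C.p a ∈ C.done Z) {y : U} (hyA : y ∈ K.A) (hyZ : ∀ u ∈ Z, φ u ≠ y)
    (hy : a ≠ C.ρ → G.Adj (φ (C.p a)) y)
    (hgood : ∀ x ∈ C.items {a},
      (K.d (F x).1 - ε) * (#{z ∈ K.Cl (F x).1 \ (C.done Z).image φ |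
        (d₀ - ε) * #K.A ≤ #{w ∈ K.A | G.Adj z w}} : ℝ) ≤
      #{z ∈ {z ∈ K.Cl (F x).1 \ (C.done Z).image φ |
        (d₀ - ε) * #K.A ≤ (#{w ∈ K.A | G.Adj z w} : ℝ)} | G.Adj y z}) :
    ∃ φ' : V → U, SeedState C K (insert a Z) φ' F := by
  set D := C.done Z with hD
  let Free : ι → Finset U := fun B => K.Cl B \ D.image φ
  let typ : ι → Finset U := fun B => {z ∈ Free B | (d₀ - ε) * #K.A ≤ (#{w ∈ K.A | G.Adj z w} : ℝ)}
  let Q : ι → Finset U := fun B => {z ∈ typ B | G.Adj y z}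
  let out : ι → ℝ := fun B => ∑ x ∈ C.items {a} with (F x).1 = B, C.outer x
  let inn : ι → ℝ := fun B => ∑ x ∈ C.items {a} with (F x).2 = B, C.inner x
  have hm8 : 8 ≤ d₀ * δ * m := by
    have h1 : (1 : ℝ) ≤ τ := by exact_mod_cast hτ1
    have hm : 0 < m := by
      by_contra! hm
      have : d₀ ^ 2 * δ / 8 * m ≤ 0 := mul_nonpos_of_nonneg_of_nonpos (by positivity) hm
      linarith
    have h2 : d₀ * (d₀ * δ * m) ≤ d₀ * δ * m := mul_le_of_le_one_left (by positivity) hd₀1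
    nlinarith
  have hm0 : 0 ≤ m := by
    by_contra! hm
    have : d₀ * δ * m ≤ 0 := mul_nonpos_of_nonneg_of_nonpos (by positivity) hm.le
    linarith
  have hεδ' : 16 * ε ≤ d₀ * δ := by
    refine hεδ.trans ?_
    rw [sq, mul_assoc]
    exact mul_le_of_le_one_left (by positivity) hd₀1
  have hout : ∀ B, 0 ≤ out B := fun B => sum_nonneg fun x _ => C.outer_nonneg x
  have hinn : ∀ B, 0 ≤ inn B := fun B => sum_nonneg fun x _ => C.inner_nonneg x
  have hdisj : Disjoint (C.items Z) (C.items {a}) := by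
    rw [Finset.disjoint_left]
    intro x hx hx'
    simp only [CutTree.items, mem_filter, mem_singleton] at hx hx'
    exact haZ (hx'.2.2 ▸ hx.2.2)
  have hroom : ∀ B, δ * #(K.Cl B) + out B / K.d B + inn B ≤ #(Free B) := by
    intro B
    have h1 := h.card_used_le hd₀ B
    have h2 : ∑ x ∈ C.items {a}, itemLoad K.d (C.inner x) (C.outer x) (F x) B =
        out B / K.d B + inn B := by
      simp only [itemLoad, sum_add_distrib, out, inn, sum_filter, sum_div, ite_div, zero_div]
    have h3 : ∑ x ∈ C.items Z, itemLoad K.d (C.inner x) (C.outer x) (F x) B +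
        ∑ x ∈ C.items {a}, itemLoad K.d (C.inner x) (C.outer x) (F x) B ≤
        ∑ x, itemLoad K.d (C.inner x) (C.outer x) (F x) B := by
      rw [← sum_union hdisj]
      exact sum_le_sum_of_subset_of_nonneg (subset_univ _) fun x _ _ =>
        itemLoad_nonneg (C.inner_nonneg x) (C.outer_nonneg x)
          (hd₀.trans_le (K.le_d _ (h.valid x).1)) B
    have h4 : (#(Free B) : ℝ) + #(K.Cl B ∩ D.image φ) = #(K.Cl B) := by
      exact_mod_cast card_sdiff_add_card_inter (K.Cl B) (D.image φ)
    linarith [hload B]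
  have hbB : ∀ B, d₀ * δ * m ≤ d₀ * δ * #(K.Cl B) := fun B =>
    mul_le_mul_of_nonneg_left (K.le_card B) (by positivity)
  have htarget : ∀ B, ∃ S ⊆ Q B, ((∃ x ∈ C.items {a}, (F x).1 = B) →
      out B + d₀ * δ / 4 * #(K.Cl B) ≤ #S) ∧ inn B + d₀ * δ / 4 * #(K.Cl B) ≤ #(Free B \ S) := by
    intro B
    by_cases hB : ∃ x ∈ C.items {a}, (F x).1 = B
    · obtain ⟨x, hx, rfl⟩ := hB
      have hNA := (h.valid x).1
      have hFree : #(Free (F x).1) ≤ #(K.Cl (F x).1) := card_le_card sdiff_subset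
      have hεA : ε * #K.A ≤ #K.A := by
        refine mul_le_of_le_one_left (Nat.cast_nonneg _) ?_
        have : d₀ * δ ≤ 1 := mul_le_one₀ hd₀1 hδ.le hδ1
        linarith
      obtain ⟨S, hS, h1, h2⟩ := exists_target (Free := Free (F x).1) (FB := typ (F x).1)
        (Q := Q (F x).1) (filter_subset _ _) (filter_subset _ _) (by exact_mod_cast hFree)
        ((K.reg_left' _ hNA).le_card sdiff_subset Subset.rfl hεA) (hgood x hx) hd₀ (K.le_d _ hNA)
        (K.d_le _ hNA) hδ hε hεδ' (hm8.trans (hbB _)) (hout _) (hinn _) (hroom _)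
      exact ⟨S, hS, fun _ => h1, h2⟩
    · refine ⟨∅, empty_subset _, fun hB' => absurd hB' hB, ?_⟩
      rw [sdiff_empty]
      have h1 : out B = 0 := by
        simp only [out]
        rw [filter_eq_empty_iff.2, sum_empty]
        exact fun x hx hxB => hB ⟨x, hx, hxB⟩
      have h2 := hroom B
      rw [h1, zero_div] at h2
      have h3 : (0 : ℝ) ≤ #(K.Cl B) := Nat.cast_nonneg _
      have h4 : d₀ * δ * #(K.Cl B) ≤ δ * #(K.Cl B) := by
        rw [mul_assoc]
        exact mul_le_of_le_one_left (by positivity) hd₀1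
      have h5 : 0 ≤ δ * (#(K.Cl B) : ℝ) := by positivity
      linarith
  choose S hSQ hScard hRcard using htarget
  have hSFree : ∀ B, S B ⊆ Free B := fun B =>
    (hSQ B).trans ((filter_subset _ _).trans (filter_subset _ _))
  have hSCl : ∀ B, S B ⊆ K.Cl B := fun B => (hSFree B).trans sdiff_subset
  have hRCl : ∀ B, Free B \ S B ⊆ K.Cl B := fun B => sdiff_subset.trans sdiff_subset
  have hmemD : ∀ v, v ∈ D ↔ v ∈ Z ∨ v ∉ C.W ∧ C.p (C.top v) ∈ Z := by
    intro v
    simp [hD, CutTree.done]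
  have haD : a ∉ D := fun ha => by
    rcases (hmemD a).1 ha with ha | ⟨ha, _⟩
    · exact haZ ha
    · exact ha haW
  have hyD : ∀ u ∈ D, φ u ≠ y := by
    intro u hu e
    rcases (hmemD u).1 hu with hu | ⟨hu, huZ⟩
    · exact hyZ u hu e
    · rw [← e] at hyA
      by_cases hu₁ : u ∈ C.V₁
      · exact Finset.disjoint_left.1 (K.disjoint_left _) hyA (h.inner u hu huZ hu₁)
      · exact Finset.disjoint_left.1 (K.disjoint_left _) hyA (h.outer u hu huZ hu₁).1
  have hφ₁ := h.emb.insert_vertex haD hyD fun ha => ⟨hpa ha, hy ha⟩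
  set φ₁ := Function.update φ a y with hφ₁def
  have hφ₁a : φ₁ a = y := Function.update_self ..
  have hφ₁D : ∀ u ∈ D, φ₁ u = φ u := fun u hu =>
    Function.update_of_ne (fun e : u = a => haD (e ▸ hu)) _ _
  have hfree : ∀ B, ∀ u ∈ insert a D, φ₁ u ∉ Free B := by
    intro B u hu huB
    rw [mem_sdiff] at huB
    rcases mem_insert.1 hu with rfl | hu
    · rw [hφ₁a] at huB
      exact Finset.disjoint_left.1 (K.disjoint_left _) hyA huB.1
    · rw [hφ₁D u hu] at huB
      exact huB.2 (mem_image_of_mem _ hu)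
  have hitem : ∀ {x}, x ∈ C.items {a} → x ∉ C.W ∧ C.p x = a := by
    intro x hx
    simpa [CutTree.items] using hx
  have hcomp : ∀ {x v}, v ∈ C.comp x → v ∉ C.W ∧ C.top v = x := by
    intro x v hv
    simpa [CutTree.comp] using hv
  obtain ⟨φ', hext, hφ', hmem⟩ := hφ₁.exists_extend_components C.dep_lt (V₁ := C.V₁) (a := a)
    (comp := C.comp) (f := fun x => (F x).1) (g := fun x => (F x).2) (S := S)
    (R := fun B => Free B \ S B) (s := fun B => d₀ * δ / 4 * #(K.Cl B)) (τ := τ)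
    (fun B B' hB => (K.disjoint B B' hB).mono (hSCl B) (hSCl B'))
    (fun B B' hB => (K.disjoint B B' hB).mono (hRCl B) (hRCl B'))
    (fun B B' => by
      by_cases hB : B = B'
      · subst hB; exact disjoint_sdiff
      · exact (K.disjoint B B' hB).mono (hSCl B) (hRCl B'))
    (fun B u hu hu' => hfree B u hu (hSFree B hu'))
    (fun B u hu hu' => hfree B u hu (sdiff_subset hu')) (C.items {a})
    (fun x _ x' _ hne => C.disjoint_comp hne)
    (fun x hx => by
      rw [Finset.disjoint_left]
      intro v hv hvx
      obtain ⟨h1, h2⟩ := hcomp hvx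
      rcases mem_insert.1 hv with rfl | hv
      · exact h1 haW
      · rcases (hmemD v).1 hv with hv | ⟨_, hv⟩
        · exact h1 (hZ hv)
        · rw [h2, (hitem hx).2] at hv
          exact haZ hv)
    (fun x _ hx => (hcomp hx).1 C.root_mem)
    (fun x hx v hv => by
      obtain ⟨h1, h2⟩ := hcomp hv
      have h3 := C.alt v (C.ne_root h1)
      by_cases hpv : C.p v ∈ C.W
      · left
        have h4 : v = x := (C.top_eq v h1 hpv).symm.trans h2
        refine ⟨h4 ▸ (hitem hx).2, mem_insert_self _ _, fun hv₁ => ?_⟩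
        exact h3.1 hv₁ (C.subset hpv)
      · right
        refine ⟨?_, h3⟩
        simp only [CutTree.comp, mem_filter, mem_univ, true_and]
        exact ⟨hpv, (C.top_parent v h1 hpv).symm.trans h2⟩)
    (fun x _ => C.card_comp x)
    (fun x _ z hz => by
      rw [hφ₁a]
      exact (mem_filter.1 (hSQ _ hz)).2)
    (fun x hx => hScard _ ⟨x, hx, rfl⟩)
    (fun x _ => hRcard _)
    (fun x hx S' hS' R' hR' hS'c hR'c => by
      obtain ⟨hNA, hN⟩ := h.valid x
      exact (K.reg _ hNA _ hN).exists_pair (K.reg' _ hNA _ hN) hε hd₀1 (by positivity) hd₀.le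
        (by linarith) hm0 (K.le_card _) (K.le_card _) (by linarith) (hS'.trans (hSCl _))
        (hR'.trans (hRCl _)) hS'c hR'c)
  have hφ'D : ∀ u ∈ D, φ' u = φ u := fun u hu => by
    rw [hext u (mem_insert_of_mem hu), hφ₁D u hu]
  have hnew : ∀ v ∉ C.W, C.p (C.top v) = a → C.top v ∈ C.items {a} ∧ v ∈ C.comp (C.top v) := by
    intro v hv hva
    simp only [CutTree.items, CutTree.comp, mem_filter, mem_univ, true_and, mem_singleton]
    exact ⟨⟨C.top_notMem v hv, hva⟩, hv, trivial⟩
  refine ⟨φ', ?_, ?_, ?_, ?_, h.valid⟩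
  · rw [C.done_insert]
    exact hφ'
  · intro u hu
    rcases mem_insert.1 hu with rfl | hu
    · rw [hext u (mem_insert_self _ _), hφ₁a]
      exact hyA
    · rw [hφ'D u ((hmemD u).2 (Or.inl hu))]
      exact h.seed u hu
  · intro v hv hvZ hv₁
    rcases mem_insert.1 hvZ with hva | hvZ
    · obtain ⟨h1, h2⟩ := hnew v hv hva
      exact hRCl _ ((hmem _ h1 v h2).1 hv₁)
    · rw [hφ'D v ((hmemD v).2 (Or.inr ⟨hv, hvZ⟩))]
      exact h.inner v hv hvZ hv₁
  · intro v hv hvZ hv₁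
    rcases mem_insert.1 hvZ with hva | hvZ
    · obtain ⟨h1, h2⟩ := hnew v hv hva
      have h3 := (hmem _ h1 v h2).2 hv₁
      exact ⟨hSCl _ h3, (mem_filter.1 (mem_filter.1 (hSQ _ h3)).1).2⟩
    · rw [hφ'D v ((hmemD v).2 (Or.inr ⟨hv, hvZ⟩))]
      exact h.outer v hv hvZ hv₁

end SeedState

namespace CutTree

variable {V : Type*} [Fintype V] [DecidableEq V] {τ : ℕ} (C : CutTree V τ)

lemma sum_items_insert {a : V} {Z : Finset V} (ha : a ∉ Z) (f : V → ℝ) :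
    ∑ x ∈ C.items (insert a Z), f x = ∑ x ∈ C.items Z, f x + ∑ x ∈ C.items {a}, f x := by
  rw [← sum_union]
  · refine sum_congr ?_ fun _ _ => rfl
    ext x
    simp only [items, mem_filter, mem_univ, true_and, mem_union, mem_insert, mem_singleton]
    tauto
  · rw [Finset.disjoint_left]
    intro x hx hx'
    simp only [items, mem_filter, mem_singleton] at hx hx'
    exact ha (hx'.2.2 ▸ hx.2.2)

lemma sum_items_weight_le {d₀ : ℝ} (hd₀ : 0 < d₀) (hd₀1 : d₀ ≤ 1) (Z : Finset V) :
    ∑ x ∈ C.items Z, C.weight d₀ x ≤ Fintype.card V / d₀ :=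
  (sum_le_sum_of_subset_of_nonneg (subset_univ _) fun x _ _ => C.weight_nonneg hd₀ x).trans
    (C.sum_weight_le hd₀ hd₀1)

end CutTree

namespace SeedState

variable {U V ι : Type*} {G : SimpleGraph U} [DecidableRel G.Adj] [Fintype V] [DecidableEq V]
  [DecidableEq ι] {τ : ℕ} {ε d₀ m : ℝ} {C : CutTree V τ} {K : ClusterSystem G ι ε d₀ m}
  {Z : Finset V} {φ : V → U} {F : V → ι × ι} [DecidableEq U]

/-- There are many vertices of `A` at which the seed `a` can be placed. -/
lemma le_card_candidates (h : SeedState C K Z φ F) (hd₀ : 0 < d₀) (hd₀1 : d₀ ≤ 1)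
    (hε0 : 0 ≤ ε) (hε : 4 * ε ≤ d₀) (hZ : (#Z : ℝ) ≤ d₀ / 4 * m) {a : V} (haV₁ : a ∈ C.V₁)
    (hpa : a ≠ C.ρ → C.p a ∉ C.W ∧ C.p (C.top (C.p a)) ∈ Z) :
    d₀ / 2 * #K.A ≤ #({y ∈ K.A | a ≠ C.ρ → G.Adj (φ (C.p a)) y} \ Z.image φ) := by
  have h1 : (d₀ - ε) * #K.A ≤ #{y ∈ K.A | a ≠ C.ρ → G.Adj (φ (C.p a)) y} := by
    by_cases ha : a = C.ρ
    · rw [filter_true_of_mem fun y _ h => absurd ha h]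
      have : (0 : ℝ) ≤ #K.A := Nat.cast_nonneg _

      exact mul_le_of_le_one_left this (by linarith)

    · have h2 := (h.outer _ (hpa ha).1 (hpa ha).2 ((C.alt a ha).1 haV₁)).2
      simpa [ha] using h2
  have h2 := le_card_sdiff (Z.image φ) {y ∈ K.A | a ≠ C.ρ → G.Adj (φ (C.p a)) y}
  have h3 : #(Z.image φ) ≤ #Z := card_image_le
  have h4 : #{y ∈ K.A | a ≠ C.ρ → G.Adj (φ (C.p a)) y} ≤
    #({y ∈ K.A | a ≠ C.ρ → G.Adj (φ (C.p a)) y} \ Z.image φ) + #Z := by omega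
  have h5 : (#{y ∈ K.A | a ≠ C.ρ → G.Adj (φ (C.p a)) y} : ℝ) ≤
    #({y ∈ K.A | a ≠ C.ρ → G.Adj (φ (C.p a)) y} \ Z.image φ) + #Z := by exact_mod_cast h4
  have h6 : d₀ / 4 * m ≤ d₀ / 4 * #K.A := by
    have := K.le_card_left
    gcongr
  have h7 : 4 * ε * #K.A ≤ d₀ * #K.A := by gcongr
  linarith

variable [Fintype ι]

/-- One step of the embedding: the next seed `a` and the components hanging from it are embedded,
after the components hanging from `a` that are assigned to clusters with few neighbours of the
image of `a` have been reassigned. -/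
lemma exists_step (h : SeedState C K Z φ F) {δ η n : ℝ} (hd₀ : 0 < d₀) (hd₀1 : d₀ ≤ 1)
    (hδ : 0 < δ) (hδ1 : δ ≤ 1) (hε : 0 < ε) (hη : 0 < η) (hη1 : η ≤ 1)
    (hεδ : 80 * ε ≤ d₀ ^ 3 * δ * η) (hτ1 : 1 ≤ τ) (hτ : (τ : ℝ) ≤ d₀ ^ 2 * δ / 8 * m)
    (hW : (#C.W : ℝ) ≤ d₀ / 4 * m) (hV : Fintype.card V ≤ n) (hn : ∑ B, (#(K.Cl B) : ℝ) ≤ n)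
    (hNA : η * n ≤ ∑ B ∈ K.NA, (#(K.Cl B) : ℝ))
    (hN : ∀ B ∈ K.NA, η * n ≤ ∑ B' ∈ K.N B, (#(K.Cl B') : ℝ))
    (hsq : ∑ x, C.weight d₀ x ^ 2 ≤ (δ * m / 4) ^ 2) {e : ι → ℝ} (he : ∀ B, 0 ≤ e B)
    (heδ : ∀ B, e B ≤ δ * #(K.Cl B))
    (hload : ∀ B, ∑ x, itemLoad K.d (C.inner x) (C.outer x) (F x) B ≤
      (1 - 2 * δ) * #(K.Cl B) + e B)
    (hsum : ∑ B, e B ≤ 5 * ε / d₀ * ∑ x ∈ C.items Z, C.weight d₀ x)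
    {a : V} (haW : a ∈ C.W) (haZ : a ∉ Z) (hZ : Z ⊆ C.W)
    (hpa : a ≠ C.ρ → C.p (C.top (C.p a)) ∈ Z) :
    ∃ (φ' : V → U) (F' : V → ι × ι) (e' : ι → ℝ), SeedState C K (insert a Z) φ' F' ∧
      (∀ B, 0 ≤ e' B) ∧ (∀ B, e' B ≤ δ * #(K.Cl B)) ∧
      (∀ B, ∑ x, itemLoad K.d (C.inner x) (C.outer x) (F' x) B ≤
        (1 - 2 * δ) * #(K.Cl B) + e' B) ∧
      ∑ B, e' B ≤ 5 * ε / d₀ * ∑ x ∈ C.items (insert a Z), C.weight d₀ x := by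
  have hτ1' : (1 : ℝ) ≤ τ := by exact_mod_cast hτ1
  have hm : 0 < m := by
    by_contra! hm
    have : d₀ ^ 2 * δ / 8 * m ≤ 0 := mul_nonpos_of_nonneg_of_nonpos (by positivity) hm
    linarith
  have hn0 : 0 < n := by
    have h1 : (0 : ℝ) < Fintype.card V := by
      exact_mod_cast Fintype.card_pos_iff.2 ⟨a⟩
    linarith
  have hδη : δ * η ≤ 1 := mul_le_one₀ hδ1 hη.le hη1
  have hdδη : d₀ ^ 2 * (δ * η) ≤ 1 := mul_le_one₀ (pow_le_one₀ hd₀.le hd₀1) (by positivity) hδη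
  have hε80 : 80 * ε ≤ d₀ ^ 2 * δ * η := by
    refine hεδ.trans ?_
    have : 0 ≤ d₀ ^ 2 * δ * η := by positivity
    nlinarith
  have hεδ16 : 16 * ε ≤ d₀ ^ 2 * δ := by
    have : d₀ ^ 2 * δ * η ≤ d₀ ^ 2 * δ := mul_le_of_le_one_right (by positivity) hη1
    linarith
  have hεδ' : 16 * ε ≤ d₀ * δ := by
    refine hεδ16.trans ?_
    rw [sq, mul_assoc]
    exact mul_le_of_le_one_left (by positivity) hd₀1
  have hεd : 16 * ε ≤ d₀ := hεδ'.trans (mul_le_of_le_one_right hd₀.le hδ1)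
  have hpa' : a ≠ C.ρ → C.p a ∉ C.W ∧ C.p (C.top (C.p a)) ∈ Z := fun ha =>
    ⟨fun hp => (C.alt a ha).1 (C.subset haW) (C.subset hp), hpa ha⟩
  set P := {y ∈ K.A | a ≠ C.ρ → G.Adj (φ (C.p a)) y} \ Z.image φ with hP
  have hPA : P ⊆ K.A := sdiff_subset.trans (filter_subset _ _)
  have hZcard : (#Z : ℝ) ≤ d₀ / 4 * m := le_trans (by exact_mod_cast card_le_card hZ) hW
  have hPcard := h.le_card_candidates hd₀ hd₀1 hε.le (by linarith) hZcard (C.subset haW) hpa'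
  rw [← hP] at hPcard
  have hA : (0 : ℝ) < #K.A := hm.trans_le K.le_card_left
  let T : ι → Finset U := fun B => {z ∈ K.Cl B \ (C.done Z).image φ |
    (d₀ - ε) * #K.A ≤ (#{w ∈ K.A | G.Adj z w} : ℝ)}
  let bad : ι → U → Prop := fun B y => (#{z ∈ T B | G.Adj y z} : ℝ) < (K.d B - ε) * #(T B)
  let _ : ∀ B y, Decidable (bad B y) := fun B y => Real.decidableLT _ _
  have hTcard : ∀ B ∈ K.NA, ε * #(K.Cl B) ≤ #(T B) := by
    intro B hB
    have h1 := (K.reg_left' B hB).le_card (X' := K.Cl B \ (C.done Z).image φ) sdiff_subset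
      Subset.rfl (mul_le_of_le_one_left (Nat.cast_nonneg _) (by linarith))
    have h2 := h.card_used_le hd₀ B
    have h3 : ∑ x ∈ C.items Z, itemLoad K.d (C.inner x) (C.outer x) (F x) B ≤
        ∑ x, itemLoad K.d (C.inner x) (C.outer x) (F x) B :=
      sum_le_sum_of_subset_of_nonneg (subset_univ _) fun x _ _ =>
        itemLoad_nonneg (C.inner_nonneg x) (C.outer_nonneg x)
          (hd₀.trans_le (K.le_d _ (h.valid x).1)) B
    have h4 : (#(K.Cl B \ (C.done Z).image φ) : ℝ) + #(K.Cl B ∩ (C.done Z).image φ) =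
        #(K.Cl B) := by
      exact_mod_cast card_sdiff_add_card_inter (K.Cl B) ((C.done Z).image φ)
    have h5 : 2 * ε * #(K.Cl B) ≤ δ * #(K.Cl B) := by
      refine mul_le_mul_of_nonneg_right ?_ (Nat.cast_nonneg _)
      have : d₀ * δ ≤ δ := mul_le_of_le_one_left hδ.le hd₀1
      linarith
    have h6 : (#(K.Cl B \ (C.done Z).image φ) : ℝ) - ε * #(K.Cl B) ≤ #(T B) := h1
    linarith [hload B, heδ B]
  have hbad : ∀ B ∈ K.NA, (#{y ∈ K.A | bad B y} : ℝ) ≤ ε * #K.A := fun B hB =>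
    K.reg_left B hB (T B) ((filter_subset _ _).trans sdiff_subset) (hTcard B hB)
  let w' : ι → ℝ := fun B => ∑ x ∈ C.items {a} with (F x).1 = B, C.weight d₀ x
  have hc : 0 ≤ 5 * ε / d₀ := by positivity
  obtain ⟨y, hyP, hy1, hy2⟩ := exists_sum_bad_le (c := 5 * ε / d₀) hPA hbad
    (w := fun B => (#(K.Cl B) : ℝ)) (w' := w') (fun B => Nat.cast_nonneg _)
    (fun B => sum_nonneg fun x _ => C.weight_nonneg hd₀ x) hε.le hc (by
      have h1 : 5 * ε / d₀ * (d₀ / 2 * #K.A) ≤ 5 * ε / d₀ * #P := by gcongr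
      have h2 : 5 * ε / d₀ * (d₀ / 2 * #K.A) = 5 / 2 * (ε * #K.A) := by field_simp
      have h3 : 0 < ε * #K.A := by positivity
      linarith)
  set L := {x ∈ C.items {a} | bad (F x).1 y} with hLdef
  set Bad := {B ∈ K.NA | bad B y} with hBaddef
  have hw' : ∑ B ∈ K.NA, w' B = ∑ x ∈ C.items {a}, C.weight d₀ x :=
    sum_fiberwise_of_maps_to (fun x _ => (h.valid x).1) _
  have hL : ∑ x ∈ L, C.weight d₀ x ≤ 5 * ε / d₀ * ∑ x ∈ C.items {a}, C.weight d₀ x := by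
    rw [← hw']
    refine le_trans ?_ hy2
    rw [← sum_fiberwise_of_maps_to (t := Bad) (g := fun x => (F x).1) (fun x hx =>
      mem_filter.2 ⟨(h.valid x).1, (mem_filter.1 hx).2⟩)]
    refine sum_le_sum fun B _ => sum_le_sum_of_subset_of_nonneg
      (filter_subset_filter _ (filter_subset _ _)) fun x _ _ => C.weight_nonneg hd₀ x
  have hwn : ∀ Z, ∑ x ∈ C.items Z, C.weight d₀ x ≤ n / d₀ := fun Z =>
    (C.sum_items_weight_le hd₀ hd₀1 Z).trans (by gcongr)
  have hsmall : 5 * ε / d₀ * n + 2 * (5 * ε / d₀ * (n / d₀)) / δ ≤ η * n / 2 := by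
    have h1 : 5 * ε / d₀ * n + 2 * (5 * ε / d₀ * (n / d₀)) / δ =
        5 * ε * n * (d₀ * δ + 2) / (d₀ ^ 2 * δ) := by
      field_simp
    rw [h1, div_le_iff₀ (by positivity)]
    have h2 : d₀ * δ ≤ 1 := mul_le_one₀ hd₀1 hδ.le hδ1
    have h3 : 80 * ε * n ≤ d₀ ^ 2 * δ * η * n := by gcongr
    have h4 : 5 * ε * n * (d₀ * δ + 2) ≤ 5 * ε * n * 3 := by gcongr; linarith
    nlinarith
  have hℓ : 16 * (5 * ε / d₀ * ∑ x ∈ C.items {a}, C.weight d₀ x) ≤ d₀ * δ * (η * n) := by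
    have h1 : 5 * ε / d₀ * ∑ x ∈ C.items {a}, C.weight d₀ x ≤ 5 * ε / d₀ * (n / d₀) := by
      gcongr
      exact hwn _
    have h2 : 5 * ε / d₀ * (n / d₀) = 5 * ε * n / d₀ ^ 2 := by field_simp
    have h3 : 16 * (5 * ε * n / d₀ ^ 2) ≤ d₀ * δ * (η * n) := by
      rw [← mul_div_assoc, div_le_iff₀ (by positivity)]
      have : 80 * ε * n ≤ d₀ ^ 3 * δ * η * n := by gcongr
      linarith
    linarith
  obtain ⟨F', e', hF', hFF', hFBad, he', heδ', hload', hsum'⟩ := exists_reassignment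
    C.inner_nonneg C.outer_nonneg hd₀ hd₀1 hδ hm.le (by positivity) K.le_card K.le_d K.d_le hNA hN
    h.valid he heδ hload (hsum.trans (mul_le_mul_of_nonneg_left (hwn Z) hc))
    (hy1.trans (mul_le_mul_of_nonneg_left ((sum_le_sum_of_subset_of_nonneg (subset_univ _)
      fun _ _ _ => Nat.cast_nonneg _).trans hn) hc)) hL hsmall hℓ hsq
  have hLa : L ⊆ C.items {a} := filter_subset _ _
  have hdisj : ∀ x ∈ C.items Z, x ∉ L := by
    intro x hx hxL
    have hxa := hLa hxL
    simp only [CutTree.items, mem_filter, mem_singleton] at hx hxa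
    exact haZ (hxa.2.2 ▸ hx.2.2)
  have hyP' : (y ∈ K.A ∧ (a ≠ C.ρ → G.Adj (φ (C.p a)) y)) ∧ y ∉ Z.image φ := by
    rwa [hP, mem_sdiff, mem_filter] at hyP
  obtain ⟨φ', hφ'⟩ := (h.congr hF' fun x hx => hFF' x (hdisj x hx)).exists_extend hd₀ hd₀1 hδ hδ1
    hε.le hεδ16 hτ1 hτ (fun B => (hload' B).trans (by linarith [heδ' B])) haW haZ hZ
    (fun ha => by simpa [CutTree.done] using Or.inr (hpa' ha)) hyP'.1.1
    (fun u hu hφu => hyP'.2 (hφu ▸ mem_image_of_mem _ hu)) hyP'.1.2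
    (fun x hx => by
      have hnot : ¬ bad (F' x).1 y := by
        by_cases hxL : x ∈ L
        · exact fun hb => hFBad x hxL (mem_filter.2 ⟨(hF' x).1, hb⟩)
        · rw [hFF' x hxL]
          exact fun hb => hxL (mem_filter.2 ⟨hx, hb⟩)
      exact not_lt.1 hnot)
  refine ⟨φ', F', e', hφ', he', heδ', hload', hsum'.trans ?_⟩
  rw [C.sum_items_insert haZ, mul_add]
  gcongr

end SeedState

/-- Embedding a tree that is cut into small components into a suitable system of regular pairs. -/
lemma ClusterSystem.exists_embedding {U V ι : Type*} {G : SimpleGraph U} [DecidableRel G.Adj]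
    [Fintype V] [DecidableEq V] [DecidableEq ι] [Fintype ι] [DecidableEq U] {τ : ℕ} {ε d₀ m : ℝ}
    (K : ClusterSystem G ι ε d₀ m) (C : CutTree V τ) {δ n : ℝ} (hd₀ : 0 < d₀) (hd₀1 : d₀ ≤ 1)
    (hδ : 0 < δ) (hδ1 : 3 * δ ≤ 1) (hε : 0 < ε) (hεδ : 27 * ε ≤ d₀ ^ 3 * δ ^ 2) (hτ1 : 1 ≤ τ)
    (hτ : (τ : ℝ) ≤ d₀ ^ 2 * δ / 8 * m) (hτn : 16 * τ * n ≤ (d₀ * δ * m) ^ 2)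
    (hW : (#C.W : ℝ) ≤ d₀ / 4 * m) (hV : Fintype.card V ≤ n) (hn : ∑ B, (#(K.Cl B) : ℝ) ≤ n)
    (hNA : Fintype.card V + 3 * δ * n ≤ ∑ B ∈ K.NA, K.d B * #(K.Cl B))
    (hN : ∀ B ∈ K.NA, #C.V₁ + 3 * δ * n ≤ ∑ B' ∈ K.N B, (#(K.Cl B') : ℝ)) :
    ∃ φ : V → U, Function.Injective φ ∧ ∀ v, v ≠ C.ρ → G.Adj (φ (C.p v)) (φ v) := by
  have hm : 0 < m := by
    by_contra! hm
    have h1 : d₀ ^ 2 * δ / 8 * m ≤ 0 := mul_nonpos_of_nonneg_of_nonpos (by positivity) hm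
    have h2 : (1 : ℝ) ≤ τ := by exact_mod_cast hτ1
    linarith
  have hVpos : (0 : ℝ) < Fintype.card V := by exact_mod_cast Fintype.card_pos_iff.2 ⟨C.ρ⟩
  have hn0 : 0 < n := hVpos.trans_le hV
  have hδn : 0 < 3 * δ * n := by positivity
  have hNA' : 3 * δ * n ≤ ∑ B ∈ K.NA, (#(K.Cl B) : ℝ) := by
    have : ∑ B ∈ K.NA, K.d B * #(K.Cl B) ≤ ∑ B ∈ K.NA, (#(K.Cl B) : ℝ) :=
      sum_le_sum fun B hB => mul_le_of_le_one_left (Nat.cast_nonneg _) (K.d_le B hB)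
    linarith
  have hN' : ∀ B ∈ K.NA, 3 * δ * n ≤ ∑ B' ∈ K.N B, (#(K.Cl B') : ℝ) := fun B hB =>
    (le_add_of_nonneg_left (Nat.cast_nonneg _)).trans (hN B hB)
  have hne : ∀ {s : Finset ι}, 3 * δ * n ≤ ∑ B ∈ s, (#(K.Cl B) : ℝ) → s.Nonempty := by
    intro s hs
    rw [nonempty_iff_ne_empty]
    rintro rfl
    rw [sum_empty] at hs
    linarith
  have hle : ∀ s : Finset ι, ∑ B ∈ s, (#(K.Cl B) : ℝ) ≤ n := fun s =>
    (sum_le_sum_of_subset_of_nonneg (subset_univ _) fun _ _ _ => Nat.cast_nonneg _).trans hn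
  have hsq : ∑ x, C.weight d₀ x ^ 2 ≤ (δ * m / 4) ^ 2 := by
    refine (C.sum_weight_sq_le hd₀ hd₀1).trans ?_
    rw [div_mul_div_comm, div_le_iff₀ (by positivity)]
    have h1 : 16 * (τ : ℝ) * Fintype.card V ≤ 16 * τ * n := by gcongr
    linarith
  obtain ⟨F₀, hF₀, hload₀⟩ := exists_assignment (c := fun B => (1 - 3 * δ) * #(K.Cl B))
    (E := δ * m) (K₁ := #C.V₁) (K₂ := #C.V₁ᶜ) C.inner_nonneg C.outer_nonneg
    (fun B => mul_nonneg (by linarith) (Nat.cast_nonneg _)) hd₀ K.le_d K.d_le (hne hNA')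
    (fun B hB => hne (hN' B hB)) (by positivity) C.sum_inner_le C.sum_outer_le
    (by
      have h1 : (#C.V₁ : ℝ) + #C.V₁ᶜ = Fintype.card V := by
        exact_mod_cast card_add_card_compl C.V₁
      have h2 : ∑ B ∈ K.NA, K.d B * ((1 - 3 * δ) * #(K.Cl B)) =
          (1 - 3 * δ) * ∑ B ∈ K.NA, K.d B * #(K.Cl B) := by
        rw [mul_sum]
        exact sum_congr rfl fun B _ => by ring
      have h3 : ∑ B ∈ K.NA, K.d B * #(K.Cl B) ≤ n := le_trans (sum_le_sum fun B hB =>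
        mul_le_of_le_one_left (Nat.cast_nonneg _) (K.d_le B hB)) (hle K.NA)
      rw [h1, h2]
      nlinarith)
    (fun B hB => by
      rw [← mul_sum]
      nlinarith [hN B hB, hle (K.N B)])
    (hsq.trans (by gcongr; linarith [mul_pos hδ hm]))
  obtain ⟨u₀, -⟩ : K.A.Nonempty := card_pos.1 (by exact_mod_cast hm.trans_le K.le_card_left)
  have hmain : ∀ j ≤ #C.W, ∃ Z ⊆ C.W, #Z = j ∧ ∃ (φ : V → U) (F : V → ι × ι) (e : ι → ℝ),
      SeedState C K Z φ F ∧ (∀ B, 0 ≤ e B) ∧ (∀ B, e B ≤ δ * #(K.Cl B)) ∧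
      (∀ B, ∑ x, itemLoad K.d (C.inner x) (C.outer x) (F x) B ≤
        (1 - 2 * δ) * #(K.Cl B) + e B) ∧
      ∑ B, e B ≤ 5 * ε / d₀ * ∑ x ∈ C.items Z, C.weight d₀ x := by
    intro j
    induction j with
    | zero =>
      refine fun _ => ⟨∅, empty_subset _, rfl, fun _ => u₀, F₀, fun _ => 0, ⟨?_, ?_, ?_, ?_, hF₀⟩,
        fun _ => le_rfl, fun B => by positivity, fun B => ?_, ?_⟩
      · simp [IsPartialEmb, CutTree.done]
      · simp
      · simp
      · simp
      · have := mul_le_mul_of_nonneg_left (K.le_card B) hδ.le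
        linarith [hload₀ B]
      · simp [CutTree.items]
    | succ j ih =>
      intro hj
      obtain ⟨Z, hZ, hZj, φ, F, e, h, he, heδ, hload, hsum⟩ := ih (by omega)
      have hrest : (C.W \ Z).Nonempty := by
        rw [← card_pos, card_sdiff_of_subset hZ]
        omega
      obtain ⟨a, ha, hmin⟩ := exists_min_image (C.W \ Z) C.dep hrest
      obtain ⟨haW, haZ⟩ := mem_sdiff.1 ha
      obtain ⟨φ', F', e', h'⟩ := h.exists_step hd₀ hd₀1 hδ (by linarith) hε (by positivity) hδ1
        (by linarith) hτ1 hτ hW hV hn hNA' hN' hsq he heδ hload hsum haW haZ hZ (fun hρ => by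
          have hp : C.p a ∉ C.W := fun hp => (C.alt a hρ).1 (C.subset haW) (C.subset hp)
          by_contra hpZ
          have h1 := hmin _ (mem_sdiff.2 ⟨C.parent_top _ hp, hpZ⟩)
          have h2 := C.dep_lt _ (C.ne_root (C.top_notMem _ hp))
          have h3 := C.dep_top _ hp
          have h4 := C.dep_lt _ hρ
          omega)
      exact ⟨insert a Z, insert_subset haW hZ, by rw [card_insert_of_notMem haZ, hZj],
        φ', F', e', h'⟩
  obtain ⟨Z, hZ, hZc, φ, F, e, h, -⟩ := hmain _ le_rfl
  obtain rfl := eq_of_subset_of_card_le hZ hZc.ge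
  have hdone : ∀ v, v ∈ C.done C.W := fun v => by
    by_cases hv : v ∈ C.W
    · simp [CutTree.done, hv]
    · simp [CutTree.done, hv, C.parent_top v hv]
  exact ⟨φ, fun u v huv => h.emb.1 (hdone u) (hdone v) huv, fun v hv => (h.emb.2 v (hdone v) hv).2⟩

/-- A tree in which every vertex outside `V₁` has degree at most `D` splits into small components
after the deletion of a small subset of `V₁`. -/
lemma exists_cutTree {V : Type*} [Fintype V] [DecidableEq V] {T : SimpleGraph V} (hT : T.IsTree)
    {V₁ : Finset V} {ρ : V} (hρ : ρ ∈ V₁) (halt : ∀ x y, T.Adj x y → (x ∈ V₁ ↔ y ∉ V₁)) {D τ : ℕ}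
    (hD : 1 ≤ D) (hτ : 1 ≤ τ) (hdeg : ∀ u, u ∉ V₁ → (T.neighborSet u).ncard ≤ D) :
    ∃ C : CutTree V τ, C.V₁ = V₁ ∧ #C.W * τ ≤ τ + D * Fintype.card V ∧
      ∀ x y, T.Adj x y → (x ≠ C.ρ ∧ C.p x = y) ∨ (y ≠ C.ρ ∧ C.p y = x) := by
  obtain ⟨p, dep, hdep, hadj, hp⟩ := hT.exists_parent ρ
  have halt' : ∀ v, v ≠ ρ → (v ∈ V₁ ↔ p v ∉ V₁) := fun v hv => halt v (p v) (hadj v hv)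
  obtain ⟨W, hρW, hW, hcard, hbelow⟩ := exists_cut hdep V₁ hρ halt' D τ hD hτ fun u hu => by
    refine le_trans ?_ (hdeg u hu)
    rw [← Set.ncard_coe_finset]
    refine Set.ncard_le_ncard (fun v hv => ?_) (Set.toFinite _)
    simp only [coe_filter, mem_univ, true_and, Set.mem_ofPred_eq] at hv
    exact hv.2 ▸ (hadj v hv.1).symm
  obtain ⟨top, htop⟩ := exists_top hdep hρW
  refine ⟨⟨p, ρ, dep, V₁, W, top, hdep, halt', hρW, hW,
    fun v hv => (htop v hv).2.2.1.dep_le hdep hρW, fun v hv => (htop v hv).1,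
    fun v hv => (htop v hv).2.1, fun v hv => (htop v hv).2.2.2.1,
    fun v hv => (htop v hv).2.2.2.2, fun x => ?_⟩, rfl, hcard, hp⟩
  refine le_trans ?_ (hbelow x)
  rw [← Set.ncard_coe_finset]
  refine Set.ncard_le_ncard (fun v hv => ?_) (Set.toFinite _)
  simp only [coe_filter, mem_univ, true_and, Set.mem_ofPred_eq] at hv
  exact hv.2 ▸ (htop v hv.1).2.2.1

section Regularity

variable {U : Type*} {G : SimpleGraph U} [DecidableRel G.Adj]

lemma sum_card_filter_adj (X Y : Finset U) :
    (∑ x ∈ X, #{y ∈ Y | G.Adj x y} : ℝ) = G.edgeDensity X Y * #X * #Y := by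
  have h1 : #(G.interedges X Y) = ∑ x ∈ X, #{y ∈ Y | G.Adj x y} := by
    rw [SimpleGraph.interedges_def, card_filter, sum_product]
    exact sum_congr rfl fun x _ => (card_filter _ _).symm
  rw [← Nat.cast_sum, ← h1, SimpleGraph.edgeDensity_def]
  push_cast
  rcases X.eq_empty_or_nonempty with rfl | hX
  · simp
  rcases Y.eq_empty_or_nonempty with rfl | hY
  · simp [SimpleGraph.interedges_def]
  have hX' : (#X : ℝ) ≠ 0 := by exact_mod_cast hX.card_pos.ne'
  have hY' : (#Y : ℝ) ≠ 0 := by exact_mod_cast hY.card_pos.ne'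
  field_simp

lemma SimpleGraph.IsUniform.lowReg {ε d : ℝ} {X Y : Finset U} (h : G.IsUniform ε X Y)
    (hd : d ≤ G.edgeDensity X Y) : LowReg G ε d X Y := by
  intro Y' hY' hcard
  by_contra! hcon
  set X' : Finset U := {x ∈ X | (#{y ∈ Y' | G.Adj x y} : ℝ) < (d - ε) * #Y'}
  have hX'0 : (0 : ℝ) < #X' :=
    (mul_nonneg (h.pos.le) (Nat.cast_nonneg _)).trans_lt hcon
  have h1 := (abs_lt.1 (h (filter_subset _ X : X' ⊆ X) hY' (by linarith) (by linarith))).1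
  have h2 : (∑ x ∈ X', #{y ∈ Y' | G.Adj x y} : ℝ) < ∑ x ∈ X', (d - ε) * #Y' :=
    sum_lt_sum_of_nonempty (card_pos.1 (by exact_mod_cast hX'0)) fun x hx => (mem_filter.1 hx).2
  rw [sum_card_filter_adj, sum_const, nsmul_eq_mul] at h2
  have h3 : (0 : ℝ) ≤ #Y' := Nat.cast_nonneg _
  have h4 : (d - ε) * (#X' * #Y') ≤ G.edgeDensity X' Y' * (#X' * #Y') := by
    refine mul_le_mul_of_nonneg_right ?_ (by positivity)
    linarith
  linarith

variable [Fintype U] [DecidableEq U]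

/-- The vertices of a set `X` of vertices of large degree send many edges to the parts of a
partition. -/
lemma Finpartition.le_sum_of_le_degree (P : Finpartition (univ : Finset U)) {X : Finset U}
    (hX : X.Nonempty) {t : ℝ} (ht : ∀ v ∈ X, t ≤ G.degree v) {w : Finset U → ℝ}
    (hw : ∀ C ∈ P.parts, (G.edgeDensity X C : ℝ) * #C ≤ w C) : t ≤ ∑ C ∈ P.parts, w C := by
  have hdeg : ∀ v, (G.degree v : ℝ) = ∑ C ∈ P.parts, (#{z ∈ C | G.Adj v z} : ℝ) := by
    intro v
    have h1 := sum_biUnion (s := P.parts) (t := id) (f := fun z => if G.Adj v z then 1 else 0)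
      P.disjoint
    rw [P.biUnion_parts, ← card_filter] at h1
    simp only [id, ← card_filter] at h1
    rw [← G.card_neighborFinset_eq_degree, G.neighborFinset_eq_filter, h1]
    push_cast
    rfl
  have hX0 : (0 : ℝ) < #X := by exact_mod_cast hX.card_pos
  have h1 : #X * t ≤ ∑ v ∈ X, (G.degree v : ℝ) := by
    rw [← nsmul_eq_mul, ← sum_const]
    exact sum_le_sum ht
  have h2 : ∑ v ∈ X, (G.degree v : ℝ) ≤ #X * ∑ C ∈ P.parts, w C := by
    simp only [hdeg]
    rw [sum_comm, mul_sum]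
    refine sum_le_sum fun C hC => ?_
    rw [sum_card_filter_adj]
    linarith [mul_le_mul_of_nonneg_left (hw C hC) hX0.le]
  exact le_of_mul_le_mul_left (h1.trans h2) hX0

open Classical in
/-- Few parts of a uniform partition are in many irregular pairs. -/
lemma Finpartition.IsUniform.card_bad_le {P : Finpartition (univ : Finset U)} {ε θ : ℝ}
    (hP : P.IsUniform G ε) (hθ : 0 < θ) (hε : 0 ≤ ε) (hεθ : ε ≤ θ ^ 2) :
    (#{B ∈ P.parts | θ * #P.parts < #{C ∈ P.parts | B ≠ C ∧ ¬G.IsUniform ε B C}} : ℝ) ≤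
      θ * #P.parts := by
  rcases P.parts.eq_empty_or_nonempty with h0 | h0
  · simp [h0]
  have hp : (0 : ℝ) < #P.parts := by exact_mod_cast h0.card_pos
  set Bad : Finset (Finset U) :=
    {B ∈ P.parts | θ * #P.parts < #{C ∈ P.parts | B ≠ C ∧ ¬G.IsUniform ε B C}}
  have h1 : ∑ B ∈ P.parts, #{C ∈ P.parts | B ≠ C ∧ ¬G.IsUniform ε B C} =
      #(P.nonUniforms G ε) := by
    rw [← card_sigma]
    refine card_bij (fun x _ => (x.1, x.2)) ?_ ?_ ?_
    · rintro ⟨B, C⟩ h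
      simp only [mem_sigma, mem_filter] at h
      simpa using h
    · rintro ⟨B, C⟩ _ ⟨B', C'⟩ _ h
      simp only [Prod.mk.injEq] at h
      obtain ⟨rfl, rfl⟩ := h
      rfl
    · rintro ⟨B, C⟩ h
      refine ⟨⟨B, C⟩, ?_, rfl⟩
      simp only [mem_sigma, mem_filter]
      simpa using h
  have h2 : #Bad * (θ * #P.parts) ≤
      ∑ B ∈ P.parts, (#{C ∈ P.parts | B ≠ C ∧ ¬G.IsUniform ε B C} : ℝ) := by
    rw [← nsmul_eq_mul, ← sum_const]
    exact (sum_le_sum fun B hB => (mem_filter.1 hB).2.le).trans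
      (sum_le_sum_of_subset_of_nonneg (filter_subset _ _) fun _ _ _ => Nat.cast_nonneg _)
  have h3 : (#(P.nonUniforms G ε) : ℝ) ≤ #P.parts * #P.parts * ε := by
    refine hP.trans (mul_le_mul_of_nonneg_right ?_ hε)
    exact_mod_cast Nat.mul_le_mul_left _ (Nat.sub_le _ _)
  rw [← Nat.cast_sum, h1] at h2
  have h4 : #P.parts * #P.parts * ε ≤ #P.parts * #P.parts * θ ^ 2 := by gcongr
  have h5 : (0 : ℝ) < θ * #P.parts := by positivity
  refine le_of_mul_le_mul_right (h2.trans (h3.trans (h4.trans_eq ?_))) h5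
  ring

end Regularity

section Clusters

variable {U : Type*} {G : SimpleGraph U} [DecidableRel G.Adj] [Fintype U] [DecidableEq U]

lemma Finpartition.sum_card_parts_le (P : Finpartition (univ : Finset U)) {Q : Finset (Finset U)}
    (hQ : Q ⊆ P.parts) : (∑ C ∈ Q, #C : ℝ) ≤ Fintype.card U := by
  have h1 := P.sum_card_parts
  rw [card_univ] at h1
  exact_mod_cast (sum_le_sum_of_subset hQ).trans h1.le

/-- A partition has a good part containing many vertices of a large set `H`. -/
lemma Finpartition.exists_part_inter {P : Finpartition (univ : Finset U)} {Bad : Finset (Finset U)}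
    (hBad : Bad ⊆ P.parts) {s c : ℝ} (hs : ∀ C ∈ P.parts, (#C : ℝ) ≤ s) {H : Finset U}
    (hH : c * Fintype.card U + #Bad * s < #H) (hc : 0 ≤ c) :
    ∃ A ∈ P.parts, A ∉ Bad ∧ c * #A ≤ #(A ∩ H) := by
  by_contra! hcon
  have h1 : #H = ∑ C ∈ P.parts, #(C ∩ H) := by
    rw [← card_biUnion]
    · congr 1
      ext v
      obtain ⟨C, hC, hv⟩ := P.exists_mem (mem_univ v)
      simp only [mem_biUnion, mem_inter]
      exact ⟨fun h => ⟨C, hC, hv, h⟩, fun ⟨_, _, _, h⟩ => h⟩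
    · exact fun C hC C' hC' hne => (P.disjoint hC hC' hne).mono inter_subset_left inter_subset_left
  have h2 : (#H : ℝ) ≤ ∑ C ∈ P.parts, (c * #C + if C ∈ Bad then s else 0) := by
    rw [h1]
    push_cast
    refine sum_le_sum fun C hC => ?_
    split_ifs with hCB
    · have : (#(C ∩ H) : ℝ) ≤ #C := by exact_mod_cast card_le_card inter_subset_left
      have : 0 ≤ c * (#C : ℝ) := by positivity
      linarith [hs C hC]
    · rw [add_zero]
      exact (hcon C hC hCB).le
  rw [sum_add_distrib, ← mul_sum, ← sum_filter, filter_mem_eq_inter, inter_eq_right.2 hBad,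
    sum_const, nsmul_eq_mul] at h2
  have h3 := mul_le_mul_of_nonneg_left (P.sum_card_parts_le Subset.rfl) hc
  linarith

/-- The vertices of large degree in `X` have large degree to the clusters in `Q`, if the other
clusters have small density or are few. -/
lemma Finpartition.le_sum_subset (P : Finpartition (univ : Finset U)) {X : Finset U}
    (hX : X.Nonempty) {t s ε q : ℝ} (hε : 0 ≤ ε) (ht : ∀ v ∈ X, t ≤ G.degree v)
    {Q E : Finset (Finset U)} (hQ : Q ⊆ P.parts) (hE : E ⊆ P.parts)
    (hs : ∀ C ∈ P.parts, (#C : ℝ) ≤ s) {f : Finset U → ℝ} (hf : ∀ C ∈ Q, 0 ≤ f C)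
    (hQf : ∀ C ∈ Q, C ∉ E → (G.edgeDensity X C : ℝ) ≤ f C + ε)
    (hother : ∀ C ∈ P.parts, C ∉ Q → C ∉ E → (G.edgeDensity X C : ℝ) ≤ ε) (hEq : #E * s ≤ q) :
    t ≤ ∑ C ∈ Q, f C * #C + ε * Fintype.card U + q := by
  have h1 := P.le_sum_of_le_degree hX ht (w := fun C =>
    ((if C ∈ Q then f C * #C else 0) + ε * #C) + if C ∈ E then s else 0) (fun C hC => by
      have h0 : (0 : ℝ) ≤ #C := Nat.cast_nonneg _
      have hQ0 : 0 ≤ if C ∈ Q then f C * #C else 0 := by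
        split_ifs with h
        · exact mul_nonneg (hf C h) h0
        · exact le_rfl
      by_cases hCE : C ∈ E
      · simp only [if_pos hCE]
        have h2 : (G.edgeDensity X C : ℝ) ≤ 1 := by exact_mod_cast G.edgeDensity_le_one X C
        have h3 := mul_le_of_le_one_left h0 h2
        have h4 := mul_nonneg hε h0
        linarith [hs C hC]
      · simp only [if_neg hCE, add_zero]
        by_cases hCQ : C ∈ Q
        · rw [if_pos hCQ, ← add_mul]
          exact mul_le_mul_of_nonneg_right (hQf C hCQ hCE) h0
        · rw [if_neg hCQ, zero_add]
          exact mul_le_mul_of_nonneg_right (hother C hC hCQ hCE) h0)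
  rw [sum_add_distrib, sum_add_distrib, ← sum_filter, ← sum_filter, filter_mem_eq_inter,
    filter_mem_eq_inter, inter_eq_right.2 hQ, inter_eq_right.2 hE, sum_const, nsmul_eq_mul,
    ← mul_sum] at h1
  have h3 := mul_le_mul_of_nonneg_left (P.sum_card_parts_le Subset.rfl) hε
  linarith

open Classical in
/-- A uniform partition of a graph of large minimum degree with many vertices of larger degree
gives a suitable system of regular pairs. -/
lemma Finpartition.IsUniform.exists_clusterSystem {P : Finpartition (univ : Finset U)}
    {η ε s m a b : ℝ} (hP : P.IsUniform G ε) (hη : 0 < η) (hη1 : η ≤ 1) (hε : 0 < ε)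
    (hεη : ε ≤ (η / 100) ^ 2) (hs : ∀ C ∈ P.parts, (#C : ℝ) ≤ s)
    (hps : #P.parts * s ≤ 2 * Fintype.card U) (hm : ∀ C ∈ P.parts, m ≤ #C)
    (hp : 200 ≤ η * #P.parts) (hU : 0 < Fintype.card U)
    (hdeg : ∀ v, a + η * Fintype.card U ≤ G.degree v) {H : Finset U}
    (hH : η * Fintype.card U ≤ #H) (hHdeg : ∀ v ∈ H, b + η * Fintype.card U ≤ G.degree v) :
    ∃ A : Finset U, ∃ K : ClusterSystem G (P.parts.erase A) ε (η / 8) m,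
      ∑ B, (#(K.Cl B) : ℝ) ≤ Fintype.card U ∧
      b + η / 2 * Fintype.card U ≤ ∑ B ∈ K.NA, K.d B * #(K.Cl B) ∧
      ∀ B ∈ K.NA, a + η / 2 * Fintype.card U ≤ ∑ B' ∈ K.N B, (#(K.Cl B') : ℝ) := by
  set n := (Fintype.card U : ℝ) with hn
  have hn0 : 0 < n := Nat.cast_pos.2 hU
  set θ := η / 100 with hθ
  have hθ0 : 0 < θ := by positivity
  have hεθ : ε ≤ θ := hεη.trans (by nlinarith)
  have hp0 : (0 : ℝ) < #P.parts := by
    by_contra! h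
    linarith [mul_nonpos_of_nonneg_of_nonpos hη.le h]
  have hs0 : 0 ≤ s := by
    obtain ⟨C, hC⟩ := card_pos.1 (by exact_mod_cast hp0 : 0 < #P.parts)
    exact (Nat.cast_nonneg _).trans (hs C hC)
  have hsn : s ≤ θ * n := by
    have h1 : 200 * s ≤ η * #P.parts * s := by gcongr
    have h2 : η * (#P.parts * s) ≤ η * (2 * n) := by gcongr
    have h3 : η = 100 * θ := by rw [hθ]; ring
    nlinarith
  let nonu : Finset U → Finset (Finset U) := fun B => {C ∈ P.parts | B ≠ C ∧ ¬G.IsUniform ε B C}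
  set Bad : Finset (Finset U) := {B ∈ P.parts | θ * #P.parts < #(nonu B)} with hBad
  have hBadP : Bad ⊆ P.parts := filter_subset _ _
  have hBadc : (#Bad : ℝ) ≤ θ * #P.parts := hP.card_bad_le hθ0 hε.le hεη
  have hbads : ∀ {E : Finset (Finset U)}, (#E : ℝ) ≤ θ * #P.parts → #E * s ≤ 2 * θ * n := by
    intro E hE
    calc #E * s ≤ θ * #P.parts * s := by gcongr
      _ = θ * (#P.parts * s) := by ring
      _ ≤ θ * (2 * n) := by gcongr
      _ = 2 * θ * n := by ring
  have hnonu : ∀ {B}, B ∈ P.parts → B ∉ Bad → #(nonu B) * s ≤ 2 * θ * n := by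
    intro B hB hBB
    refine hbads (not_lt.1 fun h => hBB (mem_filter.2 ⟨hB, h⟩))
  obtain ⟨A, hA, hABad, hAH⟩ := Finpartition.exists_part_inter (c := η / 2) hBadP hs (H := H)
    (by
      have := hbads hBadc
      have : θ * n = η * n / 100 := by rw [hθ]; ring
      have : 0 < η * n := by positivity
      linarith) (by positivity)
  have hne : ∀ {C}, C ∈ P.parts → (0 : ℝ) < #C := fun hC => by
    exact_mod_cast (P.nonempty_of_mem_parts hC).card_pos
  have hunif : ∀ {B C}, C ∈ P.parts → B ≠ C → C ∉ nonu B → G.IsUniform ε B C := by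
    intro B C hC hBC h
    by_contra hu
    exact h (mem_filter.2 ⟨hC, hBC, hu⟩)
  let NA : Finset (Finset U) := {B ∈ P.parts.erase A | B ∉ Bad ∧ G.IsUniform ε A B ∧
    η / 8 ≤ (G.edgeDensity A B : ℝ)}
  let N : Finset U → Finset (Finset U) := fun B => {C ∈ P.parts.erase A | B ≠ C ∧
    G.IsUniform ε B C ∧ η / 8 ≤ (G.edgeDensity B C : ℝ)}
  have hNAP : NA ⊆ P.parts := (filter_subset _ _).trans (erase_subset _ _)
  have hNP : ∀ B, N B ⊆ P.parts := fun B => (filter_subset _ _).trans (erase_subset _ _)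
  have hNAsum : b + η / 2 * n ≤ ∑ B ∈ NA, (G.edgeDensity A B : ℝ) * #B := by
    have hX : (A ∩ H).Nonempty := by
      rw [← card_pos]
      have h1 : (0 : ℝ) < #(A ∩ H) := (mul_pos (by positivity) (hne hA)).trans_le hAH
      exact_mod_cast h1
    have hEc : (#(insert A (nonu A ∪ Bad)) : ℝ) ≤ 1 + #(nonu A) + #Bad := by
      have h1 := card_insert_le A (nonu A ∪ Bad)
      have h2 := card_union_le (nonu A) Bad
      exact_mod_cast (by omega : #(insert A (nonu A ∪ Bad)) ≤ 1 + #(nonu A) + #Bad)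
    have hdens : ∀ {C}, G.IsUniform ε A C → C ∈ P.parts →
        (G.edgeDensity (A ∩ H) C : ℝ) ≤ G.edgeDensity A C + ε := by
      intro C hu hC
      have h1 := (abs_lt.1 (hu (inter_subset_left : A ∩ H ⊆ A) Subset.rfl (by
        refine le_trans ?_ hAH
        rw [mul_comm]
        refine mul_le_mul_of_nonneg_right ?_ (hne hA).le
        linarith) (mul_le_of_le_one_right (hne hC).le (by linarith)))).2
      linarith
    have h1 := P.le_sum_subset (G := G) (Q := NA) (E := insert A (nonu A ∪ Bad)) hX
      (t := b + η * n) (ε := η / 8 + ε) (q := 5 * θ * n) (s := s)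
      (f := fun C => (G.edgeDensity A C : ℝ)) (by positivity)
      (fun v hv => hHdeg v (mem_inter.1 hv).2) hNAP
      (insert_subset hA (union_subset (filter_subset _ _) hBadP)) hs
      (fun C _ => by exact_mod_cast G.edgeDensity_nonneg A C)
      (fun C hC _ => by
        have := hdens (mem_filter.1 hC).2.2.1 (hNAP hC)
        linarith)
      (fun C hC hCQ hCE => by
        simp only [mem_insert, mem_union, not_or] at hCE
        have hu := hunif hC (Ne.symm hCE.1) hCE.2.1
        have h2 := hdens hu hC
        have h3 : (G.edgeDensity A C : ℝ) < η / 8 := by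
          by_contra! h3
          exact hCQ (mem_filter.2 ⟨mem_erase.2 ⟨hCE.1, hC⟩, hCE.2.2, hu, h3⟩)
        linarith)
      (by
        have h2 := mul_le_mul_of_nonneg_right hEc hs0
        have h3 := hnonu hA hABad
        have h4 := hbads hBadc
        linarith)
    have h2 : θ * n = η * n / 100 := by rw [hθ]; ring
    have h3 : ε * n ≤ θ * n := by gcongr
    have h4 : 0 < η * n := by positivity
    linarith
  have hNsum : ∀ B ∈ NA, a + η / 2 * n ≤ ∑ C ∈ N B, (#C : ℝ) := by
    intro B hB
    have hBP := hNAP hB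
    have hBBad := (mem_filter.1 hB).2.1
    have hEc : (#(insert A (insert B (nonu B))) : ℝ) ≤ 2 + #(nonu B) := by
      have h1 := card_insert_le A (insert B (nonu B))
      have h2 := card_insert_le B (nonu B)
      exact_mod_cast (by omega : #(insert A (insert B (nonu B))) ≤ 2 + #(nonu B))
    have h1 := P.le_sum_subset (G := G) (Q := N B) (E := insert A (insert B (nonu B)))
      (P.nonempty_of_mem_parts hBP) (t := a + η * n) (ε := η / 8) (q := 4 * θ * n) (s := s)
      (f := fun _ => 1) (by positivity) (fun v _ => hdeg v) (hNP B)
      (insert_subset hA (insert_subset hBP (filter_subset _ _))) hs (fun _ _ => zero_le_one)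
      (fun C _ _ => by
        have : (G.edgeDensity B C : ℝ) ≤ 1 := by exact_mod_cast G.edgeDensity_le_one B C
        linarith)
      (fun C hC hCQ hCE => by
        simp only [mem_insert, not_or] at hCE
        have hu := hunif hC (Ne.symm hCE.2.1) hCE.2.2
        by_contra! h3
        exact hCQ (mem_filter.2 ⟨mem_erase.2 ⟨hCE.1, hC⟩, Ne.symm hCE.2.1, hu, h3.le⟩))
      (by
        have h2 := mul_le_mul_of_nonneg_right hEc hs0
        have h3 := hnonu hBP hBBad
        linarith)
    simp only [one_mul] at h1
    have h2 : θ * n = η * n / 100 := by rw [hθ]; ring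
    have h4 : 0 < η * n := by positivity
    linarith
  have hsub : ∀ {Q : Finset (Finset U)} (f : Finset U → ℝ), Q ⊆ P.parts.erase A →
      ∑ B : P.parts.erase A with B.1 ∈ Q, f B.1 = ∑ B ∈ Q, f B := by
    intro Q f hQ
    rw [sum_filter, sum_coe_sort (P.parts.erase A) (fun B => if B ∈ Q then f B else 0),
      ← sum_filter, filter_mem_eq_inter, inter_eq_right.2 hQ]
  have hmem : ∀ B : P.parts.erase A, B.1 ∈ P.parts := fun B => mem_of_mem_erase B.2
  let K : ClusterSystem G (P.parts.erase A) ε (η / 8) m :=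
    { A := A
      Cl := Subtype.val
      NA := {B | B.1 ∈ NA}
      N := fun B => {C | C.1 ∈ N B.1}
      d := fun B => (G.edgeDensity A B.1 : ℝ)
      disjoint := fun B C hBC => P.disjoint (hmem B) (hmem C) (Subtype.coe_injective.ne hBC)
      disjoint_left := fun B => P.disjoint hA (hmem B) (ne_of_mem_erase B.2).symm
      le_card_left := hm A hA
      le_card := fun B => hm B.1 (hmem B)
      le_d := fun B hB => (mem_filter.1 (mem_filter.1 hB).2).2.2.2
      d_le := fun B _ => by exact_mod_cast G.edgeDensity_le_one A B.1
      reg_left := fun B hB => (mem_filter.1 (mem_filter.1 hB).2).2.2.1.lowReg le_rfl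
      reg_left' := fun B hB => by
        have h := (mem_filter.1 (mem_filter.1 hB).2).2
        exact h.2.1.symm.lowReg (by rw [G.edgeDensity_comm]; exact h.2.2)
      reg := fun B _ C hC => by
        have h := (mem_filter.1 (mem_filter.1 hC).2).2
        exact h.2.1.lowReg h.2.2
      reg' := fun B _ C hC => by
        have h := (mem_filter.1 (mem_filter.1 hC).2).2
        exact h.2.1.symm.lowReg (by rw [G.edgeDensity_comm]; exact h.2.2) }
  refine ⟨A, K, ?_, ?_, fun B hB => ?_⟩
  · rw [sum_coe_sort (P.parts.erase A) (fun B => (#B : ℝ))]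
    exact P.sum_card_parts_le (erase_subset _ _)
  · rw [hsub (fun B => (G.edgeDensity A B : ℝ) * #B) (filter_subset _ _)]
    exact hNAsum
  · rw [hsub (fun B => (#B : ℝ)) (filter_subset _ _)]
    exact hNsum _ (mem_filter.1 hB).2

end Clusters

section Main

variable {U : Type*} {G : SimpleGraph U} [DecidableRel G.Adj] [Fintype U] [DecidableEq U]

/-- A large graph of large minimum degree with many vertices of larger degree contains a suitable
system of regular pairs. -/
lemma SimpleGraph.exists_clusterSystem {η ε a b : ℝ} (hη : 0 < η) (hη1 : η ≤ 1) (hε : 0 < ε)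
    (hεη : ε ≤ (η / 100) ^ 2)
    (hU : SzemerediRegularity.bound ε ⌈200 / η⌉₊ ≤ Fintype.card U)
    (hdeg : ∀ v, a + η * Fintype.card U ≤ G.degree v) {H : Finset U}
    (hH : η * Fintype.card U ≤ #H) (hHdeg : ∀ v ∈ H, b + η * Fintype.card U ≤ G.degree v) :
    ∃ (s : Finset (Finset U)) (K : ClusterSystem G s ε (η / 8)
        (Fintype.card U / (2 * SzemerediRegularity.bound ε ⌈200 / η⌉₊))),
      ∑ B, (#(K.Cl B) : ℝ) ≤ Fintype.card U ∧
      b + η / 2 * Fintype.card U ≤ ∑ B ∈ K.NA, K.d B * #(K.Cl B) ∧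
      ∀ B ∈ K.NA, a + η / 2 * Fintype.card U ≤ ∑ B' ∈ K.N B, (#(K.Cl B') : ℝ) := by
  obtain ⟨P, hPe, hPl, hPb, hPu⟩ :=
    szemeredi_regularity G hε ((SzemerediRegularity.le_bound ε ⌈200 / η⌉₊).trans hU)
  set M := SzemerediRegularity.bound ε ⌈200 / η⌉₊
  have hM : 0 < M := SzemerediRegularity.bound_pos ε _
  set p := #P.parts with hp
  have hp200 : 200 / η ≤ p := (Nat.le_ceil _).trans (by exact_mod_cast hPl)
  have hp0' : (0 : ℝ) < p := lt_of_lt_of_le (by positivity) hp200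
  have hp0 : 0 < p := by exact_mod_cast hp0'
  have hdiv : 1 ≤ Fintype.card U / p := (Nat.one_le_div_iff hp0).2 (hPb.trans hU)
  have hdiv1 : p * (Fintype.card U / p) ≤ Fintype.card U := Nat.mul_div_le _ _
  have hdiv2 : Fintype.card U < p * (Fintype.card U / p) + p := by
    rw [mul_comm]
    exact Nat.lt_div_mul_add hp0
  obtain ⟨A, K, hK⟩ := hPu.exists_clusterSystem (s := 2 * Fintype.card U / p)
    (m := Fintype.card U / (2 * M)) hη hη1 hε hεη (fun C hC => by
      have h1 := hPe.card_part_le_average_add_one hC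
      rw [card_univ] at h1
      rw [le_div_iff₀ hp0']
      have h2 : #C * p ≤ 2 * Fintype.card U := by nlinarith
      exact_mod_cast h2)
    (by rw [← hp, mul_div_cancel₀ _ hp0'.ne']) (fun C hC => by
      have h1 := hPe.average_le_card_part hC
      rw [card_univ] at h1
      rw [div_le_iff₀ (by positivity)]
      have h2 : Fintype.card U ≤ #C * (2 * p) := by nlinarith
      have h3 : #C * (2 * p) ≤ #C * (2 * M) := by gcongr
      exact_mod_cast h2.trans h3)
    (by rwa [div_le_iff₀' hη] at hp200) (hM.trans_le hU) hdeg hH hHdeg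
  exact ⟨_, K, hK⟩

/-- The embedding theorem with explicit constants. -/
lemma SimpleGraph.IsTree.exists_embedding {V : Type*} [Fintype V] {T : SimpleGraph V}
    (hT : T.IsTree) {V₁ : Finset V} (hV₁ : V₁.Nonempty)
    (halt : ∀ x y, T.Adj x y → (x ∈ V₁ ↔ y ∉ V₁)) {η ε τ₀ γ a : ℝ} {M : ℕ} (hη : 0 < η)
    (hη1 : η ≤ 1) (hε : ε = (η / 8) ^ 3 * (η / 6) ^ 2 / 27)
    (hM : M = SzemerediRegularity.bound ε ⌈200 / η⌉₊)
    (hτ₀ : τ₀ = (η / 8 * (η / 6)) ^ 2 / (64 * M ^ 2)) (hγ : γ = τ₀ * (η / 8) / (32 * M))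
    (hn : (1 + 2 / τ₀) * (16 * M / (η / 8)) ≤ Fintype.card U)
    (hVU : Fintype.card V ≤ Fintype.card U) (haV₁ : (#V₁ : ℝ) ≤ a)
    (hdegT : ∀ u, u ∉ V₁ → ((T.neighborSet u).ncard : ℝ) ≤ γ * Fintype.card V)
    (hdeg : ∀ v, a + η * Fintype.card U ≤ G.degree v) {H : Finset U}
    (hH : η * Fintype.card U ≤ #H)
    (hHdeg : ∀ v ∈ H, (Fintype.card V : ℝ) + η * Fintype.card U ≤ G.degree v) :
    ∃ φ : V → U, Function.Injective φ ∧ ∀ ⦃x y⦄, T.Adj x y → G.Adj (φ x) (φ y) := by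
  classical
  obtain ⟨ρ, hρ⟩ := hV₁
  have hMpos : 0 < M := hM ▸ SzemerediRegularity.bound_pos ε _
  have hM0 : (0 : ℝ) < M := Nat.cast_pos.2 hMpos
  have hM1 : (1 : ℝ) ≤ M := Nat.one_le_cast.2 hMpos
  have hε0 : 0 < ε := by rw [hε]; positivity
  have hτ₀0 : 0 < τ₀ := by rw [hτ₀]; positivity
  have hγ0 : 0 < γ := by rw [hγ]; positivity
  have hεη : ε ≤ (η / 100) ^ 2 := by
    have h1 : η ^ 5 ≤ η ^ 2 := pow_le_pow_of_le_one hη.le hη1 (by norm_num)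
    rw [hε]
    linarith
  set n := (Fintype.card U : ℝ)
  set d₀ := η / 8 with hd₀
  have hd₀0 : 0 < d₀ := by positivity
  have hn1 : (1 + 2 / τ₀) * 16 * M ≤ d₀ * n := by
    rw [← mul_div_assoc, div_le_iff₀ hd₀0] at hn
    linarith
  have hn2 : (1 + 2 / τ₀) * 16 * M ≤ n := hn1.trans
    (mul_le_of_le_one_left (Nat.cast_nonneg _) (by linarith))
  have h2τ : 0 < 2 / τ₀ := by positivity
  have hMn : (M : ℝ) ≤ n := by
    nlinarith [mul_pos h2τ hM0]
  have hτn : 2 ≤ τ₀ * n := by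
    have : 2 / τ₀ ≤ n := by nlinarith [mul_le_mul_of_nonneg_left hM1 h2τ.le]
    rwa [div_le_iff₀' hτ₀0] at this
  have hn0 : 0 < n := hM0.trans_le hMn
  set τ := ⌊τ₀ * n⌋₊
  have hτle : (τ : ℝ) ≤ τ₀ * n := Nat.floor_le (by positivity)
  have hτge : τ₀ * n / 2 ≤ τ := by linarith [Nat.lt_floor_add_one (τ₀ * n)]
  have hτ1 : 1 ≤ τ := by
    have : (1 : ℝ) ≤ τ := by linarith
    exact_mod_cast this
  obtain ⟨C, hC₁, hCW, hCadj⟩ := exists_cutTree hT hρ halt (D := ⌊γ * n⌋₊ + 1) (τ := τ)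
    (Nat.le_add_left _ _) hτ1 fun u hu => by
      refine le_trans (Nat.le_floor ((hdegT u hu).trans ?_)) (Nat.le_succ _)
      gcongr
      exact Nat.cast_le.2 hVU
  have hcard : (Fintype.card V : ℝ) ≤ n := Nat.cast_le.2 hVU
  have hW : (#C.W : ℝ) ≤ d₀ / 4 * (n / (2 * M)) := by
    have h1 : (#C.W * τ : ℝ) ≤ τ + (γ * n + 1) * n := by
      have h2 : (#C.W * τ : ℝ) ≤ τ + (⌊γ * n⌋₊ + 1) * Fintype.card V := by exact_mod_cast hCW
      refine h2.trans ?_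
      have h3 : (⌊γ * n⌋₊ : ℝ) ≤ γ * n := Nat.floor_le (by positivity)
      gcongr
    have h3 : (γ * n + 1) * n = (2 * γ / τ₀ * n + 2 / τ₀) * (τ₀ * n / 2) := by
      field_simp
    have h4 : (γ * n + 1) * n ≤ (2 * γ / τ₀ * n + 2 / τ₀) * τ := by
      rw [h3]
      gcongr
    have hτpos : (0 : ℝ) < τ := by positivity
    have h5 : (#C.W : ℝ) ≤ 1 + (2 * γ / τ₀ * n + 2 / τ₀) := by
      refine le_of_mul_le_mul_right ?_ hτpos
      linarith
    have h6 : 2 * γ / τ₀ * n = d₀ / 4 * (n / (2 * M)) / 2 := by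
      rw [hγ]
      field_simp
      ring
    have h7 : 1 + 2 / τ₀ ≤ d₀ / 4 * (n / (2 * M)) / 2 := by
      have : d₀ / 4 * (n / (2 * M)) / 2 = d₀ * n / (16 * M) := by
        field_simp
        ring
      rw [this, le_div_iff₀ (by positivity)]
      linarith
    linarith
  obtain ⟨s, K, hK₁, hK₂, hK₃⟩ : ∃ (s : Finset (Finset U))
      (K : ClusterSystem G s ε d₀ (n / (2 * M))), ∑ B, (#(K.Cl B) : ℝ) ≤ n ∧
      Fintype.card V + η / 2 * n ≤ ∑ B ∈ K.NA, K.d B * #(K.Cl B) ∧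
      ∀ B ∈ K.NA, a + η / 2 * n ≤ ∑ B' ∈ K.N B, (#(K.Cl B') : ℝ) := by
    rw [hM] at hMn ⊢
    exact SimpleGraph.exists_clusterSystem hη hη1 hε0 hεη (Nat.cast_le.1 hMn) hdeg hH hHdeg
  have hτ2 : (16 * τ : ℝ) * n ≤ (d₀ * (η / 6) * (n / (2 * M))) ^ 2 := by
    have h1 : (d₀ * (η / 6) * (n / (2 * M))) ^ 2 = 16 * (τ₀ * n) * n := by
      rw [hτ₀]
      field_simp
      ring
    rw [h1]
    gcongr
  have hτ3 : (τ : ℝ) ≤ d₀ ^ 2 * (η / 6) / 8 * (n / (2 * M)) := by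
    refine hτle.trans ?_
    have h1 : τ₀ * n = d₀ ^ 2 * (η / 6) / 8 * (n / (2 * M)) * (η / (24 * M)) := by
      rw [hτ₀]
      field_simp
      ring
    rw [h1]
    refine mul_le_of_le_one_right (by positivity) ?_
    rw [div_le_one (by positivity)]
    linarith
  obtain ⟨φ, hφ, hφadj⟩ := K.exists_embedding C (δ := η / 6) (n := n) hd₀0 (by linarith)
    (by positivity) (by linarith) hε0 (by rw [hε]; linarith) hτ1 hτ3 hτ2 hW hcard hK₁
    (by linarith) fun B hB => by
      rw [hC₁]
      linarith [hK₃ B hB]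
  refine ⟨φ, hφ, fun x y hxy => ?_⟩
  obtain ⟨hx, rfl⟩ | ⟨hy, rfl⟩ := hCadj x y hxy
  · exact (hφadj x hx).symm
  · exact hφadj y hy

end Main

/-- For all `r, η > 0` there exist `n₀` and `γ > 0` such that the following holds.
Let `G` be a graph of order `n > n₀` and `T` a tree of order `k` with colour classes
`V₁, V₂` such that `|V₁| ≤ rk` and every vertex of `V₂` has degree at most `γk` in `T`.
If `δ(G) ≥ rk + ηn` and at least `ηn` vertices of `G` have degree at least `k + ηn`,
then `G` contains `T`. -/
theorem localES_dense_skew (r η : ℝ) (hr : 0 < r) (hη : 0 < η) :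
    ∃ (n₀ : ℕ) (γ : ℝ), 0 < γ ∧
      ∀ (n k : ℕ), n₀ < n →
        ∀ (G : SimpleGraph (Fin n)) (T : SimpleGraph (Fin k))
          (V₁ V₂ : Finset (Fin k)),
          T.IsTree →
          (∀ v, v ∈ V₁ ∨ v ∈ V₂) →
          Disjoint V₁ V₂ →
          (∀ ⦃x y⦄, T.Adj x y → ((x ∈ V₁ ∧ y ∈ V₂) ∨ (x ∈ V₂ ∧ y ∈ V₁))) →
          (V₁.card : ℝ) ≤ r * k →
          (∀ v ∈ V₂, (degree' T v : ℝ) ≤ γ * k) →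
          (∀ v, r * k + η * n ≤ (degree' G v : ℝ)) →
          η * n ≤ ({v : Fin n | (k : ℝ) + η * n ≤ (degree' G v : ℝ)}.ncard : ℝ) →
          Contains G T := by
  classical
  set η₁ := min η 1
  have hη₁ : 0 < η₁ := lt_min hη one_pos
  set ε := (η₁ / 8) ^ 3 * (η₁ / 6) ^ 2 / 27 with hε
  set M := SzemerediRegularity.bound ε ⌈200 / η₁⌉₊ with hM
  have hM0 : (0 : ℝ) < M := Nat.cast_pos.2 (SzemerediRegularity.bound_pos ε _)
  set τ₀ := (η₁ / 8 * (η₁ / 6)) ^ 2 / (64 * M ^ 2) with hτ₀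
  have hτ₀0 : 0 < τ₀ := by positivity
  refine ⟨⌈(1 + 2 / τ₀) * (16 * M / (η₁ / 8))⌉₊, τ₀ * (η₁ / 8) / (32 * M), by positivity, ?_⟩
  intro n k hn G T V₁ V₂ hT hcov hdisj hadj hV₁ hdegT hdeg hH
  have hn0 : (0 : ℝ) < n := Nat.cast_pos.2 (Nat.zero_lt_of_lt hn)
  have hηn : η₁ * n ≤ η * n := by
    gcongr
    exact min_le_left _ _
  have hdeg' : ∀ v, degree' G v = G.degree v := fun v => by
    rw [degree', Set.ncard_eq_toFinset_card', ← SimpleGraph.neighborFinset_def,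
      SimpleGraph.card_neighborFinset_eq_degree]
  simp only [hdeg'] at hdeg hH
  rw [Set.ncard_eq_toFinset_card'] at hH
  have hkn : k ≤ n := by
    have h1 : 0 < η * n := by positivity
    obtain ⟨v, hv⟩ := card_pos.1 (Nat.cast_pos.1 (h1.trans_le hH))
    rw [Set.mem_toFinset, Set.mem_ofPred_eq] at hv
    have h2 : (G.degree v : ℝ) ≤ n := by
      have := (G.degree_lt_card_verts v).le
      rw [Fintype.card_fin] at this
      exact_mod_cast this
    exact_mod_cast (by linarith : (k : ℝ) ≤ n)
  obtain rfl | hne := V₁.eq_empty_or_nonempty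
  · refine ⟨Fin.castLE hkn, Fin.castLE_injective hkn, fun x y hxy => ?_⟩
    simpa using hadj hxy
  have halt : ∀ x y, T.Adj x y → (x ∈ V₁ ↔ y ∉ V₁) := fun x y hxy => by
    obtain ⟨hx, hy⟩ | ⟨hx, hy⟩ := hadj hxy
    · exact iff_of_true hx (Finset.disjoint_right.1 hdisj hy)
    · exact iff_of_false (Finset.disjoint_right.1 hdisj hx) (not_not.2 hy)
  refine hT.exists_embedding hne halt hη₁ (min_le_right _ _) hε hM hτ₀ rfl ?_ (by simpa using hkn)
    hV₁ (fun u hu => ?_) (fun v => ?_)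
    (H := {v : Fin n | (k : ℝ) + η * n ≤ (G.degree v : ℝ)}.toFinset) ?_ fun v hv => ?_
  · rw [Fintype.card_fin]
    exact Nat.lt_of_ceil_lt hn |>.le
  · rw [Fintype.card_fin]
    exact hdegT u ((hcov u).resolve_left hu)
  · rw [Fintype.card_fin]
    linarith [hdeg v]
  · rw [Fintype.card_fin]
    exact hηn.trans hH
  · rw [Set.mem_toFinset, Set.mem_ofPred_eq] at hv
    rw [Fintype.card_fin, Fintype.card_fin]
    linarith
end

section
/- Let k be a positive integer divisible by 6. Let T be the tree on k+1 vertices consisting of a root vertex adjacent to the centres of three pairwise disjoint stars, each star having k/3 − 1 leaves (so each star has k/3 vertices). Let G be the graph on k+1 vertices consisting of one vertex adjacent to all vertices of two disjoint cliques, each clique on k/2 vertices (and no other edges between the cliques). Then Δ(G) = k, δ(G) = k/2, and G does not contain T. -/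
open SimpleGraph Finset

/-- The tree on `k+1` vertices consisting of a root (vertex `0`) adjacent to the centres of
three pairwise disjoint stars, each on `k/3` vertices (a centre and `k/3 - 1` leaves).
For `1 ≤ v ≤ k`, vertex `v` belongs to star number `(v-1)/(k/3)`, and it is the centre of
its star iff `(v-1) % (k/3) = 0`. -/
def broomTree (k : ℕ) : SimpleGraph (Fin (k + 1)) :=
  SimpleGraph.fromRel (fun x y =>
    ((x : ℕ) = 0 ∧ (y : ℕ) ≠ 0 ∧ ((y : ℕ) - 1) % (k / 3) = 0) ∨
    ((x : ℕ) ≠ 0 ∧ (y : ℕ) ≠ 0 ∧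
      ((x : ℕ) - 1) / (k / 3) = ((y : ℕ) - 1) / (k / 3) ∧
      ((x : ℕ) - 1) % (k / 3) = 0 ∧ ((y : ℕ) - 1) % (k / 3) ≠ 0))

/-- The graph on `k+1` vertices consisting of one vertex (vertex `0`) adjacent to all
vertices of two disjoint cliques, each on `k/2` vertices: vertices `1, …, k/2` form one
clique and vertices `k/2 + 1, …, k` form the other, with no edges between the cliques. -/
def twoCliquesApex (k : ℕ) : SimpleGraph (Fin (k + 1)) :=
  SimpleGraph.fromRel (fun x y =>
    ((x : ℕ) = 0) ∨
    ((x : ℕ) ≠ 0 ∧ (y : ℕ) ≠ 0 ∧ ((x : ℕ) ≤ k / 2 ↔ (y : ℕ) ≤ k / 2)))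

theorem twoCliquesApex_adj {k : ℕ} {x y : Fin (k + 1)} :
    (twoCliquesApex k).Adj x y ↔ (x : ℕ) ≠ y ∧
      ((x : ℕ) = 0 ∨ (y : ℕ) = 0 ∨ ((x : ℕ) ≤ k / 2 ↔ (y : ℕ) ≤ k / 2)) := by
  simp only [twoCliquesApex, SimpleGraph.fromRel_adj, ne_eq, Fin.ext_iff]
  tauto

/-- Compute a degree in a graph on `Fin n` from a finset of naturals listing the neighbours. -/
theorem degree'_eq_card {n : ℕ} {G : SimpleGraph (Fin n)} {v : Fin n} (s : Finset ℕ)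
    (hs : ∀ a, a ∈ s ↔ ∃ h : a < n, G.Adj v ⟨a, h⟩) : degree' G v = s.card := by
  rw [degree', ← Set.ncard_image_of_injective _ Fin.val_injective, ← Set.ncard_coe_finset]
  congr 1
  ext a
  simp only [Set.mem_image, SimpleGraph.mem_neighborSet, Finset.mem_coe, hs]
  constructor
  · rintro ⟨x, hx, rfl⟩
    exact ⟨x.2, hx⟩
  · rintro ⟨h, hx⟩
    exact ⟨⟨a, h⟩, hx, rfl⟩

theorem degree'_twoCliquesApex_zero (k : ℕ) : degree' (twoCliquesApex k) 0 = k := by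
  rw [degree'_eq_card (Finset.Ioc 0 k)]
  · simp
  · intro a
    simp only [twoCliquesApex_adj, Finset.mem_Ioc, Fin.val_zero, exists_prop]
    simp only [true_or, and_true]
    omega

theorem degree'_twoCliquesApex_of_ne_zero {k : ℕ} (hk : 2 ∣ k) {v : Fin (k + 1)}
    (hv : (v : ℕ) ≠ 0) : degree' (twoCliquesApex k) v = k / 2 := by
  have hvk := v.2
  by_cases h : (v : ℕ) ≤ k / 2
  · rw [degree'_eq_card ((Finset.Icc 0 (k / 2)).erase v)]
    · rw [Finset.card_erase_of_mem (by simpa using h)]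
      simp
    · intro a
      simp only [twoCliquesApex_adj, Finset.mem_erase, Finset.mem_Icc, exists_prop]
      omega
  · rw [degree'_eq_card ((insert 0 (Finset.Ioc (k / 2) k)).erase v)]
    · rw [Finset.card_erase_of_mem (by simp; omega), Finset.card_insert_of_notMem (by simp)]
      simp
      omega
    · intro a
      simp only [twoCliquesApex_adj, Finset.mem_erase, Finset.mem_insert, Finset.mem_Ioc,
        exists_prop]
      omega

theorem broomTree_adj_root {m i : ℕ} (h : 2 * m * i + 1 < 6 * m + 1) :
    (broomTree (6 * m)).Adj 0 ⟨2 * m * i + 1, h⟩ := by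
  have h3 : 6 * m / 3 = 2 * m := by omega
  rw [broomTree, SimpleGraph.fromRel_adj]
  refine ⟨by simp [Fin.ext_iff], Or.inl (Or.inl ⟨by simp, by simp, ?_⟩)⟩
  simp [h3]

theorem broomTree_adj_leaf {m i s : ℕ} (hs : 0 < s) (hsm : s < 2 * m)
    (h : 2 * m * i + 1 < 6 * m + 1) (h' : 2 * m * i + 1 + s < 6 * m + 1) :
    (broomTree (6 * m)).Adj ⟨2 * m * i + 1, h⟩ ⟨2 * m * i + 1 + s, h'⟩ := by
  have h3 : 6 * m / 3 = 2 * m := by omega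
  have e : 2 * m * i + 1 + s - 1 = s + 2 * m * i := by omega
  rw [broomTree, SimpleGraph.fromRel_adj]
  refine ⟨by simp [Fin.ext_iff, hs.ne'],
    Or.inl (Or.inr ⟨by simp, by simp, ?_, ?_, ?_⟩)⟩
  · simp only [h3, e, Nat.add_sub_cancel]
    rw [Nat.mul_div_cancel_left _ (by omega), Nat.add_mul_div_left _ _ (by omega),
      Nat.div_eq_of_lt hsm, zero_add]
  · simp [h3]
  · simp only [h3, e, Nat.add_mul_mod_self_left, Nat.mod_eq_of_lt hsm]
    omega

/-- Two distinct blocks of `2 * m` consecutive naturals do not both embed into one side of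
`{1, …, 3 * m} ∪ {3 * m + 1, …, 6 * m}`. -/
theorem false_of_two_blocks_same_side {m i j : ℕ} (hm : 0 < m) (hij : i < j) (hj : j < 3)
    (f : ℕ → ℕ) (hf : Set.InjOn f (Set.Iic (6 * m))) (hle : ∀ n ≤ 6 * m, f n ≤ 6 * m)
    (p : Prop)
    (hi : ∀ n ∈ Finset.Ioc (2 * m * i) (2 * m * i + 2 * m), f n ≠ 0 ∧ (f n ≤ 3 * m ↔ p))
    (hj' : ∀ n ∈ Finset.Ioc (2 * m * j) (2 * m * j + 2 * m), f n ≠ 0 ∧ (f n ≤ 3 * m ↔ p)) :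
    False := by
  have hij' : 2 * m * i + 2 * m ≤ 2 * m * j := by
    calc 2 * m * i + 2 * m = 2 * m * (i + 1) := by ring
      _ ≤ 2 * m * j := Nat.mul_le_mul_left _ hij
  have hjm : 2 * m * j + 2 * m ≤ 6 * m := by
    calc 2 * m * j + 2 * m = 2 * m * (j + 1) := by ring
      _ ≤ 2 * m * 3 := Nat.mul_le_mul_left _ hj
      _ = 6 * m := by ring
  set A := Finset.Ioc (2 * m * i) (2 * m * i + 2 * m) ∪
    Finset.Ioc (2 * m * j) (2 * m * j + 2 * m) with hA
  have hcard : A.card = 4 * m := by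
    rw [hA, Finset.card_union_of_disjoint]
    · simp only [Nat.card_Ioc]
      omega
    · rw [Finset.disjoint_left]
      intro a
      simp only [Finset.mem_Ioc]
      omega
  have hAle : ∀ n ∈ A, n ≤ 6 * m := by
    intro n
    simp only [hA, Finset.mem_union, Finset.mem_Ioc]
    omega
  have hAp : ∀ n ∈ A, f n ≠ 0 ∧ (f n ≤ 3 * m ↔ p) := fun n hn =>
    (Finset.mem_union.1 hn).elim (hi n) (hj' n)
  have hinj : Set.InjOn f A := hf.mono hAle
  by_cases hp : p
  · have := Finset.card_le_card_of_injOn (t := Finset.Ioc 0 (3 * m)) f (fun n hn => by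
      have := hAp n hn
      simp only [hp, iff_true] at this
      simp only [Finset.coe_Ioc, Set.mem_Ioc]
      omega) hinj
    simp only [Nat.card_Ioc] at this
    omega
  · have := Finset.card_le_card_of_injOn (t := Finset.Ioc (3 * m) (6 * m)) f (fun n hn => by
      have h1 := hAp n hn
      have h2 := hle n (hAle n hn)
      simp only [hp, iff_false] at h1
      simp only [Finset.coe_Ioc, Set.mem_Ioc]
      omega) hinj
    simp only [Nat.card_Ioc] at this
    omega

theorem not_contains_broomTree {m : ℕ} (hm : 0 < m) :
    ¬ Contains (twoCliquesApex (6 * m)) (broomTree (6 * m)) := by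
  rintro ⟨φ, hφ, hadj⟩
  have h2 : 6 * m / 2 = 3 * m := by omega
  set f : ℕ → ℕ := fun n => if h : n < 6 * m + 1 then (φ ⟨n, h⟩ : ℕ) else 0 with hfdef
  have f_eq : ∀ n (h : n < 6 * m + 1), f n = φ ⟨n, h⟩ := fun n h => by exact dif_pos h
  have hf : Set.InjOn f (Set.Iic (6 * m)) := by
    intro a ha b hb hab
    rw [f_eq a (Nat.lt_succ_of_le ha), f_eq b (Nat.lt_succ_of_le hb)] at hab
    exact Fin.ext_iff.1 (hφ (Fin.ext hab))
  have hle : ∀ n ≤ 6 * m, f n ≤ 6 * m := by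
    intro n hn
    rw [f_eq n (by omega)]
    omega
  have block_le : ∀ i < 3, 2 * m * i + 2 * m ≤ 6 * m := by
    intro i hi
    calc 2 * m * i + 2 * m = 2 * m * (i + 1) := by ring
      _ ≤ 2 * m * 3 := Nat.mul_le_mul_left _ hi
      _ = 6 * m := by ring
  have root_side : ∀ i < 3, f 0 ≠ 0 → f (2 * m * i + 1) ≠ 0 →
      (f (2 * m * i + 1) ≤ 3 * m ↔ f 0 ≤ 3 * m) := by
    intro i hi h0 h1
    have hlt : 2 * m * i + 1 < 6 * m + 1 := by have := block_le i hi; omega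
    have h := (twoCliquesApex_adj.1 (hadj (broomTree_adj_root hlt))).2
    rw [f_eq _ hlt] at h1 ⊢
    rw [f_eq 0 (by omega)] at h0 ⊢
    rw [h2] at h
    exact ((h.resolve_left h0).resolve_left h1).symm
  have star_side : ∀ i < 3,
      (∀ n ∈ Finset.Ioc (2 * m * i) (2 * m * i + 2 * m), f n ≠ 0) →
      ∀ n ∈ Finset.Ioc (2 * m * i) (2 * m * i + 2 * m),
        f n ≠ 0 ∧ (f n ≤ 3 * m ↔ f (2 * m * i + 1) ≤ 3 * m) := by
    intro i hi hne n hn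
    refine ⟨hne n hn, ?_⟩
    have hc := hne (2 * m * i + 1) (by simp; omega)
    have hn0 := hne n hn
    have := block_le i hi
    rw [Finset.mem_Ioc] at hn
    obtain ⟨s, rfl⟩ : ∃ s, n = 2 * m * i + 1 + s := ⟨n - (2 * m * i + 1), by omega⟩
    rcases Nat.eq_zero_or_pos s with rfl | hs
    · rfl
    have h := (twoCliquesApex_adj.1 (hadj (broomTree_adj_leaf hs (by omega)
      (by omega : 2 * m * i + 1 < 6 * m + 1) (by omega)))).2
    rw [f_eq _ (by omega)] at hc hn0 ⊢
    rw [f_eq (2 * m * i + 1) (by omega)]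
    rw [h2] at h
    exact ((h.resolve_left hc).resolve_left hn0).symm
  have key : ∀ i j, i < j → j < 3 →
      (∀ n ∈ Finset.Ioc (2 * m * i) (2 * m * i + 2 * m), f n ≠ 0) →
      (∀ n ∈ Finset.Ioc (2 * m * j) (2 * m * j + 2 * m), f n ≠ 0) →
      ¬ (f (2 * m * i + 1) ≤ 3 * m ↔ f (2 * m * j + 1) ≤ 3 * m) := by
    intro i j hij hj hi0 hj0 hs
    refine false_of_two_blocks_same_side hm hij hj f hf hle _ (star_side i (by omega) hi0) ?_
    rw [hs]
    exact star_side j hj hj0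
  have zero_unique : ∀ a ≤ 6 * m, ∀ b ≤ 6 * m, f a = 0 → f b = 0 → a = b :=
    fun a ha b hb h h' => hf ha hb (h.trans h'.symm)
  by_cases h0 : f 0 = 0
  · have hne : ∀ i < 3, ∀ n ∈ Finset.Ioc (2 * m * i) (2 * m * i + 2 * m), f n ≠ 0 := by
      intro i hi n hn h
      have := block_le i hi
      rw [Finset.mem_Ioc] at hn
      have := zero_unique n (by omega) 0 (by omega) h h0
      omega
    have k01 := key 0 1 (by omega) (by omega) (hne 0 (by omega)) (hne 1 (by omega))
    have k02 := key 0 2 (by omega) (by omega) (hne 0 (by omega)) (hne 2 (by omega))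
    have k12 := key 1 2 (by omega) (by omega) (hne 1 (by omega)) (hne 2 (by omega))
    tauto
  · have key' : ∀ i j, i < j → j < 3 →
        (∀ n ∈ Finset.Ioc (2 * m * i) (2 * m * i + 2 * m), f n ≠ 0) →
        ¬ ∀ n ∈ Finset.Ioc (2 * m * j) (2 * m * j + 2 * m), f n ≠ 0 := by
      intro i j hij hj hi0 hj0
      refine key i j hij hj hi0 hj0 ?_
      rw [root_side i (by omega) h0 (hi0 _ (by simp; omega)),
        root_side j hj h0 (hj0 _ (by simp; omega))]
    have disj : ∀ i j, i < j → j < 3 →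
        (¬ ∀ n ∈ Finset.Ioc (2 * m * i) (2 * m * i + 2 * m), f n ≠ 0) →
        ∀ n ∈ Finset.Ioc (2 * m * j) (2 * m * j + 2 * m), f n ≠ 0 := by
      intro i j hij hj hi0 b hb hfb
      push Not at hi0
      obtain ⟨a, ha, hfa⟩ := hi0
      have hij' : 2 * m * i + 2 * m ≤ 2 * m * j := by
        calc 2 * m * i + 2 * m = 2 * m * (i + 1) := by ring
          _ ≤ 2 * m * j := Nat.mul_le_mul_left _ hij
      have := block_le j hj
      rw [Finset.mem_Ioc] at ha hb
      have := zero_unique a (by omega) b (by omega) hfa hfb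
      omega
    have k01 := key' 0 1 (by omega) (by omega)
    have k02 := key' 0 2 (by omega) (by omega)
    have k12 := key' 1 2 (by omega) (by omega)
    have d01 := disj 0 1 (by omega) (by omega)
    have d02 := disj 0 2 (by omega) (by omega)
    have d12 := disj 1 2 (by omega) (by omega)
    tauto

/-- For `k` positive and divisible by `6`: the apex-plus-two-cliques graph has maximum
degree `k`, minimum degree `k/2`, and does not contain the tree consisting of a root
joined to the centres of three stars on `k/3` vertices each. -/
theorem twoCliques_maxDeg_minDeg_not_contains_broom (k : ℕ) (hk : 0 < k) (h6 : 6 ∣ k) :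
    (∀ v, degree' (twoCliquesApex k) v ≤ k) ∧
    (∃ v, degree' (twoCliquesApex k) v = k) ∧
    (∀ v, k / 2 ≤ degree' (twoCliquesApex k) v) ∧
    (∃ v, degree' (twoCliquesApex k) v = k / 2) ∧
    ¬ Contains (twoCliquesApex k) (broomTree k) := by
  have h2 : 2 ∣ k := by omega
  have hdeg : ∀ v, degree' (twoCliquesApex k) v = k ∨ degree' (twoCliquesApex k) v = k / 2 := by
    intro v
    by_cases hv : (v : ℕ) = 0
    · obtain rfl : v = 0 := Fin.ext hv
      exact Or.inl (degree'_twoCliquesApex_zero k)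
    · exact Or.inr (degree'_twoCliquesApex_of_ne_zero h2 hv)
  refine ⟨fun v => ?_, ⟨0, degree'_twoCliquesApex_zero k⟩, fun v => ?_,
    ⟨Fin.last k, degree'_twoCliquesApex_of_ne_zero h2 (by simp; omega)⟩, ?_⟩
  · have := hdeg v
    omega
  · have := hdeg v
    omega
  · obtain ⟨m, rfl⟩ := h6
    exact not_contains_broomTree (by omega)
end

section
/- Let k > 1 be an odd perfect square, and write √k for its (integer) square root. Let T be the tree on k+1 vertices consisting of a root vertex adjacent to the centres of √k pairwise disjoint stars, each star having √k vertices. Let G be the graph consisting of two disjoint cliques of orders (k−1)/2 and (k+1)/2, together with an independent set of (√k − 1)/2 further vertices, each of which is adjacent to all vertices of both cliques (and there are no edges between the two cliques or within the independent set). Then G does not contain T. -/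
open SimpleGraph Finset

/-- For `k = s^2`, the tree on `k+1` vertices consisting of a root (vertex `0`) adjacent to
the centres of `s` pairwise disjoint stars, each star on `s` vertices (a centre and `s - 1`
leaves). For `1 ≤ v ≤ k`, vertex `v` belongs to star number `(v-1)/s` and is the centre of
its star iff `(v-1) % s = 0`. -/
def starsTree (s : ℕ) : SimpleGraph (Fin (s ^ 2 + 1)) :=
  SimpleGraph.fromRel (fun x y =>
    ((x : ℕ) = 0 ∧ (y : ℕ) ≠ 0 ∧ ((y : ℕ) - 1) % s = 0) ∨
    ((x : ℕ) ≠ 0 ∧ (y : ℕ) ≠ 0 ∧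
      ((x : ℕ) - 1) / s = ((y : ℕ) - 1) / s ∧
      ((x : ℕ) - 1) % s = 0 ∧ ((y : ℕ) - 1) % s ≠ 0))

/-- For `k = s^2`, the graph on `k + (s-1)/2` vertices consisting of two disjoint cliques
of orders `(k-1)/2` (vertices `0, …, (k-1)/2 - 1`) and `(k+1)/2` (vertices
`(k-1)/2, …, k - 1`), together with an independent set of `(s-1)/2` further vertices
(vertices `k, …`), each adjacent to all vertices of both cliques; there are no edges
between the two cliques nor within the independent set. -/
def twoCliquesPlusIndep (s : ℕ) : SimpleGraph (Fin (s ^ 2 + (s - 1) / 2)) :=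
  SimpleGraph.fromRel (fun x y =>
    ((x : ℕ) < (s ^ 2 - 1) / 2 ∧ (y : ℕ) < (s ^ 2 - 1) / 2) ∨
    ((s ^ 2 - 1) / 2 ≤ (x : ℕ) ∧ (x : ℕ) < s ^ 2 ∧
      (s ^ 2 - 1) / 2 ≤ (y : ℕ) ∧ (y : ℕ) < s ^ 2) ∨
    (s ^ 2 ≤ (x : ℕ) ∧ (y : ℕ) < s ^ 2))

theorem one_add_card_centres_mul_card_le {V ι κ : Type*} [DecidableEq V] [Fintype ι] [Fintype κ]
    (G : SimpleGraph V) (X I : Finset V) (hX : ∀ x ∈ X, ∀ y, G.Adj x y → y ∈ X ∪ I)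
    (r : V) (hr : r ∈ X ∪ I) (w : ι × κ → V) (hw : Function.Injective w) (hrw : ∀ p, w p ≠ r)
    (o : κ) (hadj : ∀ i j, j ≠ o → G.Adj (w (i, o)) (w (i, j))) :
    1 + #{i | w (i, o) ∈ X} * Fintype.card κ ≤ #(X ∪ I) := by
  classical
  set C : Finset ι := {i | w (i, o) ∈ X} with hC
  have hnot : r ∉ (C ×ˢ (univ : Finset κ)).image w := by
    simp only [Finset.mem_image, not_exists, not_and]
    exact fun p _ => hrw p
  have hsub : insert r ((C ×ˢ (univ : Finset κ)).image w) ⊆ X ∪ I := by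
    refine Finset.insert_subset hr ?_
    rintro _ hy
    obtain ⟨⟨i, j⟩, hp, rfl⟩ := Finset.mem_image.1 hy
    have hi : w (i, o) ∈ X := by simpa [hC] using hp
    by_cases hj : j = o
    · subst hj
      exact Finset.mem_union_left _ hi
    · exact hX _ hi _ (hadj i j hj)
  have := Finset.card_le_card hsub
  rw [Finset.card_insert_of_notMem hnot, Finset.card_image_of_injective _ hw,
    Finset.card_product, Finset.card_univ] at this
  omega

theorem card_filter_mem_le {V ι : Type*} [DecidableEq V] [Fintype ι] (I : Finset V) (c : ι → V)
    (hc : Function.Injective c) : #{i | c i ∈ I} ≤ #I :=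
  Finset.card_le_card_of_injOn c (fun i hi => by simpa using hi) hc.injOn

theorem card_le_card_filter_add {ι : Type*} [Fintype ι] (p q : ι → Prop) [DecidablePred p]
    [DecidablePred q] (h : ∀ i, p i ∨ q i) : Fintype.card ι ≤ #{i | p i} + #{i | q i} := by
  classical
  refine le_trans (Finset.card_le_card fun i _ => ?_) (Finset.card_union_le _ _)
  simpa using h i

theorem Fin.card_filter_val_le {n a b : ℕ} (p : Fin n → Prop) [DecidablePred p]
    (h : ∀ x, p x → a ≤ (x : ℕ) ∧ (x : ℕ) < b) : #{x | p x} ≤ b - a := by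
  rw [← Nat.card_Ico]
  refine Finset.card_le_card_of_injOn Fin.val (fun x hx => ?_) Fin.val_injective.injOn
  simpa using h x (by simpa using hx)

/-- The `j`-th vertex of the `i`-th star of `starsTree s`; its centre is `j = 0`. -/
def starVertex (s : ℕ) (p : Fin s × Fin s) : Fin (s ^ 2 + 1) :=
  ⟨finProdFinEquiv p + 1, by have := (finProdFinEquiv p).isLt; rw [sq]; omega⟩

theorem starVertex_injective (s : ℕ) : Function.Injective (starVertex s) := fun p q h => by
  simp only [starVertex, Fin.mk.injEq] at h
  exact finProdFinEquiv.injective (Fin.ext (by omega))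

theorem starsTree_adj_root (s : ℕ) (i o : Fin s) (ho : (o : ℕ) = 0) :
    (starsTree s).Adj 0 (starVertex s (i, o)) := by
  rw [starsTree, SimpleGraph.fromRel_adj]
  refine ⟨fun h => ?_, Or.inl (Or.inl ⟨rfl, ?_, ?_⟩)⟩
  · simpa [starVertex] using congrArg Fin.val h
  · simp [starVertex]
  · simp [starVertex, ho]

theorem starsTree_adj_centre (s : ℕ) (i j o : Fin s) (ho : (o : ℕ) = 0) (hj : j ≠ o) :
    (starsTree s).Adj (starVertex s (i, o)) (starVertex s (i, j)) := by
  have hs : 0 < s := i.pos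
  rw [starsTree, SimpleGraph.fromRel_adj]
  refine ⟨fun h => hj ?_, Or.inl (Or.inr ⟨?_, ?_, ?_, ?_, ?_⟩)⟩
  · simpa using (congrArg Prod.snd (starVertex_injective s h)).symm
  · simp [starVertex]
  · simp [starVertex]
  · simp [starVertex, ho, hs, Nat.add_mul_div_left, Nat.div_eq_of_lt j.isLt]
  · simp [starVertex, ho]
  · simp only [starVertex, finProdFinEquiv_apply_val, Nat.add_sub_cancel, Nat.add_mul_mod_self_left,
      Nat.mod_eq_of_lt j.isLt]
    exact fun h => hj (Fin.ext (h.trans ho.symm))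

/-- Let `k = s^2 > 1` be an odd perfect square. The graph made of two disjoint cliques of
orders `(k-1)/2` and `(k+1)/2` plus an independent set of `(√k - 1)/2` vertices complete
to both cliques does not contain the tree consisting of a root joined to the centres of
`√k` stars on `√k` vertices each. -/
theorem twoCliquesPlusIndep_not_contains_starsTree (s : ℕ)
    (hodd : Odd (s ^ 2)) (h1 : 1 < s ^ 2) :
    ¬ Contains (twoCliquesPlusIndep s) (starsTree s) := by
  rintro ⟨φ, hφ, hadj⟩
  obtain ⟨t, rfl⟩ : Odd s := by
    rcases Nat.even_or_odd s with h | h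
    · exact absurd hodd (Nat.not_odd_iff_even.2 (h.pow_of_ne_zero two_ne_zero))
    · exact h
  have hsq : (2 * t + 1) ^ 2 = 4 * (t * t) + 4 * t + 1 := by ring
  let o : Fin (2 * t + 1) := 0
  let w := φ ∘ starVertex (2 * t + 1)
  have hw : Function.Injective w := hφ.comp (starVertex_injective _)
  let A : Finset (Fin ((2 * t + 1) ^ 2 + (2 * t + 1 - 1) / 2)) :=
    {x | (x : ℕ) < ((2 * t + 1) ^ 2 - 1) / 2}
  let B : Finset (Fin ((2 * t + 1) ^ 2 + (2 * t + 1 - 1) / 2)) :=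
    {x | ((2 * t + 1) ^ 2 - 1) / 2 ≤ (x : ℕ) ∧ (x : ℕ) < (2 * t + 1) ^ 2}
  let I : Finset (Fin ((2 * t + 1) ^ 2 + (2 * t + 1 - 1) / 2)) := {x | (2 * t + 1) ^ 2 ≤ (x : ℕ)}
  have hAcard : #A ≤ 2 * (t * t) + 2 * t + 1 :=
    (Fin.card_filter_val_le (a := 0) _ fun x hx => ⟨Nat.zero_le _, hx⟩).trans (by omega)
  have hBcard : #B ≤ 2 * (t * t) + 2 * t + 1 :=
    (Fin.card_filter_val_le _ fun x hx => hx).trans (by omega)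
  have hIcard : #I ≤ t :=
    (Fin.card_filter_val_le _ fun x hx => ⟨hx, x.isLt⟩).trans (by omega)
  have hAnbr : ∀ x ∈ A, ∀ y, (twoCliquesPlusIndep (2 * t + 1)).Adj x y → y ∈ A ∪ I := by
    intro x hx y hxy
    simp only [twoCliquesPlusIndep, SimpleGraph.fromRel_adj] at hxy
    simp only [A, I, Finset.mem_union, Finset.mem_filter, Finset.mem_univ, true_and] at hx ⊢
    omega
  have hBnbr : ∀ x ∈ B, ∀ y, (twoCliquesPlusIndep (2 * t + 1)).Adj x y → y ∈ B ∪ I := by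
    intro x hx y hxy
    simp only [twoCliquesPlusIndep, SimpleGraph.fromRel_adj] at hxy
    simp only [B, I, Finset.mem_union, Finset.mem_filter, Finset.mem_univ, true_and] at hx ⊢
    omega
  have hInbr : ∀ x ∈ I, ∀ y, (twoCliquesPlusIndep (2 * t + 1)).Adj x y → y ∈ A ∨ y ∈ B := by
    intro x hx y hxy
    simp only [twoCliquesPlusIndep, SimpleGraph.fromRel_adj] at hxy
    simp only [A, B, I, Finset.mem_filter, Finset.mem_univ, true_and] at hx ⊢
    omega
  have hroot : ∀ i, (twoCliquesPlusIndep (2 * t + 1)).Adj (φ 0) (w (i, o)) :=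
    fun i => hadj (starsTree_adj_root _ i o rfl)
  have hfew : ∀ X : Finset (Fin ((2 * t + 1) ^ 2 + (2 * t + 1 - 1) / 2)),
      #X ≤ 2 * (t * t) + 2 * t + 1 →
      (∀ x ∈ X, ∀ y, (twoCliquesPlusIndep (2 * t + 1)).Adj x y → y ∈ X ∪ I) →
      φ 0 ∈ X ∪ I → #{i | w (i, o) ∈ X} ≤ t := by
    intro X hXcard hX hr
    have hle := one_add_card_centres_mul_card_le _ X I hX (φ 0) hr w hw
      (fun p hp => by simpa [starVertex] using congrArg Fin.val (hφ hp)) o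
      (fun i j hj => hadj (starsTree_adj_centre _ i j o rfl hj))
    have hXI := Finset.card_union_le X I
    rw [Fintype.card_fin] at hle
    by_contra! hlt
    have := Nat.mul_le_mul_right (2 * t + 1) (Nat.succ_le_of_lt hlt)
    have : (t + 1) * (2 * t + 1) = 2 * (t * t) + 3 * t + 1 := by ring
    simp only [Nat.succ_eq_add_one] at *
    omega
  have hcI : #{i | w (i, o) ∈ I} ≤ t :=
    (card_filter_mem_le I (fun i => w (i, o))
      (hw.comp (Prod.mk_left_injective o))).trans hIcard
  have hclique : ∀ X : Finset (Fin ((2 * t + 1) ^ 2 + (2 * t + 1 - 1) / 2)),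
      #X ≤ 2 * (t * t) + 2 * t + 1 →
      (∀ x ∈ X, ∀ y, (twoCliquesPlusIndep (2 * t + 1)).Adj x y → y ∈ X ∪ I) →
      φ 0 ∉ X := by
    intro X hXcard hX hr
    have h := card_le_card_filter_add (fun i => w (i, o) ∈ X) (fun i => w (i, o) ∈ I)
      fun i => Finset.mem_union.1 (hX _ hr _ (hroot i))
    have := hfew X hXcard hX (Finset.mem_union_left _ hr)
    rw [Fintype.card_fin] at h
    omega
  have hrI : φ 0 ∈ I := by
    have hA := hclique A hAcard hAnbr
    have hB := hclique B hBcard hBnbr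
    simp only [A, B, I, Finset.mem_filter, Finset.mem_univ, true_and] at hA hB ⊢
    omega
  have h := card_le_card_filter_add (fun i => w (i, o) ∈ A) (fun i => w (i, o) ∈ B)
    fun i => hInbr _ hrI _ (hroot i)
  have hA := hfew A hAcard hAnbr (Finset.mem_union_right _ hrI)
  have hB := hfew B hBcard hBnbr (Finset.mem_union_right _ hrI)
  rw [Fintype.card_fin] at h
  omega
end
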